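/- arXiv:1105.5066 — 4 statements merged into one kernel-verified Lean document; each statement's English description precedes it below -/
import Mathlib

section
/- (Legendre–Cauchy–Dehn theorem: infinitesimal rigidity of convex polyhedra.) Let V ⊂ ℝ³ be a finite set, P = convexHull(V), and assume: the interior of P is nonempty; every v ∈ V is an extreme point of P; and P is simplicial, i.e., every exposed face of P whose affine span has dimension 2 contains exactly three points of V. Call an unordered pair {v, w} of distinct points of V an edge if the segment [v, w] is an exposed face of P. If q : V → ℝ³ satisfies ⟨v − w, q(v) − q(w)⟩ = 0 for every edge {v, w} (an isometric infinitesimal deformation), then there exist ω, b ∈ ℝ³ such that q(v) = ω × v + b for every v ∈ V (the deformation is the restriction of an infinitesimal isometry of ℝ³). -/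
open Matrix

section

/-- The scalar triple product of three vectors of `ℝ³`. -/
def tripleProd (u v w : Fin 3 → ℝ) : ℝ := u ⬝ᵥ crossProduct v w

theorem tripleProd_rotate (u v w : Fin 3 → ℝ) : tripleProd v w u = tripleProd u v w := by
  simp only [tripleProd, dotProduct, Fin.sum_univ_three, cross_apply, cons_val]
  ring

theorem tripleProd_swap (u v w : Fin 3 → ℝ) : tripleProd v u w = -tripleProd u v w := by
  simp only [tripleProd, dotProduct, Fin.sum_univ_three, cross_apply, cons_val]
  ring

theorem cross_dotProduct_eq (u v w : Fin 3 → ℝ) : crossProduct u v ⬝ᵥ w = tripleProd u v w := by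
  simp only [tripleProd, dotProduct, Fin.sum_univ_three, cross_apply, cons_val]
  ring

theorem tripleProd_self_left (u v : Fin 3 → ℝ) : tripleProd u u v = 0 := by
  simp only [tripleProd, dotProduct, Fin.sum_univ_three, cross_apply, cons_val]
  ring

theorem tripleProd_self_right (u v : Fin 3 → ℝ) : tripleProd v u u = 0 := by
  simp only [tripleProd, dotProduct, Fin.sum_univ_three, cross_apply, cons_val]
  ring

theorem tripleProd_self_outer (u v : Fin 3 → ℝ) : tripleProd u v u = 0 := by
  simp only [tripleProd, dotProduct, Fin.sum_univ_three, cross_apply, cons_val]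
  ring

/-- Cramer's rule in `ℝ³`. -/
theorem tripleProd_smul_eq (u v w c : Fin 3 → ℝ) :
    tripleProd u v w • c =
      tripleProd c v w • u + tripleProd u c w • v + tripleProd u v c • w := by
  ext i
  fin_cases i <;>
  · simp only [tripleProd, dotProduct, Fin.sum_univ_three, cross_apply, cons_val, Pi.smul_apply,
      Pi.add_apply, smul_eq_mul, Fin.mk_zero, Fin.mk_one, Fin.reduceFinMk]
    ring

theorem exists_eq_combination {u v w : Fin 3 → ℝ} (h : tripleProd u v w ≠ 0) (c : Fin 3 → ℝ) :
    ∃ α β γ : ℝ, c = α • u + β • v + γ • w := by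
  refine ⟨(tripleProd u v w)⁻¹ * tripleProd c v w, (tripleProd u v w)⁻¹ * tripleProd u c w,
    (tripleProd u v w)⁻¹ * tripleProd u v c, ?_⟩
  rw [mul_smul, mul_smul, mul_smul, ← smul_add, ← smul_add, ← tripleProd_smul_eq,
    inv_smul_smul₀ h]

theorem exists_dotProduct_eq {u v w : Fin 3 → ℝ} (h : tripleProd u v w ≠ 0) (a b c : ℝ) :
    ∃ y : Fin 3 → ℝ, y ⬝ᵥ u = a ∧ y ⬝ᵥ v = b ∧ y ⬝ᵥ w = c := by
  refine ⟨(tripleProd u v w)⁻¹ •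
    (a • crossProduct v w + b • crossProduct w u + c • crossProduct u v), ?_, ?_, ?_⟩ <;>
  · simp only [smul_dotProduct, add_dotProduct, cross_dotProduct_eq,
      tripleProd_self_right, tripleProd_self_outer, smul_eq_mul, tripleProd_rotate u v w,
      tripleProd_rotate w u v]
    try rw [← tripleProd_rotate w u v]
    field_simp
    try ring

theorem eq_of_dotProduct_eq {u v w : Fin 3 → ℝ} (h : tripleProd u v w ≠ 0) {y z : Fin 3 → ℝ}
    (hu : y ⬝ᵥ u = z ⬝ᵥ u) (hv : y ⬝ᵥ v = z ⬝ᵥ v) (hw : y ⬝ᵥ w = z ⬝ᵥ w) : y = z := by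
  refine dotProduct_eq _ _ fun c => ?_
  obtain ⟨α, β, γ, rfl⟩ := exists_eq_combination h c
  simp only [dotProduct_add, dotProduct_smul, hu, hv, hw]

theorem eq_smul_cross {u v w : Fin 3 → ℝ} (h : tripleProd u v w ≠ 0) {y : Fin 3 → ℝ}
    (hu : y ⬝ᵥ u = 0) (hv : y ⬝ᵥ v = 0) :
    y = ((tripleProd u v w)⁻¹ * y ⬝ᵥ w) • crossProduct u v := by
  refine eq_of_dotProduct_eq h ?_ ?_ ?_ <;>
  simp only [smul_dotProduct, cross_dotProduct_eq, tripleProd_self_outer, tripleProd_self_right,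
    smul_eq_mul, mul_zero, hu, hv]
  field_simp

theorem cross_ne_zero_of_tripleProd {u v w : Fin 3 → ℝ} (h : tripleProd u v w ≠ 0) :
    crossProduct u v ≠ 0 := by
  intro h0
  rw [← cross_dotProduct_eq, h0, zero_dotProduct] at h
  exact h rfl

/-- The vector `y` with `y ⬝ᵥ u = y ⬝ᵥ v = y ⬝ᵥ w = 1`. -/
noncomputable def polarVertex (u v w : Fin 3 → ℝ) : Fin 3 → ℝ :=
  (tripleProd u v w)⁻¹ • (crossProduct v w + crossProduct w u + crossProduct u v)

theorem polarVertex_rotate (u v w : Fin 3 → ℝ) : polarVertex v w u = polarVertex u v w := by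
  rw [polarVertex, polarVertex, tripleProd_rotate]
  congr 1
  abel

theorem polarVertex_dotProduct_left {u v w : Fin 3 → ℝ} (h : tripleProd u v w ≠ 0) :
    polarVertex u v w ⬝ᵥ u = 1 := by
  simp only [polarVertex, smul_dotProduct, add_dotProduct, cross_dotProduct_eq,
    tripleProd_self_right, tripleProd_self_outer, tripleProd_rotate u v w, smul_eq_mul, add_zero]
  exact inv_mul_cancel₀ h

theorem polarVertex_dotProduct_middle {u v w : Fin 3 → ℝ} (h : tripleProd u v w ≠ 0) :
    polarVertex u v w ⬝ᵥ v = 1 := by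
  rw [← polarVertex_rotate]
  exact polarVertex_dotProduct_left (by rwa [tripleProd_rotate])

theorem polarVertex_dotProduct_right {u v w : Fin 3 → ℝ} (h : tripleProd u v w ≠ 0) :
    polarVertex u v w ⬝ᵥ w = 1 := by
  rw [← polarVertex_rotate]
  exact polarVertex_dotProduct_middle (by rwa [tripleProd_rotate])

/-- The data extracted from a simplicial polytope with vertex set `W` and `0` in its interior. -/
structure IsSimplicialAround (W : Finset (Fin 3 → ℝ)) : Prop where
  eq_zero_of_nonpos : ∀ y : Fin 3 → ℝ, (∀ p ∈ W, y ⬝ᵥ p ≤ 0) → y = 0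
  lt_one : ∀ y : Fin 3 → ℝ, (∀ p ∈ W, y ⬝ᵥ p ≤ 1) → ∀ u ∈ W, ∀ v ∈ W, ∀ w ∈ W,
    tripleProd u v w ≠ 0 → y ⬝ᵥ u = 1 → y ⬝ᵥ v = 1 → y ⬝ᵥ w = 1 →
    ∀ p ∈ W, p ≠ u → p ≠ v → p ≠ w → y ⬝ᵥ p < 1
  mem_of_combination : ∀ u ∈ W, ∀ v ∈ W, ∀ w ∈ W, ∀ p ∈ W, ∀ α β γ : ℝ, 0 ≤ α → 0 ≤ β → 0 ≤ γ →
    α + β + γ ≤ 1 → p = α • u + β • v + γ • w → p = u ∨ p = v ∨ p = w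

/-- `u, v, w` are, in positive order, the vertices of a facet of the polytope spanned by `W`. -/
structure IsFacet (W : Finset (Fin 3 → ℝ)) (u v w : Fin 3 → ℝ) : Prop where
  left_mem : u ∈ W
  middle_mem : v ∈ W
  right_mem : w ∈ W
  tripleProd_pos : 0 < tripleProd u v w
  lt_one : ∀ p ∈ W, p ≠ u → p ≠ v → p ≠ w → polarVertex u v w ⬝ᵥ p < 1

variable {W : Finset (Fin 3 → ℝ)}

namespace IsFacet

variable {u v w : Fin 3 → ℝ}

theorem rotate (h : IsFacet W u v w) : IsFacet W v w u :=
  ⟨h.middle_mem, h.right_mem, h.left_mem, by rw [tripleProd_rotate]; exact h.tripleProd_pos,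
    fun p hp h1 h2 h3 => by rw [polarVertex_rotate]; exact h.lt_one p hp h3 h1 h2⟩

theorem dotProduct_left (h : IsFacet W u v w) : polarVertex u v w ⬝ᵥ u = 1 :=
  polarVertex_dotProduct_left h.tripleProd_pos.ne'

theorem dotProduct_middle (h : IsFacet W u v w) : polarVertex u v w ⬝ᵥ v = 1 :=
  polarVertex_dotProduct_middle h.tripleProd_pos.ne'

theorem dotProduct_right (h : IsFacet W u v w) : polarVertex u v w ⬝ᵥ w = 1 :=
  polarVertex_dotProduct_right h.tripleProd_pos.ne'

theorem dotProduct_le_one (h : IsFacet W u v w) {p : Fin 3 → ℝ} (hp : p ∈ W) :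
    polarVertex u v w ⬝ᵥ p ≤ 1 := by
  by_cases h1 : p = u
  · rw [h1, h.dotProduct_left]
  by_cases h2 : p = v
  · rw [h2, h.dotProduct_middle]
  by_cases h3 : p = w
  · rw [h3, h.dotProduct_right]
  exact (h.lt_one p hp h1 h2 h3).le

theorem eq_of_dotProduct_eq_one (h : IsFacet W u v w) {p : Fin 3 → ℝ} (hp : p ∈ W)
    (h1 : polarVertex u v w ⬝ᵥ p = 1) : p = u ∨ p = v ∨ p = w := by
  by_contra! hne
  exact (h.lt_one p hp hne.1 hne.2.1 hne.2.2).ne h1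

theorem left_ne_middle (h : IsFacet W u v w) : u ≠ v := by
  rintro rfl
  exact h.tripleProd_pos.ne' (tripleProd_self_left _ _)

/-- The polar vertices of adjacent facets. -/
theorem polarVertex_adjacent {a b : Fin 3 → ℝ} (ha : IsFacet W u v a) (hb : IsFacet W v u b) :
    ∃ t : ℝ, 0 < t ∧ polarVertex v u b = polarVertex u v a + t • crossProduct v u := by
  have hab : b ≠ a := by
    rintro rfl
    have h1 := ha.tripleProd_pos
    have h2 := hb.tripleProd_pos
    rw [tripleProd_swap] at h2
    linarith
  have h := eq_smul_cross hb.tripleProd_pos.ne' (y := polarVertex v u b - polarVertex u v a)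
    (by rw [sub_dotProduct, hb.dotProduct_left, ha.dotProduct_middle, sub_self])
    (by rw [sub_dotProduct, hb.dotProduct_middle, ha.dotProduct_left, sub_self])
  refine ⟨_, ?_, by rw [← h, add_sub_cancel]⟩
  have hlt := ha.lt_one b hb.right_mem hb.rotate.left_ne_middle.symm
    hb.rotate.rotate.left_ne_middle hab
  have hp := hb.tripleProd_pos
  rw [sub_dotProduct, hb.dotProduct_right]
  have : 0 < 1 - polarVertex u v a ⬝ᵥ b := by linarith
  positivity

theorem right_unique {a b : Fin 3 → ℝ} (ha : IsFacet W u v a) (hb : IsFacet W u v b) : a = b := by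
  by_contra hab
  have key : ∀ {a b : Fin 3 → ℝ}, IsFacet W u v a → IsFacet W u v b → a ≠ b →
      0 < (tripleProd u v a)⁻¹ * (polarVertex u v a - polarVertex u v b) ⬝ᵥ a := by
    intro a b ha hb hab
    have hlt := hb.lt_one a ha.right_mem ha.rotate.rotate.left_ne_middle
      ha.rotate.left_ne_middle.symm hab
    have hp := ha.tripleProd_pos
    rw [sub_dotProduct, ha.dotProduct_right]
    have : 0 < 1 - polarVertex u v b ⬝ᵥ a := by linarith
    positivity
  have h1 := key ha hb hab
  have h2 := key hb ha (Ne.symm hab)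
  have e := eq_smul_cross ha.tripleProd_pos.ne' (y := polarVertex u v a - polarVertex u v b)
    (by rw [sub_dotProduct, ha.dotProduct_left, hb.dotProduct_left, sub_self])
    (by rw [sub_dotProduct, ha.dotProduct_middle, hb.dotProduct_middle, sub_self])
  have e2 := congrArg (· ⬝ᵥ b) e
  simp only [smul_dotProduct, cross_dotProduct_eq, smul_eq_mul] at e2
  have h3 : 0 < (polarVertex u v a - polarVertex u v b) ⬝ᵥ b := by
    rw [e2]
    exact mul_pos h1 hb.tripleProd_pos
  have h4 := pos_of_mul_pos_right h2 (inv_nonneg.2 hb.tripleProd_pos.le)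
  rw [sub_dotProduct] at h3 h4
  linarith

end IsFacet

namespace IsSimplicialAround

theorem isFacet (hW : IsSimplicialAround W) {u v w y : Fin 3 → ℝ} (hu : u ∈ W) (hv : v ∈ W)
    (hw : w ∈ W) (h : 0 < tripleProd u v w) (hyu : y ⬝ᵥ u = 1) (hyv : y ⬝ᵥ v = 1)
    (hyw : y ⬝ᵥ w = 1) (hy : ∀ p ∈ W, y ⬝ᵥ p ≤ 1) : IsFacet W u v w := by
  have e : polarVertex u v w = y := eq_of_dotProduct_eq h.ne'
    (by rw [hyu, polarVertex_dotProduct_left h.ne'])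
    (by rw [hyv, polarVertex_dotProduct_middle h.ne'])
    (by rw [hyw, polarVertex_dotProduct_right h.ne'])
  refine ⟨hu, hv, hw, h, ?_⟩
  rw [e]
  exact hW.lt_one y hy u hu v hv w hw h.ne' hyu hyv hyw

/-- Tilting a valid inequality until it becomes tight at a further point. -/
theorem exists_tilt (hW : IsSimplicialAround W) {y d : Fin 3 → ℝ} (hy : ∀ p ∈ W, y ⬝ᵥ p ≤ 1)
    (hd : d ≠ 0) : ∃ t : ℝ, ∃ p ∈ W, 0 < d ⬝ᵥ p ∧ (y + t • d) ⬝ᵥ p = 1 ∧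
      ∀ p' ∈ W, (y + t • d) ⬝ᵥ p' ≤ 1 := by
  have hne : (W.filter fun p => 0 < d ⬝ᵥ p).Nonempty := by
    by_contra h
    rw [Finset.not_nonempty_iff_eq_empty, Finset.filter_eq_empty_iff] at h
    exact hd (hW.eq_zero_of_nonpos d fun p hp => not_lt.1 (h hp))
  obtain ⟨p, hp, hmin⟩ := Finset.exists_min_image _ (fun p => (1 - y ⬝ᵥ p) / (d ⬝ᵥ p)) hne
  rw [Finset.mem_filter] at hp
  have hp0 := hp.2
  have ht : 0 ≤ (1 - y ⬝ᵥ p) / (d ⬝ᵥ p) := by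
    have := hy p hp.1
    have : 0 ≤ 1 - y ⬝ᵥ p := by linarith
    positivity
  refine ⟨(1 - y ⬝ᵥ p) / (d ⬝ᵥ p), p, hp.1, hp.2, ?_, fun p' hp' => ?_⟩
  · rw [add_dotProduct, smul_dotProduct, smul_eq_mul]
    field_simp
    ring
  · rw [add_dotProduct, smul_dotProduct, smul_eq_mul]
    by_cases h : 0 < d ⬝ᵥ p'
    · have := hmin p' (Finset.mem_filter.2 ⟨hp', h⟩)
      rw [le_div_iff₀ h] at this
      linarith
    · have := mul_nonpos_of_nonneg_of_nonpos ht (not_lt.1 h)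
      linarith [hy p' hp']

theorem exists_adjacent (hW : IsSimplicialAround W) {u v w : Fin 3 → ℝ} (h : IsFacet W u v w) :
    ∃ w', IsFacet W v u w' := by
  obtain ⟨t, p, hp, hdp, h1, hle⟩ := hW.exists_tilt (y := polarVertex u v w)
    (d := crossProduct v u) (fun p hp => h.dotProduct_le_one hp) (by
      have := cross_ne_zero_of_tripleProd h.tripleProd_pos.ne'
      rwa [← cross_anticomm, neg_ne_zero])
  rw [cross_dotProduct_eq] at hdp
  refine ⟨p, hW.isFacet h.middle_mem h.left_mem hp hdp ?_ ?_ h1 hle⟩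
  · rw [add_dotProduct, smul_dotProduct, cross_dotProduct_eq, tripleProd_self_outer, smul_zero,
      h.dotProduct_middle, add_zero]
  · rw [add_dotProduct, smul_dotProduct, cross_dotProduct_eq, tripleProd_self_right, smul_zero,
      h.dotProduct_left, add_zero]

theorem exists_isFacet (hW : IsSimplicialAround W) : ∃ u v w, IsFacet W u v w := by
  obtain ⟨t₁, u, hu, -, hu1, hle₁⟩ := hW.exists_tilt (y := 0) (d := ![1, 0, 0])
    (fun p _ => by simp) (by simp)
  set y₁ : Fin 3 → ℝ := 0 + t₁ • ![1, 0, 0]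
  have hu0 : u ≠ 0 := by
    rintro rfl
    simp at hu1
  obtain ⟨d, hd, hdu⟩ : ∃ d : Fin 3 → ℝ, d ≠ 0 ∧ d ⬝ᵥ u = 0 := by
    by_cases h : u 0 = 0 ∧ u 1 = 0
    · refine ⟨![1, 0, 0], by simp, ?_⟩
      simp [dotProduct, Fin.sum_univ_three, h.1]
    · refine ⟨![u 1, -u 0, 0], fun h0 => h ?_, ?_⟩
      · have h1 := congrFun h0 0
        have h2 := congrFun h0 1
        simp at h1 h2
        exact ⟨h2, h1⟩
      · simp only [dotProduct, Fin.sum_univ_three, cons_val]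
        ring
  obtain ⟨t₂, v, hv, hdv, hv1, hle₂⟩ := hW.exists_tilt hle₁ hd
  have hu2 : (y₁ + t₂ • d) ⬝ᵥ u = 1 := by
    rw [add_dotProduct, smul_dotProduct, hdu, hu1, smul_zero, add_zero]
  set y₂ := y₁ + t₂ • d
  have huv : crossProduct u v ≠ 0 := by
    intro h
    have e : (u ⬝ᵥ u) • v = (u ⬝ᵥ v) • u - crossProduct u (crossProduct u v) := by
      ext i
      fin_cases i <;>
      · simp only [dotProduct, Fin.sum_univ_three, cross_apply, cons_val, Pi.smul_apply,
          Pi.sub_apply, smul_eq_mul, Fin.mk_zero, Fin.mk_one, Fin.reduceFinMk]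
        ring
    rw [h, map_zero, sub_zero] at e
    have e2 := congrArg (d ⬝ᵥ ·) e
    simp only [dotProduct_smul, hdu, smul_eq_mul, mul_zero] at e2
    rcases mul_eq_zero.1 e2 with h3 | h3
    · exact hu0 (dotProduct_self_eq_zero.1 h3)
    · exact hdv.ne' h3
  obtain ⟨t₃, w, hw, hdw, hw1, hle₃⟩ := hW.exists_tilt hle₂ huv
  rw [cross_dotProduct_eq] at hdw
  refine ⟨u, v, w, hW.isFacet hu hv hw hdw ?_ ?_ hw1 hle₃⟩
  · rw [add_dotProduct, smul_dotProduct, cross_dotProduct_eq, tripleProd_self_outer, smul_zero,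
      hu2, add_zero]
  · rw [add_dotProduct, smul_dotProduct, cross_dotProduct_eq, tripleProd_self_right, smul_zero,
      hv1, add_zero]

end IsSimplicialAround

theorem IsFacet.dotProduct_lt_of_neg {u v a b c : Fin 3 → ℝ} (ha : IsFacet W u v a)
    (hb : IsFacet W v u b) {α β γ : ℝ} (hc : c = α • u + β • v + γ • a) (hγ : γ < 0) :
    polarVertex u v a ⬝ᵥ c < polarVertex v u b ⬝ᵥ c := by
  obtain ⟨t, ht, e⟩ := ha.polarVertex_adjacent hb
  have h : crossProduct v u ⬝ᵥ c = -(γ * tripleProd u v a) := by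
    rw [hc]
    simp only [dotProduct_add, dotProduct_smul, cross_dotProduct_eq, tripleProd_self_outer,
      tripleProd_self_right, tripleProd_swap u v a, smul_eq_mul]
    ring
  rw [e, add_dotProduct, smul_dotProduct, h, smul_eq_mul]
  have := mul_pos ht (neg_pos.2 (mul_neg_of_neg_of_pos hγ ha.tripleProd_pos))
  linarith

namespace IsSimplicialAround

/-- A nonempty adjacency-closed set of facets covers all directions. -/
theorem exists_cone (hW : IsSimplicialAround W)
    {R : (Fin 3 → ℝ) → (Fin 3 → ℝ) → (Fin 3 → ℝ) → Prop}
    (hR : ∀ u v w, R u v w → IsFacet W u v w) (hrot : ∀ u v w, R u v w → R v w u)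
    (hadj : ∀ u v w w', R u v w → IsFacet W v u w' → R v u w')
    (hne : ∃ u v w, R u v w) (c : Fin 3 → ℝ) :
    ∃ u v w, ∃ α β γ : ℝ, R u v w ∧ 0 ≤ α ∧ 0 ≤ β ∧ 0 ≤ γ ∧ c = α • u + β • v + γ • w := by
  classical
  obtain ⟨u₀, v₀, w₀, h₀⟩ := hne
  obtain ⟨⟨u, v, w⟩, hmem, hmax⟩ := Finset.exists_max_image
    ((W ×ˢ W ×ˢ W).filter fun x => R x.1 x.2.1 x.2.2)
    (fun x => polarVertex x.1 x.2.1 x.2.2 ⬝ᵥ c) ⟨(u₀, v₀, w₀), by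
      simp [h₀, (hR _ _ _ h₀).left_mem, (hR _ _ _ h₀).middle_mem, (hR _ _ _ h₀).right_mem]⟩
  simp only [Finset.mem_filter, Finset.mem_product] at hmem
  have hmax' : ∀ u' v' w', R u' v' w' → polarVertex u' v' w' ⬝ᵥ c ≤ polarVertex u v w ⬝ᵥ c := by
    intro u' v' w' h
    have hF := hR _ _ _ h
    exact hmax (u', v', w') (by simp [h, hF.left_mem, hF.middle_mem, hF.right_mem])
  have key : ∀ u' v' w' (α β γ : ℝ), R u' v' w' → polarVertex u' v' w' = polarVertex u v w →
      c = α • u' + β • v' + γ • w' → 0 ≤ γ := by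
    intro u' v' w' α β γ h e hc
    by_contra! hγ
    obtain ⟨b, hb⟩ := hW.exists_adjacent (hR _ _ _ h)
    have h1 := (hR _ _ _ h).dotProduct_lt_of_neg hb hc hγ
    have h2 := hmax' _ _ _ (hadj _ _ _ _ h hb)
    rw [e] at h1
    exact h1.not_ge h2
  have hRu := hmem.2
  obtain ⟨α, β, γ, hc⟩ := exists_eq_combination (hR _ _ _ hRu).tripleProd_pos.ne' c
  refine ⟨u, v, w, α, β, γ, hRu, ?_, ?_, ?_, hc⟩
  · exact key v w u β γ α (hrot _ _ _ hRu) (polarVertex_rotate _ _ _) (by rw [hc]; abel)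
  · exact key w u v γ α β (hrot _ _ _ (hrot _ _ _ hRu))
      ((polarVertex_rotate _ _ _).trans (polarVertex_rotate _ _ _)) (by rw [hc]; abel)
  · exact key u v w α β γ hRu rfl hc

/-- The facets around a vertex cover all directions modulo that vertex. -/
theorem exists_link_cone (hW : IsSimplicialAround W) {v a b : Fin 3 → ℝ} (h : IsFacet W v a b)
    (c : Fin 3 → ℝ) : ∃ w w', ∃ α β γ : ℝ, IsFacet W v w w' ∧ 0 ≤ β ∧ 0 ≤ γ ∧
      c = α • v + β • w + γ • w' := by
  classical
  obtain ⟨⟨w, w'⟩, hmem, hmax⟩ := Finset.exists_max_image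
    ((W ×ˢ W).filter fun x => IsFacet W v x.1 x.2)
    (fun x => polarVertex v x.1 x.2 ⬝ᵥ c) ⟨(a, b), by simp [h, h.middle_mem, h.right_mem]⟩
  simp only [Finset.mem_filter, Finset.mem_product] at hmem
  have hF := hmem.2
  have hmax' : ∀ u u', IsFacet W v u u' → polarVertex v u u' ⬝ᵥ c ≤ polarVertex v w w' ⬝ᵥ c :=
    fun u u' h => hmax (u, u') (by simp [h, h.middle_mem, h.right_mem])
  obtain ⟨α, β, γ, hc⟩ := exists_eq_combination hF.tripleProd_pos.ne' c
  refine ⟨w, w', α, β, γ, hF, ?_, ?_, hc⟩ <;> by_contra! hneg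
  · obtain ⟨d, hd⟩ := hW.exists_adjacent hF.rotate.rotate
    have h1 := hF.rotate.rotate.dotProduct_lt_of_neg hd
      (show c = γ • w' + α • v + β • w by rw [hc]; abel) hneg
    rw [polarVertex_rotate, polarVertex_rotate] at h1
    exact h1.not_ge (hmax' _ _ hd)
  · obtain ⟨d, hd⟩ := hW.exists_adjacent hF
    have h1 := hF.dotProduct_lt_of_neg hd hc hneg
    rw [← polarVertex_rotate w v d] at h1
    exact h1.not_ge (hmax' _ _ hd.rotate)

/-- An adjacency-closed nonempty set of facets touches every vertex. -/
theorem exists_mem_facet (hW : IsSimplicialAround W)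
    {R : (Fin 3 → ℝ) → (Fin 3 → ℝ) → (Fin 3 → ℝ) → Prop}
    (hR : ∀ u v w, R u v w → IsFacet W u v w) (hrot : ∀ u v w, R u v w → R v w u)
    (hadj : ∀ u v w w', R u v w → IsFacet W v u w' → R v u w')
    (hne : ∃ u v w, R u v w) {p : Fin 3 → ℝ} (hp : p ∈ W) : ∃ v w, R p v w := by
  obtain ⟨u, v, w, α, β, γ, h, hα, hβ, hγ, hc⟩ := hW.exists_cone hR hrot hadj hne p
  have hF := hR _ _ _ h
  have hle := hF.dotProduct_le_one hp
  rw [hc] at hle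
  simp only [dotProduct_add, dotProduct_smul, hF.dotProduct_left, hF.dotProduct_middle,
    hF.dotProduct_right, smul_eq_mul, mul_one] at hle
  rcases hW.mem_of_combination u hF.left_mem v hF.middle_mem w hF.right_mem p hp α β γ hα hβ hγ
    hle hc with rfl | rfl | rfl
  · exact ⟨_, _, h⟩
  · exact ⟨_, _, hrot _ _ _ h⟩
  · exact ⟨_, _, hrot _ _ _ (hrot _ _ _ h)⟩

theorem exists_isFacet_of_mem (hW : IsSimplicialAround W) {p : Fin 3 → ℝ} (hp : p ∈ W) :
    ∃ v w, IsFacet W p v w := by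
  refine hW.exists_mem_facet (fun _ _ _ h => h) (fun _ _ _ h => h.rotate)
    (fun _ _ _ _ _ h => h) hW.exists_isFacet hp

end IsSimplicialAround

section Stress

open Classical in
/-- The inverse triple product of the vertices of a facet, and zero for other triples. -/
noncomputable def facetWeight (W : Finset (Fin 3 → ℝ)) (u v w : Fin 3 → ℝ) : ℝ :=
  if IsFacet W u v w ∨ IsFacet W v u w then |tripleProd u v w|⁻¹ else 0

theorem facetWeight_swap (u v w : Fin 3 → ℝ) : facetWeight W v u w = facetWeight W u v w := by
  classical
  simp only [facetWeight, tripleProd_swap u v w, abs_neg]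
  exact if_congr or_comm rfl rfl

theorem facetWeight_rotate (u v w : Fin 3 → ℝ) : facetWeight W v w u = facetWeight W u v w := by
  have h1 : IsFacet W v w u ↔ IsFacet W u v w := ⟨fun h => h.rotate.rotate, fun h => h.rotate⟩
  have h2 : IsFacet W w v u ↔ IsFacet W v u w := ⟨fun h => h.rotate, fun h => h.rotate.rotate⟩
  rw [facetWeight, facetWeight, tripleProd_rotate, h1, h2]

theorem facetWeight_swap_right (u v w : Fin 3 → ℝ) :
    facetWeight W u w v = facetWeight W u v w := by
  rw [facetWeight_rotate v u w, facetWeight_swap]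

theorem facetWeight_nonneg (u v w : Fin 3 → ℝ) : 0 ≤ facetWeight W u v w := by
  rw [facetWeight]
  split_ifs <;> positivity

theorem IsFacet.facetWeight_eq {u v w : Fin 3 → ℝ} (h : IsFacet W u v w) :
    facetWeight W u v w = (tripleProd u v w)⁻¹ := by
  rw [facetWeight, if_pos (Or.inl h), abs_of_pos h.tripleProd_pos]

theorem facetWeight_eq_zero {u v w : Fin 3 → ℝ} (h : ¬ IsFacet W u v w)
    (h' : ¬ IsFacet W v u w) : facetWeight W u v w = 0 := by
  rw [facetWeight, if_neg (not_or.2 ⟨h, h'⟩)]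

/-- The edges of the polytope spanned by `W`, as sides of facets. -/
def IsEdge (W : Finset (Fin 3 → ℝ)) (v w : Fin 3 → ℝ) : Prop := ∃ a, IsFacet W v w a

theorem IsEdge.symm (hW : IsSimplicialAround W) {v w : Fin 3 → ℝ} (h : IsEdge W v w) :
    IsEdge W w v :=
  let ⟨_, ha⟩ := h
  hW.exists_adjacent ha

theorem facetWeight_eq_zero_of_not_isEdge (hW : IsSimplicialAround W) {v w : Fin 3 → ℝ}
    (h : ¬ IsEdge W v w) (u : Fin 3 → ℝ) : facetWeight W v w u = 0 :=
  facetWeight_eq_zero (fun h1 => h ⟨_, h1⟩) fun h1 => h (IsEdge.symm hW ⟨_, h1⟩)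

theorem sum_facetWeight {M : Type*} [AddCommGroup M] [Module ℝ M] {v w a b : Fin 3 → ℝ}
    (ha : IsFacet W v w a) (hb : IsFacet W w v b) (f : (Fin 3 → ℝ) → M) :
    ∑ u ∈ W, facetWeight W v w u • f u =
      (tripleProd v w a)⁻¹ • f a + (tripleProd w v b)⁻¹ • f b := by
  classical
  have hab : a ≠ b := by
    rintro rfl
    have h1 := ha.tripleProd_pos
    have h2 := hb.tripleProd_pos
    rw [tripleProd_swap] at h2
    linarith
  rw [← Finset.sum_subset (s₁ := {a, b})]
  · rw [Finset.sum_pair hab, ha.facetWeight_eq, ← facetWeight_swap, hb.facetWeight_eq]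
  · intro x hx
    rcases Finset.mem_insert.1 hx with rfl | hx
    · exact ha.right_mem
    · rw [Finset.mem_singleton.1 hx]
      exact hb.right_mem
  · intro x _ hx
    simp only [Finset.mem_insert, Finset.mem_singleton, not_or] at hx
    rw [facetWeight_eq_zero (fun h => hx.1 (h.right_unique ha))
      (fun h => hx.2 (h.right_unique hb)), zero_smul]

/-- The weighted sum of the two vertices facing an edge. -/
noncomputable def oppositeSum (W : Finset (Fin 3 → ℝ)) (v w : Fin 3 → ℝ) : Fin 3 → ℝ :=
  ∑ u ∈ W, facetWeight W v w u • u

theorem oppositeSum_swap (v w : Fin 3 → ℝ) : oppositeSum W w v = oppositeSum W v w :=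
  Finset.sum_congr rfl fun u _ => by rw [facetWeight_swap]

/-- The coefficient of `w` when `oppositeSum W v w` is expanded in `w` and `v`. -/
noncomputable def edgeCoeff (W : Finset (Fin 3 → ℝ)) (v w : Fin 3 → ℝ) : ℝ :=
  (crossProduct (oppositeSum W v w) v ⬝ᵥ crossProduct w v) /
    (crossProduct w v ⬝ᵥ crossProduct w v)

theorem edgeCoeff_eq_zero_of_not_isEdge (hW : IsSimplicialAround W) {v w : Fin 3 → ℝ}
    (h : ¬ IsEdge W v w) : edgeCoeff W v w = 0 := by
  have h0 : oppositeSum W v w = 0 := Finset.sum_eq_zero fun u _ => by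
    rw [facetWeight_eq_zero_of_not_isEdge hW h, zero_smul]
  rw [edgeCoeff, h0, map_zero, LinearMap.zero_apply, zero_dotProduct, zero_div]

theorem oppositeSum_eq (hW : IsSimplicialAround W) (v w : Fin 3 → ℝ) :
    oppositeSum W v w = edgeCoeff W v w • w + edgeCoeff W w v • v := by
  by_cases h : IsEdge W v w
  · obtain ⟨a, ha⟩ := h
    obtain ⟨b, hb⟩ := hW.exists_adjacent ha
    have hwv : crossProduct w v ≠ 0 := cross_ne_zero_of_tripleProd hb.tripleProd_pos.ne'
    have hn : crossProduct w v ⬝ᵥ crossProduct w v ≠ 0 :=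
      fun h0 => hwv (dotProduct_self_eq_zero.1 h0)
    have hn' : crossProduct v w ⬝ᵥ crossProduct v w = crossProduct w v ⬝ᵥ crossProduct w v := by
      rw [← cross_anticomm, neg_dotProduct_neg]
    have hz : crossProduct w v ⬝ᵥ oppositeSum W v w = 0 := by
      rw [oppositeSum, sum_facetWeight ha hb (fun u => u), dotProduct_add, dotProduct_smul,
        dotProduct_smul, cross_dotProduct_eq, cross_dotProduct_eq, tripleProd_swap v w a,
        smul_eq_mul, smul_eq_mul, mul_neg, inv_mul_cancel₀ ha.tripleProd_pos.ne',
        inv_mul_cancel₀ hb.tripleProd_pos.ne', neg_add_cancel]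
    rw [edgeCoeff, edgeCoeff, oppositeSum_swap v w, hn']
    refine smul_right_injective _ hn ?_
    simp only [smul_add, smul_smul, mul_div_cancel₀ _ hn]
    generalize oppositeSum W v w = z at hz
    have e : (crossProduct w v ⬝ᵥ crossProduct w v) • z =
        (crossProduct w v ⬝ᵥ z) • crossProduct w v +
        ((crossProduct z v ⬝ᵥ crossProduct w v) • w +
        (crossProduct z w ⬝ᵥ crossProduct v w) • v) := by
      ext i
      fin_cases i <;>
      · simp only [dotProduct, Fin.sum_univ_three, cross_apply, cons_val, Pi.smul_apply,
          Pi.add_apply, smul_eq_mul, Fin.mk_zero, Fin.mk_one, Fin.reduceFinMk]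
        ring
    rw [e, hz, zero_smul, zero_add]
  · have h' : ¬ IsEdge W w v := fun h1 => h (h1.symm hW)
    rw [edgeCoeff_eq_zero_of_not_isEdge hW h, edgeCoeff_eq_zero_of_not_isEdge hW h', zero_smul,
      zero_smul, add_zero]
    exact Finset.sum_eq_zero fun u _ => by
      rw [facetWeight_eq_zero_of_not_isEdge hW h, zero_smul]

/-- The jump across the edge `vw` of the piecewise linear function with values `x` at the
vertices. -/
noncomputable def edgeJump (W : Finset (Fin 3 → ℝ)) (x : (Fin 3 → ℝ) → ℝ) (v w : Fin 3 → ℝ) : ℝ :=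
  ∑ u ∈ W, facetWeight W v w u * x u - edgeCoeff W v w * x w - edgeCoeff W w v * x v

theorem edgeJump_swap (x : (Fin 3 → ℝ) → ℝ) (v w : Fin 3 → ℝ) :
    edgeJump W x w v = edgeJump W x v w := by
  simp only [edgeJump, facetWeight_swap v w]
  ring

theorem edgeJump_eq_zero_of_not_isEdge (hW : IsSimplicialAround W) {v w : Fin 3 → ℝ}
    (h : ¬ IsEdge W v w) (x : (Fin 3 → ℝ) → ℝ) : edgeJump W x v w = 0 := by
  have h' : ¬ IsEdge W w v := fun h1 => h (h1.symm hW)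
  simp [edgeJump, edgeCoeff_eq_zero_of_not_isEdge hW h, edgeCoeff_eq_zero_of_not_isEdge hW h',
    facetWeight_eq_zero_of_not_isEdge hW h]

theorem edgeJump_add (x y : (Fin 3 → ℝ) → ℝ) (v w : Fin 3 → ℝ) :
    edgeJump W (fun p => x p + y p) v w = edgeJump W x v w + edgeJump W y v w := by
  simp only [edgeJump, mul_add, Finset.sum_add_distrib]
  ring

theorem edgeJump_smul (c : ℝ) (x : (Fin 3 → ℝ) → ℝ) (v w : Fin 3 → ℝ) :
    edgeJump W (fun p => c * x p) v w = c * edgeJump W x v w := by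
  simp only [edgeJump, mul_left_comm _ c, ← Finset.mul_sum]
  ring

theorem sum_facetWeight_mul_dotProduct (v w y : Fin 3 → ℝ) :
    ∑ u ∈ W, facetWeight W v w u * y ⬝ᵥ u = y ⬝ᵥ oppositeSum W v w := by
  simp only [oppositeSum, dotProduct_sum, dotProduct_smul, smul_eq_mul]

theorem edgeJump_dotProduct (hW : IsSimplicialAround W) (y v w : Fin 3 → ℝ) :
    edgeJump W (fun p => y ⬝ᵥ p) v w = 0 := by
  rw [edgeJump, sum_facetWeight_mul_dotProduct, oppositeSum_eq hW]
  simp only [dotProduct_add, dotProduct_smul, smul_eq_mul]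
  ring

theorem edgeJump_one_nonneg (hW : IsSimplicialAround W) (v w : Fin 3 → ℝ) :
    0 ≤ edgeJump W (fun _ => 1) v w := by
  by_cases h : IsEdge W v w
  · obtain ⟨a, ha⟩ := h
    have h0 := edgeJump_dotProduct hW (polarVertex v w a) v w
    rw [edgeJump, ha.dotProduct_left, ha.dotProduct_middle] at h0
    have : ∑ u ∈ W, facetWeight W v w u * polarVertex v w a ⬝ᵥ u ≤
        ∑ u ∈ W, facetWeight W v w u * 1 := Finset.sum_le_sum fun u hu =>
      mul_le_mul_of_nonneg_left (ha.dotProduct_le_one hu) (facetWeight_nonneg _ _ _)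
    rw [edgeJump]
    linarith
  · rw [edgeJump_eq_zero_of_not_isEdge hW h]

theorem edgeJump_one_pos (hW : IsSimplicialAround W) {v w : Fin 3 → ℝ} (h : IsEdge W v w) :
    0 < edgeJump W (fun _ => 1) v w := by
  obtain ⟨a, ha⟩ := h
  obtain ⟨b, hb⟩ := hW.exists_adjacent ha
  have h0 := edgeJump_dotProduct hW (polarVertex v w a) v w
  rw [edgeJump, ha.dotProduct_left, ha.dotProduct_middle] at h0
  have : ∑ u ∈ W, facetWeight W v w u * polarVertex v w a ⬝ᵥ u <
      ∑ u ∈ W, facetWeight W v w u * 1 := by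
    refine Finset.sum_lt_sum (fun u hu => mul_le_mul_of_nonneg_left
      (ha.dotProduct_le_one hu) (facetWeight_nonneg _ _ _)) ⟨b, hb.right_mem, ?_⟩
    rw [← facetWeight_swap, hb.facetWeight_eq]
    refine mul_lt_mul_of_pos_left ?_ (inv_pos.2 hb.tripleProd_pos)
    refine ha.lt_one b hb.right_mem hb.rotate.left_ne_middle.symm
      hb.rotate.rotate.left_ne_middle ?_
    rintro rfl
    have h1 := ha.tripleProd_pos
    have h2 := hb.tripleProd_pos
    rw [tripleProd_swap] at h2
    linarith
  rw [edgeJump]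
  linarith

end Stress

/-- Two cones spanned by facets at `v` which share a point modulo `v` share the rays needed to
express that point. -/
theorem IsFacet.mem_of_combination_eq {v a b c d : Fin 3 → ℝ} (hF : IsFacet W v a b)
    (hG : IsFacet W v c d) {α β γ α' β' γ' : ℝ} (hβ : 0 ≤ β) (hγ : 0 ≤ γ) (hβ' : 0 ≤ β')
    (hγ' : 0 ≤ γ') (h : α • v + β • a + γ • b = α' • v + β' • c + γ' • d) :
    (0 < β' → c = a ∨ c = b) ∧ (0 < γ' → d = a ∨ d = b) := by
  have e1 := congrArg (polarVertex v a b ⬝ᵥ ·) h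
  have e2 := congrArg (polarVertex v c d ⬝ᵥ ·) h
  simp only [dotProduct_add, dotProduct_smul, hF.dotProduct_left, hF.dotProduct_middle,
    hF.dotProduct_right, hG.dotProduct_left, hG.dotProduct_middle,
    hG.dotProduct_right, smul_eq_mul, mul_one] at e1 e2
  have i1 := mul_le_mul_of_nonneg_left (hG.dotProduct_le_one hF.middle_mem) hβ
  have i2 := mul_le_mul_of_nonneg_left (hG.dotProduct_le_one hF.right_mem) hγ
  have i3 := mul_le_mul_of_nonneg_left (hF.dotProduct_le_one hG.middle_mem) hβ'
  have i4 := mul_le_mul_of_nonneg_left (hF.dotProduct_le_one hG.right_mem) hγ'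
  refine ⟨fun hp => ?_, fun hp => ?_⟩
  · refine (hF.eq_of_dotProduct_eq_one hG.middle_mem ?_).resolve_left hG.left_ne_middle.symm
    exact mul_left_cancel₀ hp.ne' (by linarith)
  · refine (hF.eq_of_dotProduct_eq_one hG.right_mem ?_).resolve_left
      hG.rotate.rotate.left_ne_middle
    exact mul_left_cancel₀ hp.ne' (by linarith)

/-- The quadratic form of a vertex: mixed area of the corresponding facet of the polar body. -/
noncomputable def edgeForm (W : Finset (Fin 3 → ℝ)) (v : Fin 3 → ℝ) (x y : (Fin 3 → ℝ) → ℝ) : ℝ :=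
  ∑ w ∈ W, edgeJump W x v w * y w

theorem edgeForm_comm {v : Fin 3 → ℝ} {x y : (Fin 3 → ℝ) → ℝ} (hx : x v = 0) (hy : y v = 0) :
    edgeForm W v x y = edgeForm W v y x := by
  have key : ∀ x y : (Fin 3 → ℝ) → ℝ, x v = 0 → edgeForm W v x y =
      ∑ w ∈ W, ∑ u ∈ W, facetWeight W v w u * (x u * y w) -
        ∑ w ∈ W, edgeCoeff W v w * (x w * y w) := by
    intro x y hx
    rw [edgeForm, ← Finset.sum_sub_distrib]
    refine Finset.sum_congr rfl fun w _ => ?_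
    rw [edgeJump, hx, mul_zero, sub_zero, sub_mul, Finset.sum_mul]
    simp only [mul_assoc]
  rw [key x y hx, key y x hy, Finset.sum_comm]
  congr 1
  · refine Finset.sum_congr rfl fun w _ => Finset.sum_congr rfl fun u _ => ?_
    rw [facetWeight_swap_right, mul_comm (x w)]
  · refine Finset.sum_congr rfl fun w _ => ?_
    rw [mul_comm (x w)]

theorem edgeForm_add_left (v : Fin 3 → ℝ) (x x' y : (Fin 3 → ℝ) → ℝ) :
    edgeForm W v (fun p => x p + x' p) y = edgeForm W v x y + edgeForm W v x' y := by
  simp only [edgeForm, edgeJump_add, add_mul, Finset.sum_add_distrib]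

theorem edgeForm_smul_left (v : Fin 3 → ℝ) (c : ℝ) (x y : (Fin 3 → ℝ) → ℝ) :
    edgeForm W v (fun p => c * x p) y = c * edgeForm W v x y := by
  simp only [edgeForm, edgeJump_smul, mul_assoc, Finset.mul_sum]

theorem edgeForm_add_right (v : Fin 3 → ℝ) (x y y' : (Fin 3 → ℝ) → ℝ) :
    edgeForm W v x (fun p => y p + y' p) = edgeForm W v x y + edgeForm W v x y' := by
  simp only [edgeForm, mul_add, Finset.sum_add_distrib]

theorem edgeForm_smul_right (v : Fin 3 → ℝ) (c : ℝ) (x y : (Fin 3 → ℝ) → ℝ) :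
    edgeForm W v x (fun p => c * y p) = c * edgeForm W v x y := by
  simp only [edgeForm, mul_left_comm _ c, Finset.mul_sum]

theorem edgeForm_dotProduct_left (hW : IsSimplicialAround W) (v y : Fin 3 → ℝ)
    (x : (Fin 3 → ℝ) → ℝ) : edgeForm W v (fun p => y ⬝ᵥ p) x = 0 := by
  simp only [edgeForm, edgeJump_dotProduct hW, zero_mul, Finset.sum_const_zero]

/-- A discrete Picone identity: if `s` is linear, vanishes at `v` and divides `k`, the form of `k`
is a weighted sum of squares. -/
theorem two_mul_edgeForm_self (hW : IsSimplicialAround W) {v y : Fin 3 → ℝ} (hy : y ⬝ᵥ v = 0)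
    {k U : (Fin 3 → ℝ) → ℝ} (hkv : k v = 0)
    (hU : ∀ w, IsEdge W v w → k w = y ⬝ᵥ w * U w) :
    2 * edgeForm W v k k =
      -∑ w ∈ W, ∑ u ∈ W, facetWeight W v w u * (y ⬝ᵥ w * y ⬝ᵥ u) * (U w - U u) ^ 2 := by
  have hA : ∀ w u, facetWeight W v w u * k u = facetWeight W v w u * (y ⬝ᵥ u * U u) := by
    intro w u
    by_cases h : IsEdge W v u
    · rw [hU u h]
    · rw [← facetWeight_swap_right, facetWeight_eq_zero_of_not_isEdge hW h, zero_mul, zero_mul]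
  have hterm : ∀ w, edgeJump W k v w * k w =
      ∑ u ∈ W, facetWeight W v w u * (y ⬝ᵥ w * y ⬝ᵥ u) * (U w * U u - U w ^ 2) := by
    intro w
    by_cases h : IsEdge W v w
    · have hs : ∑ u ∈ W, facetWeight W v w u * y ⬝ᵥ u = edgeCoeff W v w * y ⬝ᵥ w := by
        rw [sum_facetWeight_mul_dotProduct, oppositeSum_eq hW, dotProduct_add, dotProduct_smul,
          dotProduct_smul, hy, smul_zero, add_zero, smul_eq_mul]
      calc edgeJump W k v w * k w
          = (∑ u ∈ W, facetWeight W v w u * k u) * k w - edgeCoeff W v w * y ⬝ᵥ w *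
              (y ⬝ᵥ w * U w ^ 2) := by
            rw [edgeJump, hkv, hU w h]
            ring
        _ = _ := by
            rw [← hs, Finset.sum_mul, Finset.sum_mul, ← Finset.sum_sub_distrib]
            refine Finset.sum_congr rfl fun u _ => ?_
            rw [hA, hU w h]
            ring
    · rw [edgeJump_eq_zero_of_not_isEdge hW h, zero_mul, eq_comm]
      exact Finset.sum_eq_zero fun u _ => by
        rw [facetWeight_eq_zero_of_not_isEdge hW h, zero_mul, zero_mul]
  have hQ : edgeForm W v k k = ∑ w ∈ W, ∑ u ∈ W,
      facetWeight W v w u * (y ⬝ᵥ w * y ⬝ᵥ u) * (U w * U u - U w ^ 2) :=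
    Finset.sum_congr rfl fun w _ => hterm w
  have hQ' := hQ
  rw [Finset.sum_comm] at hQ'
  rw [two_mul]
  nth_rewrite 2 [hQ']
  rw [hQ, ← Finset.sum_add_distrib, ← Finset.sum_neg_distrib]
  refine Finset.sum_congr rfl fun w _ => ?_
  rw [← Finset.sum_add_distrib, ← Finset.sum_neg_distrib]
  refine Finset.sum_congr rfl fun u _ => ?_
  rw [facetWeight_swap_right]
  ring

/-- A function vanishing at `v`, at one neighbour of `v`, and at the two neighbours spanning the
opposite direction has nonpositive form. -/
theorem edgeForm_self_nonpos_of_vanish (hW : IsSimplicialAround W) {v w₁ w₂ w₃ : Fin 3 → ℝ}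
    (h₁ : IsEdge W v w₁) (h₂₃ : IsFacet W v w₂ w₃) {α β γ : ℝ} (hβ : 0 ≤ β) (hγ : 0 ≤ γ)
    (hc : -w₁ = α • v + β • w₂ + γ • w₃) {k : (Fin 3 → ℝ) → ℝ} (hk : k v = 0) (hk₁ : k w₁ = 0)
    (hk₂ : k w₂ = 0) (hk₃ : k w₃ = 0) : edgeForm W v k k ≤ 0 := by
  obtain ⟨b, hb⟩ := h₁
  have cramer : ∀ w u, tripleProd v w u • w₁ =
      tripleProd w₁ w u • v + tripleProd v w₁ u • w + (-tripleProd v w₁ w) • u := by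
    intro w u
    rw [tripleProd_smul_eq, ← tripleProd_rotate v w w₁, ← tripleProd_rotate w w₁ v,
      tripleProd_swap v w₁ w]
  have pos_case : ∀ w u, IsFacet W v w u → 0 ≤ tripleProd v w₁ u → 0 ≤ -tripleProd v w₁ w →
      (0 < tripleProd v w₁ u → w = w₁ ∨ w = b) ∧ (0 < -tripleProd v w₁ w → u = w₁ ∨ u = b) := by
    intro w u h h1 h2
    refine hb.mem_of_combination_eq h (α := 0) h.tripleProd_pos.le le_rfl h1 h2 ?_
      (α' := tripleProd w₁ w u)
    rw [← cramer w u, zero_smul, zero_smul, zero_add, add_zero]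
  have neg_case : ∀ w u, IsFacet W v w u → 0 ≤ -tripleProd v w₁ u → 0 ≤ tripleProd v w₁ w →
      (0 < -tripleProd v w₁ u → w = w₂ ∨ w = w₃) ∧
      (0 < tripleProd v w₁ w → u = w₂ ∨ u = w₃) := by
    intro w u h h1 h2
    refine h₂₃.mem_of_combination_eq h (α := tripleProd v w u * α)
      (mul_nonneg h.tripleProd_pos.le hβ) (mul_nonneg h.tripleProd_pos.le hγ) h1 h2 ?_
      (α' := -tripleProd w₁ w u)
    rw [mul_smul, mul_smul, mul_smul, ← smul_add, ← smul_add, ← hc, smul_neg, cramer w u]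
    module
  have hk' : ∀ w, w = w₂ ∨ w = w₃ → k w = 0 := by
    rintro w (rfl | rfl) <;> assumption
  have hs₁ : tripleProd v w₁ w₁ = 0 := tripleProd_self_right _ _
  have hsb := hb.tripleProd_pos
  have hzero : ∀ w, IsEdge W v w → tripleProd v w₁ w = 0 → k w = 0 := by
    rintro w ⟨u, hu⟩ hs
    rcases lt_trichotomy (tripleProd v w₁ u) 0 with h | h | h
    · exact hk' w ((neg_case w u hu (by linarith) hs.ge).1 (by linarith))
    · exfalso
      have e := congrArg (crossProduct b v ⬝ᵥ ·) (cramer w u)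
      simp only [h, hs, dotProduct_add, dotProduct_smul, cross_dotProduct_eq, smul_eq_mul,
        tripleProd_self_right, mul_zero, zero_mul, neg_zero, add_zero] at e
      rw [← tripleProd_rotate b v w₁] at e
      exact (mul_pos hu.tripleProd_pos hsb).ne' e
    · rcases (pos_case w u hu h.le (by linarith)).1 h with rfl | rfl
      · exact hk₁
      · exact absurd hs hsb.ne'
  have hcross : ∀ w u, IsFacet W v w u → tripleProd v w₁ w * tripleProd v w₁ u < 0 →
      k w = 0 ∧ k u = 0 := by
    intro w u h hlt
    rcases mul_neg_iff.1 hlt with ⟨h1, h2⟩ | ⟨h1, h2⟩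
    · have := neg_case w u h (by linarith) h1.le
      exact ⟨hk' w (this.1 (by linarith)), hk' u (this.2 h1)⟩
    · exfalso
      have := pos_case w u h h2.le (by linarith)
      rcases this.1 h2 with rfl | rfl
      · exact h1.ne hs₁
      · linarith
  have hsum := two_mul_edgeForm_self hW (v := v) (y := crossProduct v w₁) (k := k)
    (U := fun w => k w / tripleProd v w₁ w)
    (by rw [cross_dotProduct_eq, tripleProd_self_outer]) hk (by
      intro w hw
      rw [cross_dotProduct_eq]
      by_cases h : tripleProd v w₁ w = 0
      · rw [hzero w hw h, h, zero_mul]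
      · field_simp)
  have hnonneg : 0 ≤ ∑ w ∈ W, ∑ u ∈ W, facetWeight W v w u *
      (crossProduct v w₁ ⬝ᵥ w * crossProduct v w₁ ⬝ᵥ u) *
      (k w / tripleProd v w₁ w - k u / tripleProd v w₁ u) ^ 2 := by
    refine Finset.sum_nonneg fun w _ => Finset.sum_nonneg fun u _ => ?_
    rw [cross_dotProduct_eq, cross_dotProduct_eq]
    by_cases hs : 0 ≤ tripleProd v w₁ w * tripleProd v w₁ u
    · exact mul_nonneg (mul_nonneg (facetWeight_nonneg _ _ _) hs) (sq_nonneg _)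
    · rw [not_le] at hs
      by_cases h1 : IsFacet W v w u
      · rw [(hcross w u h1 hs).1, (hcross w u h1 hs).2]
        simp
      by_cases h2 : IsFacet W v u w
      · rw [(hcross u w h2 (by rwa [mul_comm])).1, (hcross u w h2 (by rwa [mul_comm])).2]
        simp
      · rw [facetWeight_eq_zero h1 fun h => h2 h.rotate, zero_mul, zero_mul]
  linarith

/-- The Minkowski inequality for the facet of the polar body at the vertex `v`, with its equality
case. -/
theorem exists_edgeForm_nonpos (hW : IsSimplicialAround W) {v : Fin 3 → ℝ} (hv : v ∈ W) :
    ∃ f : Fin 3 → ℝ, f ⬝ᵥ v = 1 ∧ ∀ k : (Fin 3 → ℝ) → ℝ, k v = 0 →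
      edgeForm W v k (fun p => 1 - f ⬝ᵥ p) = 0 → edgeForm W v k k ≤ 0 ∧
      (edgeForm W v k k = 0 → ∀ w ∈ W, edgeJump W k v w = 0) := by
  classical
  obtain ⟨w₁, b, hb⟩ := hW.exists_isFacet_of_mem hv
  obtain ⟨w₂, w₃, α, β, γ, hF, hβ, hγ, hc⟩ := hW.exists_link_cone hb (-w₁)
  set h : (Fin 3 → ℝ) → ℝ := fun p => 1 - polarVertex v w₂ w₃ ⬝ᵥ p with hh
  have hhv : h v = 0 := by rw [hh]; simp only [hF.dotProduct_left, sub_self]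
  have hh₂ : h w₂ = 0 := by rw [hh]; simp only [hF.dotProduct_middle, sub_self]
  have hh₃ : h w₃ = 0 := by rw [hh]; simp only [hF.dotProduct_right, sub_self]
  have hnn : ∀ p ∈ W, 0 ≤ h p := fun p hp => sub_nonneg.2 (hF.dotProduct_le_one hp)
  have hh₁ : 0 < h w₁ := by
    have e := congrArg (crossProduct v w₂ ⬝ᵥ ·) hc
    have e' := congrArg (crossProduct w₃ v ⬝ᵥ ·) hc
    simp only [dotProduct_add, dotProduct_smul, dotProduct_neg, cross_dotProduct_eq,
      tripleProd_self_outer, tripleProd_self_right, smul_eq_mul, mul_zero, zero_add,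
      add_zero] at e e'
    have hD := hF.tripleProd_pos
    have hD' : 0 < tripleProd w₃ v w₂ := hF.rotate.rotate.tripleProd_pos
    refine sub_pos.2 (hF.lt_one w₁ hb.middle_mem hb.left_ne_middle.symm ?_ ?_)
    · rintro rfl
      nlinarith [mul_nonneg hβ hD'.le]
    · rintro rfl
      nlinarith [mul_nonneg hγ hD.le]
  have hjump : ∀ w, edgeJump W h v w = edgeJump W (fun _ => 1) v w := by
    intro w
    have e : h = fun p => 1 + (-polarVertex v w₂ w₃) ⬝ᵥ p := by
      funext p
      rw [neg_dotProduct]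
      exact sub_eq_add_neg _ _
    rw [e, edgeJump_add, edgeJump_dotProduct hW, add_zero]
  have hBpos : 0 < edgeForm W v h h := by
    refine Finset.sum_pos' (fun w hw => ?_) ⟨w₁, hb.middle_mem, ?_⟩
    · rw [hjump]
      exact mul_nonneg (edgeJump_one_nonneg hW v w) (hnn w hw)
    · rw [hjump]
      exact mul_pos (edgeJump_one_pos hW ⟨b, hb⟩) hh₁
  have hle : ∀ k : (Fin 3 → ℝ) → ℝ, k v = 0 → edgeForm W v k h = 0 → edgeForm W v k k ≤ 0 := by
    intro k hk hkh
    obtain ⟨l, hlv, hl₂, hl₃⟩ := exists_dotProduct_eq hF.tripleProd_pos.ne' 0 (k w₂) (k w₃)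
    set c := (k w₁ - l ⬝ᵥ w₁) / h w₁
    set k' : (Fin 3 → ℝ) → ℝ := fun p => k p + ((-l) ⬝ᵥ p + (-c) * h p) with hk'
    have hk'v : k' v = 0 := by simp only [hk', neg_dotProduct, hk, hlv, hhv]; ring
    have hk'₁ : k' w₁ = 0 := by
      have : c * h w₁ = k w₁ - l ⬝ᵥ w₁ := div_mul_cancel₀ _ hh₁.ne'
      simp only [hk', neg_dotProduct]
      linarith
    have hle' := edgeForm_self_nonpos_of_vanish hW ⟨b, hb⟩ hF hβ hγ hc hk'v hk'₁
      (by simp only [hk', neg_dotProduct, hl₂, hh₂]; ring)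
      (by simp only [hk', neg_dotProduct, hl₃, hh₃]; ring)
    have hl' : ∀ p, edgeForm W v p (fun p => (-l) ⬝ᵥ p) = edgeForm W v (fun p => (-l) ⬝ᵥ p) p ∨
        p v ≠ 0 := by
      intro p
      by_cases hp : p v = 0
      · exact Or.inl (edgeForm_comm hp (by rw [neg_dotProduct, hlv, neg_zero]))
      · exact Or.inr hp
    have expand : edgeForm W v k' k' = edgeForm W v k k + c ^ 2 * edgeForm W v h h := by
      have e1 := (hl' k).resolve_right (not_not.2 hk)
      have e2 := (hl' h).resolve_right (not_not.2 hhv)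
      have e3 := edgeForm_comm (W := W) hhv hk
      simp only [hk', edgeForm_add_left, edgeForm_add_right, edgeForm_smul_left,
        edgeForm_smul_right, edgeForm_dotProduct_left hW, e1, e2, e3, hkh]
      ring
    have := mul_nonneg (sq_nonneg c) hBpos.le
    linarith
  refine ⟨polarVertex v w₂ w₃, hF.dotProduct_left, fun k hk hkh => ⟨hle k hk hkh, ?_⟩⟩
  intro hkk w hw
  by_cases hE : IsEdge W v w
  swap
  · exact edgeJump_eq_zero_of_not_isEdge hW hE k
  have hwv : v ≠ w := by
    obtain ⟨a, ha⟩ := hE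
    exact ha.left_ne_middle
  have orth : ∀ y : (Fin 3 → ℝ) → ℝ, y v = 0 → edgeForm W v y h = 0 → edgeForm W v k y = 0 := by
    intro y hy hyh
    have hyk := edgeForm_comm (W := W) hy hk
    have key : ∀ t : ℝ, 2 * t * edgeForm W v k y + t ^ 2 * edgeForm W v y y ≤ 0 := by
      intro t
      have := hle (fun p => k p + t * y p) (by simp [hk, hy])
        (by rw [edgeForm_add_left, edgeForm_smul_left, hyh, hkh, mul_zero, add_zero])
      simp only [edgeForm_add_left, edgeForm_add_right, edgeForm_smul_left, edgeForm_smul_right,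
        hkk, hyk] at this
      linarith
    have hyy := hle y hy hyh
    by_contra hne
    set B := edgeForm W v k y
    set C := edgeForm W v y y
    have h1 := key (B / (1 - C))
    have hC : 0 < 1 - C := by linarith
    have : 2 * (B / (1 - C)) * B + (B / (1 - C)) ^ 2 * C = (B / (1 - C)) ^ 2 * (2 - C) := by
      field_simp
      ring
    rw [this] at h1
    have h2 : 0 < (B / (1 - C)) ^ 2 := by positivity
    nlinarith
  have hall : ∀ y : (Fin 3 → ℝ) → ℝ, y v = 0 → edgeForm W v k y = 0 := by
    intro y hy
    set c := edgeForm W v y h / edgeForm W v h h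
    have := orth (fun p => y p + (-c) * h p) (by simp [hy, hhv]) (by
      rw [edgeForm_add_left, edgeForm_smul_left, neg_mul, div_mul_cancel₀ _ hBpos.ne',
        add_neg_cancel])
    rwa [edgeForm_add_right, edgeForm_smul_right, hkh, mul_zero, add_zero] at this
  have := hall (Pi.single w 1) (Pi.single_eq_of_ne hwv _)
  simpa [edgeForm, Pi.single_apply, hw] using this

/-- Triangles are infinitesimally rigid. -/
theorem exists_infinitesimal_isometry {u v w : Fin 3 → ℝ} (h : tripleProd u v w ≠ 0)
    {q : (Fin 3 → ℝ) → (Fin 3 → ℝ)} (huv : (u - v) ⬝ᵥ (q u - q v) = 0)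
    (hvw : (v - w) ⬝ᵥ (q v - q w) = 0) (hwu : (w - u) ⬝ᵥ (q w - q u) = 0) :
    ∃ ω b : Fin 3 → ℝ, q u = crossProduct ω u + b ∧ q v = crossProduct ω v + b ∧
      q w = crossProduct ω w + b := by
  obtain ⟨e, rfl⟩ : ∃ e, v = u + e := ⟨v - u, by abel⟩
  obtain ⟨f, rfl⟩ : ∃ f, w = u + f := ⟨w - u, by abel⟩
  obtain ⟨a, ha⟩ : ∃ a, q (u + e) = q u + a := ⟨q (u + e) - q u, by abel⟩
  obtain ⟨c, hc⟩ : ∃ c, q (u + f) = q u + c := ⟨q (u + f) - q u, by abel⟩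
  rw [ha] at huv hvw
  rw [hc] at hvw hwu
  have hea : e ⬝ᵥ a = 0 := by simpa using huv
  have hfc : f ⬝ᵥ c = 0 := by simpa using hwu
  have hfa : f ⬝ᵥ a + e ⬝ᵥ c = 0 := by
    simp only [add_sub_add_left_eq_sub, sub_dotProduct, dotProduct_sub, hea, hfc] at hvw
    linarith
  have hn : crossProduct e f ⬝ᵥ crossProduct e f ≠ 0 := by
    intro h0
    refine h ?_
    have h1 := dotProduct_self_eq_zero.1 h0
    simp only [tripleProd, map_add, LinearMap.add_apply, h1, cross_self, dotProduct_add,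
      dot_self_cross, dot_cross_self, dotProduct_zero, add_zero]
  set N := crossProduct e f ⬝ᵥ crossProduct e f with hN
  set ω₀ := (f ⬝ᵥ a) • crossProduct e f + (c ⬝ᵥ crossProduct e f) • e -
    (a ⬝ᵥ crossProduct e f) • f with hω₀
  have ea : N • a = crossProduct ω₀ e := by
    have : N • a = crossProduct ω₀ e + (e ⬝ᵥ a) • crossProduct f (crossProduct e f) := by
      ext i
      fin_cases i <;>
      · simp only [hN, hω₀, dotProduct, Fin.sum_univ_three, cross_apply, cons_val, Pi.smul_apply,
          Pi.add_apply, Pi.sub_apply, smul_eq_mul, Fin.mk_zero, Fin.mk_one, Fin.reduceFinMk]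
        ring
    rw [this, hea, zero_smul, add_zero]
  have ec : N • c = crossProduct ω₀ f := by
    have : N • c = crossProduct ω₀ f + (f ⬝ᵥ a + e ⬝ᵥ c) • crossProduct f (crossProduct e f) +
        (f ⬝ᵥ c) • crossProduct (crossProduct e f) e := by
      ext i
      fin_cases i <;>
      · simp only [hN, hω₀, dotProduct, Fin.sum_univ_three, cross_apply, cons_val, Pi.smul_apply,
          Pi.add_apply, Pi.sub_apply, smul_eq_mul, Fin.mk_zero, Fin.mk_one, Fin.reduceFinMk]
        ring
    rw [this, hfa, hfc, zero_smul, zero_smul, add_zero, add_zero]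
  have ea' : crossProduct (N⁻¹ • ω₀) e = a := by
    rw [map_smul, LinearMap.smul_apply, ← ea, inv_smul_smul₀ hn]
  have ec' : crossProduct (N⁻¹ • ω₀) f = c := by
    rw [map_smul, LinearMap.smul_apply, ← ec, inv_smul_smul₀ hn]
  refine ⟨N⁻¹ • ω₀, q u - crossProduct (N⁻¹ • ω₀) u, by abel, ?_, ?_⟩
  · rw [ha, map_add, ea']
    abel
  · rw [hc, map_add, ec']
    abel

/-- The infinitesimal isometries of two adjacent facets differ by the jump across the common
edge. -/
theorem IsFacet.sub_eq_edgeJump (hW : IsSimplicialAround W) {v w a b ω β ω' β' : Fin 3 → ℝ}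
    (ha : IsFacet W v w a) (hb : IsFacet W w v b) {q : (Fin 3 → ℝ) → (Fin 3 → ℝ)}
    (hv : q v = crossProduct ω v + β) (hw : q w = crossProduct ω w + β)
    (hqa : q a = crossProduct ω a + β) (hv' : q v = crossProduct ω' v + β')
    (hw' : q w = crossProduct ω' w + β') (hqb : q b = crossProduct ω' b + β') :
    ω - ω' = edgeJump W (fun p => q p ⬝ᵥ p) v w • (w - v) ∧
      β - β' = edgeJump W (fun p => q p ⬝ᵥ p) v w • crossProduct v w := by
  have hx : ∀ {p ω β : Fin 3 → ℝ}, q p = crossProduct ω p + β → q p ⬝ᵥ p = β ⬝ᵥ p := by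
    intro p ω β h
    rw [h, add_dotProduct, cross_dotProduct_eq, tripleProd_self_right, zero_add]
  have hD := ha.tripleProd_pos.ne'
  have hdiff : β - β' = edgeJump W (fun p => q p ⬝ᵥ p) v w • crossProduct v w := by
    rw [eq_smul_cross hD (y := β - β') (by rw [sub_dotProduct, ← hx hv, ← hx hv', sub_self])
      (by rw [sub_dotProduct, ← hx hw, ← hx hw', sub_self])]
    congr 1
    have h0 := edgeJump_dotProduct hW β' v w
    have e1 := sum_facetWeight ha hb (fun p => q p ⬝ᵥ p)
    have e2 := sum_facetWeight ha hb (fun p => β' ⬝ᵥ p)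
    simp only [smul_eq_mul] at e1 e2
    rw [edgeJump, e2] at h0
    rw [edgeJump, e1, hx hqa, hx hqb, hx hv', hx hw', sub_dotProduct]
    linear_combination -h0
  refine ⟨?_, hdiff⟩
  set l := edgeJump W (fun p => q p ⬝ᵥ p) v w
  have hΘv : crossProduct (ω - ω' - l • (w - v)) v = 0 := by
    have e : crossProduct (ω - ω') v = -(β - β') := by
      rw [map_sub, LinearMap.sub_apply]
      linear_combination (exp := 1) hv'.symm.trans hv |>.symm
    rw [map_sub, LinearMap.sub_apply, e, hdiff, map_smul, LinearMap.smul_apply, map_sub,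
      LinearMap.sub_apply, cross_self, sub_zero, ← cross_anticomm w v, smul_neg, neg_neg, sub_self]
  have hΘw : crossProduct (ω - ω' - l • (w - v)) w = 0 := by
    have e : crossProduct (ω - ω') w = -(β - β') := by
      rw [map_sub, LinearMap.sub_apply]
      linear_combination (exp := 1) hw'.symm.trans hw |>.symm
    rw [map_sub, LinearMap.sub_apply, e, hdiff, map_smul, LinearMap.smul_apply, map_sub,
      LinearMap.sub_apply, cross_self, zero_sub, smul_neg, sub_self]
  rw [← sub_eq_zero]
  set Θ := ω - ω' - l • (w - v)
  have e := tripleProd_smul_eq v w a Θ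
  rw [← cross_dotProduct_eq Θ w a, hΘw, tripleProd_swap Θ v a, ← cross_dotProduct_eq Θ v a, hΘv,
    ← tripleProd_rotate v w Θ, ← tripleProd_rotate w Θ v, ← cross_dotProduct_eq Θ v w, hΘv] at e
  simp only [zero_dotProduct, neg_zero, zero_smul, add_zero] at e
  exact (smul_eq_zero.1 e).resolve_left hD

/-- Infinitesimal rigidity in terms of facets. -/
theorem IsSimplicialAround.exists_infinitesimal_isometry (hW : IsSimplicialAround W)
    {q : (Fin 3 → ℝ) → (Fin 3 → ℝ)}
    (hq : ∀ u v w, IsFacet W u v w → (u - v) ⬝ᵥ (q u - q v) = 0) :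
    ∃ ω b : Fin 3 → ℝ, ∀ v ∈ W, q v = crossProduct ω v + b := by
  classical
  have hflex : ∀ u v w, ∃ ω b : Fin 3 → ℝ, IsFacet W u v w → q u = crossProduct ω u + b ∧
      q v = crossProduct ω v + b ∧ q w = crossProduct ω w + b := by
    intro u v w
    by_cases h : IsFacet W u v w
    · obtain ⟨ω, b, h'⟩ := _root_.exists_infinitesimal_isometry h.tripleProd_pos.ne' (hq _ _ _ h)
        (hq _ _ _ h.rotate) (hq _ _ _ h.rotate.rotate)
      exact ⟨ω, b, fun _ => h'⟩
    · exact ⟨0, 0, fun h' => absurd h' h⟩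
  choose Ω β hΩ using hflex
  set x : (Fin 3 → ℝ) → ℝ := fun p => q p ⬝ᵥ p with hx
  have hstress : ∀ v, ∑ w ∈ W, edgeJump W x v w • (w - v) = 0 := by
    intro v
    have hterm : ∀ w ∈ W, edgeJump W x v w • (w - v) =
        ∑ w' ∈ W, (if IsFacet W v w w' then Ω v w w' else 0) -
        ∑ w' ∈ W, (if IsFacet W v w' w then Ω v w' w else 0) := by
      intro w _
      by_cases h : IsEdge W v w
      · obtain ⟨a, ha⟩ := h
        obtain ⟨b, hb⟩ := hW.exists_adjacent ha
        obtain ⟨h1, h2, h3⟩ := hΩ _ _ _ ha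
        obtain ⟨h4, h5, h6⟩ := hΩ _ _ _ hb.rotate
        rw [Finset.sum_eq_single_of_mem a ha.right_mem fun u _ hu =>
            if_neg fun h => hu (h.right_unique ha),
          Finset.sum_eq_single_of_mem b hb.right_mem fun u _ hu =>
            if_neg fun h => hu (h.rotate.rotate.right_unique hb),
          if_pos ha, if_pos hb.rotate]
        exact (ha.sub_eq_edgeJump hW hb h1 h2 h3 h4 h6 h5).1.symm
      · rw [edgeJump_eq_zero_of_not_isEdge hW h, zero_smul, Finset.sum_eq_zero fun u _ =>
            if_neg fun h' => h ⟨_, h'⟩, Finset.sum_eq_zero fun u _ =>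
            if_neg fun h' => h (IsEdge.symm hW ⟨_, h'.rotate.rotate⟩), sub_zero]
    rw [Finset.sum_congr rfl hterm, Finset.sum_sub_distrib, sub_eq_zero, Finset.sum_comm]
  have hlocal : ∀ v ∈ W, ∑ w ∈ W, edgeJump W x v w * (x w - x v) ≤ 0 ∧
      (∑ w ∈ W, edgeJump W x v w * (x w - x v) = 0 → ∀ w ∈ W, edgeJump W x v w = 0) := by
    intro v hv
    obtain ⟨f, hf, hform⟩ := exists_edgeForm_nonpos hW hv
    set k : (Fin 3 → ℝ) → ℝ := fun p => x p + (-(x v) • f) ⬝ᵥ p with hk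
    have hjump : ∀ w, edgeJump W k v w = edgeJump W x v w := by
      intro w
      rw [hk, edgeJump_add, edgeJump_dotProduct hW, add_zero]
    have h1 : edgeForm W v k (fun p => 1 - f ⬝ᵥ p) = 0 := by
      have e := congrArg (f ⬝ᵥ ·) (hstress v)
      simp only [dotProduct_sum, dotProduct_smul, dotProduct_sub, hf, dotProduct_zero,
        smul_eq_mul] at e
      rw [← neg_eq_zero, ← e, edgeForm, ← Finset.sum_neg_distrib]
      refine Finset.sum_congr rfl fun w _ => ?_
      rw [hjump]
      ring
    have h2 : edgeForm W v k k = ∑ w ∈ W, edgeJump W x v w * (x w - x v) := by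
      have e : edgeForm W v k k = ∑ w ∈ W, edgeJump W x v w * (x w - x v) +
          x v * edgeForm W v k (fun p => 1 - f ⬝ᵥ p) := by
        rw [edgeForm, edgeForm, Finset.mul_sum, ← Finset.sum_add_distrib]
        refine Finset.sum_congr rfl fun w _ => ?_
        rw [hjump, hk]
        simp only [smul_dotProduct, smul_eq_mul]
        ring
      rw [e, h1, mul_zero, add_zero]
    have := hform k (by rw [hk]; simp only [smul_dotProduct, hf, smul_eq_mul]; ring) h1
    simpa only [h2, hjump] using this
  have htotal : ∑ v ∈ W, ∑ w ∈ W, edgeJump W x v w * (x w - x v) = 0 := by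
    have : ∑ v ∈ W, ∑ w ∈ W, edgeJump W x v w * (x w - x v) =
        -∑ v ∈ W, ∑ w ∈ W, edgeJump W x v w * (x w - x v) := by
      nth_rewrite 1 [Finset.sum_comm]
      rw [← Finset.sum_neg_distrib]
      refine Finset.sum_congr rfl fun v _ => ?_
      rw [← Finset.sum_neg_distrib]
      refine Finset.sum_congr rfl fun w _ => ?_
      rw [edgeJump_swap]
      ring
    linarith
  have hzero : ∀ v ∈ W, ∀ w ∈ W, edgeJump W x v w = 0 := fun v hv =>
    (hlocal v hv).2 ((Finset.sum_eq_zero_iff_of_nonpos fun v hv => (hlocal v hv).1).1 htotal v hv)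
  obtain ⟨u₀, v₀, w₀, h₀⟩ := hW.exists_isFacet
  refine ⟨Ω u₀ v₀ w₀, β u₀ v₀ w₀, fun p hp => ?_⟩
  obtain ⟨v, w, hR⟩ := hW.exists_mem_facet
    (R := fun u v w => IsFacet W u v w ∧ q u = crossProduct (Ω u₀ v₀ w₀) u + β u₀ v₀ w₀ ∧
      q v = crossProduct (Ω u₀ v₀ w₀) v + β u₀ v₀ w₀ ∧
      q w = crossProduct (Ω u₀ v₀ w₀) w + β u₀ v₀ w₀)
    (fun _ _ _ h => h.1) (fun _ _ _ h => ⟨h.1.rotate, h.2.2.1, h.2.2.2, h.2.1⟩)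
    (by
      rintro u v w w' ⟨h, hu, hv, hw⟩ h'
      obtain ⟨g1, g2, g3⟩ := hΩ _ _ _ h'
      obtain ⟨e1, e2⟩ := h.sub_eq_edgeJump hW h' hu hv hw g2 g1 g3
      rw [hzero u h.left_mem v h.middle_mem, zero_smul, sub_eq_zero] at e1 e2
      exact ⟨h', hv, hu, by rw [e1, e2]; exact g3⟩)
    ⟨u₀, v₀, w₀, h₀, hΩ _ _ _ h₀⟩ hp
  exact hR.2.1

end

theorem dotProduct_le_of_mem_convexHull {V : Set (Fin 3 → ℝ)} {y x : Fin 3 → ℝ} {c : ℝ}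
    (h : ∀ p ∈ V, y ⬝ᵥ p ≤ c) (hx : x ∈ convexHull ℝ V) : y ⬝ᵥ x ≤ c := by
  have hc : Convex ℝ {x : Fin 3 → ℝ | y ⬝ᵥ x ≤ c} :=
    convex_halfSpace_le ⟨fun a b => dotProduct_add y a b, fun r a => dotProduct_smul r y a⟩ c
  exact convexHull_min (s := V) (t := {x | y ⬝ᵥ x ≤ c}) h hc hx

theorem isExposed_dotProduct_eq {P : Set (Fin 3 → ℝ)} {y : Fin 3 → ℝ} {c : ℝ}
    (h : ∀ x ∈ P, y ⬝ᵥ x ≤ c) : IsExposed ℝ P {x ∈ P | y ⬝ᵥ x = c} := by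
  rintro ⟨z, hz, hzc⟩
  refine ⟨LinearMap.toContinuousLinearMap (dotProductBilin ℝ ℝ y), ?_⟩
  ext x
  simp only [Set.mem_ofPred_eq, LinearMap.coe_toContinuousLinearMap', dotProductBilin_apply_apply]
  refine and_congr_right fun hx => ⟨fun hxc p hp => hxc ▸ h p hp, fun hmax => ?_⟩
  exact le_antisymm (h x hx) (hzc ▸ hmax z hz)

theorem isExposed_segment {V : Finset (Fin 3 → ℝ)} {y a b : Fin 3 → ℝ} {c : ℝ}
    (hle : ∀ p ∈ V, y ⬝ᵥ p ≤ c) (ha : a ∈ V) (hb : b ∈ V) (hya : y ⬝ᵥ a = c) (hyb : y ⬝ᵥ b = c)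
    (heq : ∀ p ∈ V, y ⬝ᵥ p = c → p = a ∨ p = b) :
    IsExposed ℝ (convexHull ℝ (V : Set (Fin 3 → ℝ))) (segment ℝ a b) := by
  have hset : segment ℝ a b = {x ∈ convexHull ℝ (V : Set (Fin 3 → ℝ)) | y ⬝ᵥ x = c} := by
    ext x
    constructor
    · intro hx
      refine ⟨segment_subset_convexHull ha hb hx, ?_⟩
      obtain ⟨s, t, -, -, hst, rfl⟩ := hx
      rw [dotProduct_add, dotProduct_smul, dotProduct_smul, hya, hyb, ← add_smul, hst, one_smul]
    · rintro ⟨hx, hyx⟩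
      obtain ⟨w, hw0, hw1, rfl⟩ := Finset.mem_convexHull'.1 hx
      have hsum : ∑ p ∈ V, w p * (c - y ⬝ᵥ p) = 0 := by
        simp only [mul_sub, Finset.sum_sub_distrib, ← Finset.sum_mul, hw1, one_mul]
        rw [← hyx, dotProduct_sum]
        simp [dotProduct_smul]
      have hslack := (Finset.sum_eq_zero_iff_of_nonneg fun p hp =>
        mul_nonneg (hw0 p hp) (sub_nonneg.2 (hle p hp))).1 hsum
      rw [← Finset.sum_filter_of_ne (p := fun p => w p ≠ 0)
        fun p _ hp h0 => hp (by rw [h0, zero_smul])]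
      refine (convex_segment a b).sum_mem (fun p hp => hw0 p (Finset.mem_filter.1 hp).1) ?_ ?_
      · rw [Finset.sum_filter_of_ne fun p _ hp => hp, hw1]
      · intro p hp
        obtain ⟨hpV, hpw⟩ := Finset.mem_filter.1 hp
        have hyp : y ⬝ᵥ p = c := by
          have := (mul_eq_zero.1 (hslack p hpV)).resolve_left hpw
          linarith
        obtain rfl | rfl := heq p hpV hyp
        · exact left_mem_segment ℝ p b
        · exact right_mem_segment ℝ a p
  rw [hset]
  exact isExposed_dotProduct_eq fun x hx => dotProduct_le_of_mem_convexHull hle hx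

theorem eq_zero_of_mem_interior {P : Set (Fin 3 → ℝ)} {o y : Fin 3 → ℝ} (ho : o ∈ interior P)
    (h : ∀ x ∈ P, y ⬝ᵥ x ≤ y ⬝ᵥ o) : y = 0 := by
  have hcont : Filter.Tendsto (fun t : ℝ => o + t • y) (nhdsWithin 0 (Set.Ioi 0)) (nhds o) := by
    refine Filter.Tendsto.mono_left ?_ nhdsWithin_le_nhds
    exact (by fun_prop : Continuous fun t : ℝ => o + t • y).tendsto' 0 o (by simp)
  obtain ⟨t, ht, ht0⟩ := ((hcont.eventually (mem_interior_iff_mem_nhds.1 ho)).and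
    self_mem_nhdsWithin).exists
  have hle := h _ ht
  rw [dotProduct_add, dotProduct_smul, smul_eq_mul] at hle
  have hnonneg : 0 ≤ y ⬝ᵥ y := Finset.sum_nonneg fun i _ => mul_self_nonneg (y i)
  have ht0' : 0 < t := ht0
  refine dotProduct_self_eq_zero.1 (le_antisymm ?_ hnonneg)
  nlinarith

theorem linearIndependent_sub_of_tripleProd {u v w : Fin 3 → ℝ} (h : tripleProd u v w ≠ 0) :
    LinearIndependent ℝ ![v - u, w - u] := by
  rw [LinearIndependent.pair_iff]
  intro s t hst
  obtain ⟨y, hyu, hyv, hyw⟩ := exists_dotProduct_eq h 0 1 0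
  obtain ⟨z, hzu, hzv, hzw⟩ := exists_dotProduct_eq h 0 0 1
  have h1 := congrArg (y ⬝ᵥ ·) hst
  have h2 := congrArg (z ⬝ᵥ ·) hst
  simp only [dotProduct_add, dotProduct_smul, dotProduct_sub, dotProduct_zero, smul_eq_mul, hyu,
    hyv, hyw, hzu, hzv, hzw] at h1 h2
  constructor <;> linarith

theorem finrank_vectorSpan_eq_two {F : Set (Fin 3 → ℝ)} {y u v w o : Fin 3 → ℝ} {c : ℝ}
    (hy : y ≠ 0) (hF : ∀ x ∈ F, y ⬝ᵥ x = c) (hu : u + o ∈ F) (hv : v + o ∈ F) (hw : w + o ∈ F)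
    (h : tripleProd u v w ≠ 0) : Module.finrank ℝ (vectorSpan ℝ F) = 2 := by
  refine le_antisymm ?_ ?_
  · have hker : vectorSpan ℝ F ≤ LinearMap.ker (dotProductBilin ℝ ℝ y) := by
      refine Submodule.span_le.2 ?_
      rintro _ ⟨a, ha, b, hb, rfl⟩
      simp only [SetLike.mem_coe, LinearMap.mem_ker, dotProductBilin_apply_apply, vsub_eq_sub,
        dotProduct_sub, hF a ha, hF b hb, sub_self]
    have htop : vectorSpan ℝ F ≠ ⊤ := by
      intro htop
      have hmem : y ∈ LinearMap.ker (dotProductBilin ℝ ℝ y) := hker (htop ▸ Submodule.mem_top)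
      exact hy (dotProduct_self_eq_zero.1 hmem)
    have := Submodule.finrank_lt htop
    rw [Module.finrank_fin_fun] at this
    omega
  · have hspan : Submodule.span ℝ (Set.range ![v - u, w - u]) ≤ vectorSpan ℝ F := by
      refine Submodule.span_le.2 ?_
      rintro _ ⟨i, rfl⟩
      fin_cases i
      · simpa using vsub_mem_vectorSpan ℝ hv hu
      · simpa using vsub_mem_vectorSpan ℝ hw hu
    have hcard := finrank_span_eq_card (linearIndependent_sub_of_tripleProd h)
    rw [Fintype.card_fin] at hcard
    exact hcard.ge.trans (Submodule.finrank_mono hspan)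

theorem eq_of_combination_of_mem_extremePoints {P : Set (Fin 3 → ℝ)} (hP : Convex ℝ P)
    {o u v w p : Fin 3 → ℝ} (ho : o ∈ interior P) (hu : u + o ∈ P) (hv : v + o ∈ P)
    (hw : w + o ∈ P) (hp : p + o ∈ Set.extremePoints ℝ P) {α β γ : ℝ} (hα : 0 ≤ α) (hβ : 0 ≤ β)
    (hγ : 0 ≤ γ) (hsum : α + β + γ ≤ 1) (h : p = α • u + β • v + γ • w) :
    p = u ∨ p = v ∨ p = w := by
  have hsub : convexHull ℝ {u + o, v + o, w + o, o} ⊆ P := by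
    refine convexHull_min ?_ hP
    rintro _ (rfl | rfl | rfl | rfl)
    exacts [hu, hv, hw, interior_subset ho]
  have hmem : p + o ∈ convexHull ℝ {u + o, v + o, w + o, o} := by
    have hcomb : p + o = α • (u + o) + β • (v + o) + γ • (w + o) + (1 - α - β - γ) • o := by
      rw [h]
      module
    have hconv := (convex_convexHull ℝ {u + o, v + o, w + o, o}).sum_mem (t := Finset.univ)
      (w := ![α, β, γ, 1 - α - β - γ]) (z := ![u + o, v + o, w + o, o]) ?_ ?_ ?_
    · rw [hcomb]
      simpa [Fin.sum_univ_four] using hconv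
    · intro i _
      fin_cases i
      exacts [hα, hβ, hγ, by simp; linarith]
    · simp [Fin.sum_univ_four]
    · intro i _
      refine subset_convexHull ℝ _ ?_
      fin_cases i <;> simp
  have hne : p + o ≠ o := fun h0 =>
    Set.disjoint_left.1 (disjoint_interior_extremePoints P) (h0.symm ▸ ho) hp
  have hext := extremePoints_convexHull_subset
    (inter_extremePoints_subset_extremePoints_of_subset hsub ⟨hmem, hp⟩)
  simpa [hne, -add_eq_right] using hext

theorem isSimplicialAround_image_sub {V : Finset (Fin 3 → ℝ)} {P : Set (Fin 3 → ℝ)}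
    (hP : P = convexHull ℝ (V : Set (Fin 3 → ℝ))) {o : Fin 3 → ℝ} (ho : o ∈ interior P)
    (hvert : ∀ v ∈ V, v ∈ Set.extremePoints ℝ P)
    (hsimplicial : ∀ F : Set (Fin 3 → ℝ), IsExposed ℝ P F →
      Module.finrank ℝ (vectorSpan ℝ F) = 2 → ((V : Set (Fin 3 → ℝ)) ∩ F).ncard = 3) :
    IsSimplicialAround (V.image (· - o)) := by
  have hmem : ∀ p, p ∈ V.image (· - o) ↔ p + o ∈ V := fun p => by
    simp [Finset.mem_image, sub_eq_iff_eq_add]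
  have hVP : ∀ p ∈ V, p ∈ P := fun p hp => (hvert p hp).1
  have hle : ∀ (y : Fin 3 → ℝ) (c : ℝ), (∀ p ∈ V.image (· - o), y ⬝ᵥ p ≤ c) →
      ∀ x ∈ P, y ⬝ᵥ x ≤ c + y ⬝ᵥ o := by
    intro y c h x hx
    rw [hP] at hx
    refine dotProduct_le_of_mem_convexHull (fun p hp => ?_) hx
    have := h (p - o) (Finset.mem_image_of_mem _ hp)
    rw [dotProduct_sub] at this
    linarith
  refine ⟨fun y hy => ?_, ?_, ?_⟩
  · refine eq_zero_of_mem_interior ho fun x hx => ?_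
    simpa using hle y 0 hy x hx
  · intro y hy u hu v hv w hw htri hyu hyv hyw p hp hpu hpv hpw
    refine lt_of_le_of_ne (hy p hp) fun hyp => ?_
    rw [hmem] at hu hv hw hp
    have hy0 : y ≠ 0 := by
      rintro rfl
      simp at hyu
    have hface : ∀ a, a + o ∈ V → y ⬝ᵥ a = 1 → a + o ∈ {x ∈ P | y ⬝ᵥ x = 1 + y ⬝ᵥ o} :=
      fun a ha hya => ⟨hVP _ ha, by rw [dotProduct_add, hya]⟩
    have hcard := hsimplicial _ (isExposed_dotProduct_eq (hle y 1 hy))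
      (finrank_vectorSpan_eq_two hy0 (fun x hx => hx.2) (hface u hu hyu) (hface v hv hyv)
        (hface w hw hyw) htri)
    have huv : u ≠ v := fun h => htri (h ▸ tripleProd_self_left _ _)
    have huw : u ≠ w := fun h => htri (h ▸ tripleProd_self_outer _ _)
    have hvw : v ≠ w := fun h => htri (h ▸ tripleProd_self_right _ _)
    have hthree : ({u + o, v + o, w + o} : Set (Fin 3 → ℝ)).ncard = 3 :=
      Set.ncard_eq_three.2 ⟨_, _, _, by simpa using huv, by simpa using huw, by simpa using hvw,
        rfl⟩
    have heq := Set.eq_of_subset_of_ncard_le (s := {u + o, v + o, w + o})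
      (t := (V : Set (Fin 3 → ℝ)) ∩ {x ∈ P | y ⬝ᵥ x = 1 + y ⬝ᵥ o}) ?_ (by rw [hcard, hthree])
      (V.finite_toSet.inter_of_left _)
    · have hpm : p + o ∈ ({u + o, v + o, w + o} : Set (Fin 3 → ℝ)) :=
        heq ▸ ⟨hp, hface p hp hyp⟩
      simp [hpu, hpv, hpw] at hpm
    · rintro _ (rfl | rfl | rfl)
      exacts [⟨hu, hface u hu hyu⟩, ⟨hv, hface v hv hyv⟩, ⟨hw, hface w hw hyw⟩]
  · intro u hu v hv w hw p hp α β γ hα hβ hγ hsum h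
    rw [hmem] at hu hv hw hp
    exact eq_of_combination_of_mem_extremePoints (hP ▸ convex_convexHull ℝ _) ho (hVP _ hu)
      (hVP _ hv) (hVP _ hw) (hvert _ hp) hα hβ hγ hsum h

theorem IsSimplicialAround.exists_supporting_edge {W : Finset (Fin 3 → ℝ)}
    (hW : IsSimplicialAround W) {u v w : Fin 3 → ℝ} (h : IsFacet W u v w) :
    ∃ y : Fin 3 → ℝ, (∀ p ∈ W, y ⬝ᵥ p ≤ 1) ∧ y ⬝ᵥ u = 1 ∧ y ⬝ᵥ v = 1 ∧
      ∀ p ∈ W, y ⬝ᵥ p = 1 → p = u ∨ p = v := by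
  obtain ⟨w', h'⟩ := hW.exists_adjacent h
  refine ⟨(1 / 2 : ℝ) • (polarVertex u v w + polarVertex v u w'), ?_, ?_, ?_, ?_⟩ <;>
    simp only [smul_dotProduct, add_dotProduct, smul_eq_mul, h.dotProduct_left,
      h.dotProduct_middle, h'.dotProduct_left, h'.dotProduct_middle]
  · intro p hp
    linarith [h.dotProduct_le_one hp, h'.dotProduct_le_one hp]
  · norm_num
  · norm_num
  · intro p hp hyp
    have h1 := h.eq_of_dotProduct_eq_one hp
      (by linarith [h.dotProduct_le_one hp, h'.dotProduct_le_one hp])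
    have h2 := h'.eq_of_dotProduct_eq_one hp
      (by linarith [h.dotProduct_le_one hp, h'.dotProduct_le_one hp])
    obtain h1 | h1 | rfl := h1
    · exact Or.inl h1
    · exact Or.inr h1
    · obtain h2 | h2 | rfl := h2
      · exact Or.inr h2
      · exact Or.inl h2
      · have hpos := h'.tripleProd_pos
        rw [tripleProd_swap] at hpos
        linarith [h.tripleProd_pos]

/-- The Legendre–Cauchy–Dehn theorem: every convex polyhedron in ℝ³ is infinitesimally
rigid. If `P` is the convex hull of a finite set `V` of points, has nonempty interior,
every point of `V` is a vertex (extreme point), every 2-dimensional exposed face is a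
triangle, and `q : V → ℝ³` is an isometric infinitesimal deformation (stationary edge
lengths), then `q` is the restriction of an infinitesimal isometry `v ↦ ω × v + b`. -/
theorem legendre_cauchy_dehn
    (V : Finset (Fin 3 → ℝ)) (P : Set (Fin 3 → ℝ))
    (hP : P = convexHull ℝ (V : Set (Fin 3 → ℝ)))
    (hint : (interior P).Nonempty)
    (hvert : ∀ v ∈ V, v ∈ Set.extremePoints ℝ P)
    (hsimplicial : ∀ F : Set (Fin 3 → ℝ), IsExposed ℝ P F →
      Module.finrank ℝ (vectorSpan ℝ F) = 2 → ((V : Set (Fin 3 → ℝ)) ∩ F).ncard = 3)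
    (q : (Fin 3 → ℝ) → (Fin 3 → ℝ))
    (hq : ∀ v ∈ V, ∀ w ∈ V, v ≠ w → IsExposed ℝ P (segment ℝ v w) →
      (v - w) ⬝ᵥ (q v - q w) = 0) :
    ∃ ω b : Fin 3 → ℝ, ∀ v ∈ V, q v = crossProduct ω v + b := by
  obtain ⟨o, ho⟩ := hint
  have hW := isSimplicialAround_image_sub hP ho hvert hsimplicial
  have hmem : ∀ p, p ∈ V.image (· - o) ↔ p + o ∈ V := fun p => by
    simp [Finset.mem_image, sub_eq_iff_eq_add]
  obtain ⟨ω, b, hωb⟩ := hW.exists_infinitesimal_isometry (q := fun p => q (p + o)) (by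
    intro u v w h
    obtain ⟨y, hle, hyu, hyv, heq⟩ := hW.exists_supporting_edge h
    have hu := (hmem u).1 h.left_mem
    have hv := (hmem v).1 h.middle_mem
    have hexp : IsExposed ℝ P (segment ℝ (u + o) (v + o)) := by
      rw [hP]
      refine isExposed_segment (y := y) (c := 1 + y ⬝ᵥ o) (fun p hp => ?_) hu hv
        (by rw [dotProduct_add, hyu]) (by rw [dotProduct_add, hyv]) fun p hp hyp => ?_
      · have := hle (p - o) (Finset.mem_image_of_mem _ hp)
        rw [dotProduct_sub] at this
        linarith
      · have := heq (p - o) (Finset.mem_image_of_mem _ hp) (by rw [dotProduct_sub, hyp]; ring)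
        simpa only [sub_eq_iff_eq_add] using this
    have := hq _ hu _ hv (by simpa using h.left_ne_middle) hexp
    simpa using this)
  refine ⟨ω, b - crossProduct ω o, fun v hv => ?_⟩
  have := hωb (v - o) (Finset.mem_image_of_mem _ hv)
  simp only [sub_add_cancel, map_sub] at this
  rw [this]
  abel
end

section
/- Let m ≥ 3, let c : ZMod m → (0, π) be fixed, and let ρⱼ : ℝ → (0, π) (j ∈ ZMod m) be differentiable at t₀ and such that for every j and every t in a neighborhood of t₀ the triple (ρⱼ(t), ρ_{j+1}(t), cⱼ) forms a valid spherical triangle. Define αⱼ(t) = ang(cⱼ; ρⱼ(t), ρ_{j+1}(t)), βⱼ(t) = ang(ρ_{j+1}(t); ρⱼ(t), cⱼ), γⱼ(t) = ang(ρⱼ(t); ρ_{j+1}(t), cⱼ), the curvature κ(t) = 2π − Σⱼ αⱼ(t), the exterior angles λⱼ(t) = π − βⱼ(t) − γ_{j−1}(t), sⱼ(t) = cos ρⱼ(t), and the total curvature K(t) = κ(t) + Σⱼ sⱼ(t)·λⱼ(t) of the warped spherical polygon. Then K is differentiable at t₀ with K′(t₀) = Σⱼ sⱼ′(t₀)·λⱼ(t₀);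 equivalently, κ′(t₀) + Σⱼ sⱼ(t₀)·λⱼ′(t₀) = 0. -/
/-- `sAng z x y` is the angle opposite the side of length `z` in a spherical triangle
with side lengths `x`, `y`, `z` (spherical law of cosines). -/
noncomputable def sAng (z x y : ℝ) : ℝ :=
  Real.arccos ((Real.cos z - Real.cos x * Real.cos y) / (Real.sin x * Real.sin y))

/-- `x`, `y`, `z` are the side lengths of a valid (nondegenerate) spherical triangle. -/
def ValidTriangle (x y z : ℝ) : Prop :=
  0 < x ∧ x < Real.pi ∧ 0 < y ∧ y < Real.pi ∧ 0 < z ∧ z < Real.pi ∧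
    |x - y| < z ∧ z < x + y ∧ x + y + z < 2 * Real.pi

/-- Derivative of a spherical angle along a motion of the three sides, in terms of the square
root `D` of the Gram determinant of the triangle. -/
theorem hasDerivAt_sAng {x y z : ℝ → ℝ} {x' y' z' t D : ℝ}
    (hx : HasDerivAt x x' t) (hy : HasDerivAt y y' t) (hz : HasDerivAt z z' t)
    (hsx : 0 < Real.sin (x t)) (hsy : 0 < Real.sin (y t)) (hD : 0 < D)
    (hD2 : D ^ 2 = 1 - Real.cos (x t) ^ 2 - Real.cos (y t) ^ 2 - Real.cos (z t) ^ 2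
      + 2 * Real.cos (x t) * Real.cos (y t) * Real.cos (z t)) :
    HasDerivAt (fun s => sAng (z s) (x s) (y s))
      ((Real.sin (z t) * z'
        - x' * (Real.cos (y t) - Real.cos (z t) * Real.cos (x t)) / Real.sin (x t)
        - y' * (Real.cos (x t) - Real.cos (z t) * Real.cos (y t)) / Real.sin (y t)) / D) t := by
  have hsx2 := Real.sin_sq_add_cos_sq (x t)
  have hsy2 := Real.sin_sq_add_cos_sq (y t)
  have hf := (hz.cos.sub (hx.cos.mul hy.cos)).div (hx.sin.mul hy.sin) (mul_pos hsx hsy).ne'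
  have hone : 1 - ((Real.cos (z t) - Real.cos (x t) * Real.cos (y t))
      / (Real.sin (x t) * Real.sin (y t))) ^ 2
      = (D / (Real.sin (x t) * Real.sin (y t))) ^ 2 := by
    have hprod : Real.sin (x t) ^ 2 * Real.sin (y t) ^ 2
        = (1 - Real.cos (x t) ^ 2) * (1 - Real.cos (y t) ^ 2) := by
      rw [Real.sin_sq, Real.sin_sq]
    field_simp
    linear_combination hprod - hD2
  have hpos : 0 < D / (Real.sin (x t) * Real.sin (y t)) := by positivity
  have hlt : ((Real.cos (z t) - Real.cos (x t) * Real.cos (y t))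
      / (Real.sin (x t) * Real.sin (y t))) ^ 2 < 1 := by
    nlinarith [pow_pos hpos 2]
  obtain ⟨h₁, h₂⟩ := abs_lt.mp ((sq_lt_one_iff_abs_lt_one _).mp hlt)
  have h := (Real.hasDerivAt_arccos h₁.ne' h₂.ne).comp t hf
  rw [hone, Real.sqrt_sq hpos.le] at h
  refine h.congr_deriv ?_
  simp only [Pi.mul_apply, Pi.sub_apply]
  field_simp
  linear_combination
    (-(x' * Real.cos (y t) * Real.sin (y t))) * hsx2
      - (y' * Real.cos (x t) * Real.sin (x t)) * hsy2

/-- The Gram determinant of a valid spherical triangle is positive. -/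
theorem ValidTriangle.gram_pos {x y z : ℝ} (h : ValidTriangle x y z) :
    0 < 1 - Real.cos x ^ 2 - Real.cos y ^ 2 - Real.cos z ^ 2
      + 2 * Real.cos x * Real.cos y * Real.cos z := by
  obtain ⟨hx, hx', hy, hy', hz, hz', hxy, hlt, hsum⟩ := h
  have h₁ : Real.cos z < Real.cos (x - y) := by
    rw [← Real.cos_abs (x - y)]
    exact Real.cos_lt_cos_of_nonneg_of_le_pi (abs_nonneg _) hz'.le hxy
  have h₂ : Real.cos (x + y) < Real.cos z := by
    rcases le_total (x + y) Real.pi with hle | hle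
    · exact Real.cos_lt_cos_of_nonneg_of_le_pi hz.le hle hlt
    · rw [← Real.cos_two_pi_sub (x + y)]
      exact Real.cos_lt_cos_of_nonneg_of_le_pi hz.le (by linarith) (by linarith)
  have h := mul_pos (sub_pos.mpr h₁) (sub_pos.mpr h₂)
  rw [Real.cos_sub, Real.cos_add] at h
  have hprod : Real.sin x ^ 2 * Real.sin y ^ 2
      = (1 - Real.cos x ^ 2) * (1 - Real.cos y ^ 2) := by
    rw [Real.sin_sq, Real.sin_sq]
  linarith

/-- If one side of a spherical triangle stays fixed, the derivatives of its angles satisfy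
`α′ + cos x · β′ + cos y · γ′ = 0`. -/
theorem ValidTriangle.exists_hasDerivAt_sAng {x y : ℝ → ℝ} {x' y' c t : ℝ}
    (h : ValidTriangle (x t) (y t) c) (hx : HasDerivAt x x' t) (hy : HasDerivAt y y' t) :
    ∃ a b g : ℝ, HasDerivAt (fun s => sAng c (x s) (y s)) a t ∧
      HasDerivAt (fun s => sAng (y s) (x s) c) b t ∧
      HasDerivAt (fun s => sAng (x s) (y s) c) g t ∧
      a + Real.cos (x t) * b + Real.cos (y t) * g = 0 := by
  obtain ⟨D, hD, hD2⟩ : ∃ D : ℝ, 0 < D ∧ D ^ 2 = 1 - Real.cos (x t) ^ 2 - Real.cos (y t) ^ 2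
      - Real.cos c ^ 2 + 2 * Real.cos (x t) * Real.cos (y t) * Real.cos c :=
    ⟨_, Real.sqrt_pos.mpr h.gram_pos, Real.sq_sqrt h.gram_pos.le⟩
  obtain ⟨hx₀, hxπ, hy₀, hyπ, hc₀, hcπ, -⟩ := h
  have hsx := Real.sin_pos_of_pos_of_lt_pi hx₀ hxπ
  have hsy := Real.sin_pos_of_pos_of_lt_pi hy₀ hyπ
  have hsc := Real.sin_pos_of_pos_of_lt_pi hc₀ hcπ
  have hc := hasDerivAt_const t c
  refine ⟨_, _, _, hasDerivAt_sAng hx hy hc hsx hsy hD hD2,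
    hasDerivAt_sAng hx hc hy hsx hsc hD (hD2.trans (by ring)),
    hasDerivAt_sAng hy hc hx hsy hsc hD (hD2.trans (by ring)), ?_⟩
  have hsx2 := Real.sin_sq_add_cos_sq (x t)
  have hsy2 := Real.sin_sq_add_cos_sq (y t)
  field_simp
  linear_combination
    (Real.sin c * x' * Real.cos (y t) * Real.sin (y t)) * hsx2
      + (Real.sin c * y' * Real.cos (x t) * Real.sin (x t)) * hsy2

/-- First variation of the total curvature of a warped spherical polygon with fixed
boundary edge lengths: `K′ = Σⱼ sⱼ′·λⱼ`, where `sⱼ = cos ρⱼ`,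
`κ = 2π − Σⱼ αⱼ`, `λⱼ = π − βⱼ − γ_{j−1}` and `K = κ + Σⱼ sⱼ λⱼ`. -/
theorem warped_spherical_polygon_total_curvature_deriv
    (m : ℕ) [NeZero m] (hm : 3 ≤ m)
    (c : ZMod m → ℝ) (hc : ∀ j, 0 < c j ∧ c j < Real.pi)
    (ρ : ZMod m → ℝ → ℝ) (t₀ : ℝ) (ρ' : ZMod m → ℝ)
    (hρ : ∀ j, HasDerivAt (ρ j) (ρ' j) t₀)
    (hρrange : ∀ j, ∀ᶠ t in nhds t₀, 0 < ρ j t ∧ ρ j t < Real.pi)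
    (hvalid : ∀ j, ∀ᶠ t in nhds t₀, ValidTriangle (ρ j t) (ρ (j + 1) t) (c j)) :
    HasDerivAt
      (fun t =>
        (2 * Real.pi - ∑ j, sAng (c j) (ρ j t) (ρ (j + 1) t)) +
        ∑ j, Real.cos (ρ j t) *
          (Real.pi - sAng (ρ (j + 1) t) (ρ j t) (c j)
            - sAng (ρ (j - 1) t) (ρ j t) (c (j - 1))))
      (∑ j, (-Real.sin (ρ j t₀) * ρ' j) *
        (Real.pi - sAng (ρ (j + 1) t₀) (ρ j t₀) (c j)
          - sAng (ρ (j - 1) t₀) (ρ j t₀) (c (j - 1))))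
      t₀ := by
  choose a b g ha hb hg habg using fun j =>
    (hvalid j).self_of_nhds.exists_hasDerivAt_sAng (hρ j) (hρ (j + 1))
  have hg' : ∀ j, HasDerivAt (fun t => sAng (ρ (j - 1) t) (ρ j t) (c (j - 1))) (g (j - 1)) t₀ := by
    intro j
    have := hg (j - 1)
    rwa [sub_add_cancel] at this
  have h := ((HasDerivAt.fun_sum (u := Finset.univ) fun j _ => ha j).const_sub (2 * Real.pi)).add
    (HasDerivAt.fun_sum (u := Finset.univ) fun j _ =>
      (hρ j).cos.mul (((hb j).const_sub Real.pi).sub (hg' j)))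
  refine h.congr_deriv ?_
  have hshift : ∑ j, Real.cos (ρ j t₀) * g (j - 1) = ∑ j, Real.cos (ρ (j + 1) t₀) * g j := by
    rw [← Equiv.sum_comp (Equiv.addRight (1 : ZMod m))]
    simp
  have hzero : ∑ j, (a j + Real.cos (ρ j t₀) * b j + Real.cos (ρ (j + 1) t₀) * g j) = 0 :=
    Finset.sum_eq_zero fun j _ => habg j
  simp only [Finset.sum_add_distrib] at hzero
  simp only [Pi.sub_apply, Finset.sum_add_distrib, mul_sub, Finset.sum_sub_distrib, mul_neg,
    Finset.sum_neg_distrib]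
  linarith
end

section
/- Let (a₀, b₀, c₀) ∈ (0, π)³ form a valid spherical triangle, and set α₀ = ang(a₀; b₀, c₀), β₀ = ang(b₀; c₀, a₀), γ₀ = ang(c₀; a₀, b₀). Then the function a ↦ ang(a; b₀, c₀) is differentiable at a₀ with derivative 1/(sin b₀ · sin γ₀), this value also equals 1/(sin c₀ · sin β₀), and the function b ↦ ang(a₀; b, c₀) is differentiable at b₀ with derivative −cot γ₀ / sin b₀. -/
/-- The Gram determinant of three unit vectors at mutual spherical distances `x`, `y`, `z`. -/
noncomputable def sphericalGram (x y z : ℝ) : ℝ :=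
  1 - Real.cos x ^ 2 - Real.cos y ^ 2 - Real.cos z ^ 2 + 2 * Real.cos x * Real.cos y * Real.cos z

theorem sphericalGram_rotate (x y z : ℝ) : sphericalGram y z x = sphericalGram x y z := by
  unfold sphericalGram; ring

theorem sphericalGram_eq_prod (x y z : ℝ) :
    sphericalGram x y z =
      (Real.cos (x - y) - Real.cos z) * (Real.cos z - Real.cos (x + y)) := by
  rw [Real.cos_sub, Real.cos_add, sphericalGram]
  linear_combination -Real.sin y ^ 2 * Real.sin_sq_add_cos_sq x
    - (1 - Real.cos x ^ 2) * Real.sin_sq_add_cos_sq y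

theorem ValidTriangle.sphericalGram_pos {x y z : ℝ} (h : ValidTriangle x y z) :
    0 < sphericalGram x y z := by
  obtain ⟨hx, hx', hy, hy', hz, hz', hxy, hzxy, hsum⟩ := h
  rw [abs_lt] at hxy
  rw [sphericalGram_eq_prod]
  apply mul_pos <;> rw [Real.cos_sub_cos]
  · have h₁ : 0 < Real.sin ((x - y + z) / 2) :=
      Real.sin_pos_of_pos_of_lt_pi (by linarith) (by linarith)
    have h₂ : Real.sin ((x - y - z) / 2) < 0 :=
      Real.sin_neg_of_neg_of_neg_pi_lt (by linarith) (by linarith)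
    nlinarith [mul_neg_of_pos_of_neg h₁ h₂]
  · have h₁ : 0 < Real.sin ((z + (x + y)) / 2) :=
      Real.sin_pos_of_pos_of_lt_pi (by linarith) (by linarith)
    have h₂ : Real.sin ((z - (x + y)) / 2) < 0 :=
      Real.sin_neg_of_neg_of_neg_pi_lt (by linarith) (by linarith)
    nlinarith [mul_neg_of_pos_of_neg h₁ h₂]

theorem ValidTriangle.rotate {x y z : ℝ} (h : ValidTriangle x y z) : ValidTriangle y z x := by
  obtain ⟨hx, hx', hy, hy', hz, hz', hxy, hzxy, hsum⟩ := h
  rw [abs_lt] at hxy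
  exact ⟨hy, hy', hz, hz', hx, hx', abs_lt.2 ⟨by linarith, by linarith⟩, by linarith,
    by linarith⟩

section

variable {x y z : ℝ}

theorem ValidTriangle.sin_pos (h : ValidTriangle x y z) : 0 < Real.sin x :=
  Real.sin_pos_of_pos_of_lt_pi h.1 h.2.1

theorem ValidTriangle.one_sub_sq_eq (h : ValidTriangle x y z) :
    1 - ((Real.cos z - Real.cos x * Real.cos y) / (Real.sin x * Real.sin y)) ^ 2 =
      sphericalGram x y z / (Real.sin x * Real.sin y) ^ 2 := by
  have hx := h.sin_pos.ne'
  have hy := h.rotate.sin_pos.ne'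
  rw [sphericalGram]
  field_simp
  rw [Real.sin_sq x, Real.sin_sq y]
  ring

theorem ValidTriangle.sqrt_one_sub_sq_eq (h : ValidTriangle x y z) :
    √(1 - ((Real.cos z - Real.cos x * Real.cos y) / (Real.sin x * Real.sin y)) ^ 2) =
      √(sphericalGram x y z) / (Real.sin x * Real.sin y) := by
  rw [h.one_sub_sq_eq, Real.sqrt_div h.sphericalGram_pos.le,
    Real.sqrt_sq (mul_pos h.sin_pos h.rotate.sin_pos).le]

theorem ValidTriangle.abs_lt_one (h : ValidTriangle x y z) :
    |(Real.cos z - Real.cos x * Real.cos y) / (Real.sin x * Real.sin y)| < 1 := by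
  rw [← sq_lt_one_iff_abs_lt_one, ← sub_pos, h.one_sub_sq_eq]
  exact div_pos h.sphericalGram_pos (pow_pos (mul_pos h.sin_pos h.rotate.sin_pos) 2)

theorem ValidTriangle.sin_sAng (h : ValidTriangle x y z) :
    Real.sin (sAng z x y) = √(sphericalGram x y z) / (Real.sin x * Real.sin y) := by
  rw [sAng, Real.sin_arccos, h.sqrt_one_sub_sq_eq]

theorem ValidTriangle.cos_sAng (h : ValidTriangle x y z) :
    Real.cos (sAng z x y) =
      (Real.cos z - Real.cos x * Real.cos y) / (Real.sin x * Real.sin y) :=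
  Real.cos_arccos (abs_lt.1 h.abs_lt_one).1.le (abs_lt.1 h.abs_lt_one).2.le

theorem ValidTriangle.hasDerivAt_arccos (h : ValidTriangle x y z) :
    HasDerivAt Real.arccos (-(Real.sin x * Real.sin y / √(sphericalGram x y z)))
      ((Real.cos z - Real.cos x * Real.cos y) / (Real.sin x * Real.sin y)) := by
  have h' := Real.hasDerivAt_arccos (abs_lt.1 h.abs_lt_one).1.ne' (abs_lt.1 h.abs_lt_one).2.ne
  rwa [h.sqrt_one_sub_sq_eq, one_div_div] at h'

theorem ValidTriangle.hasDerivAt_sAng_opposite (h : ValidTriangle x y z) :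
    HasDerivAt (fun t => sAng t x y) (Real.sin z / √(sphericalGram x y z)) z := by
  have hx := h.sin_pos.ne'
  have hy := h.rotate.sin_pos.ne'
  have hs := (Real.sqrt_pos.2 h.sphericalGram_pos).ne'
  have hf := ((Real.hasDerivAt_cos z).sub_const (Real.cos x * Real.cos y)).div_const
    (Real.sin x * Real.sin y)
  refine (h.hasDerivAt_arccos.comp z hf).congr_deriv ?_
  field_simp

theorem ValidTriangle.hasDerivAt_sAng_adjacent (h : ValidTriangle x y z) :
    HasDerivAt (fun t => sAng z t y)
      (-((Real.cos y - Real.cos z * Real.cos x) / (Real.sin x * √(sphericalGram x y z)))) x := by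
  have hx := h.sin_pos.ne'
  have hy := h.rotate.sin_pos.ne'
  have hs := (Real.sqrt_pos.2 h.sphericalGram_pos).ne'
  have hf := (((Real.hasDerivAt_cos x).mul_const (Real.cos y)).const_sub (Real.cos z)).div
    ((Real.hasDerivAt_sin x).mul_const (Real.sin y)) (mul_ne_zero hx hy)
  refine (h.hasDerivAt_arccos.comp x hf).congr_deriv ?_
  field_simp
  rw [Real.sin_sq x]
  ring

end

/-- Derivatives of the angle `α = sAng a (b₀) (c₀)` of a spherical triangle with
respect to the side lengths: `∂α/∂a = 1/(sin b₀ sin γ₀) = 1/(sin c₀ sin β₀)` and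
`∂α/∂b = −cot γ₀ / sin b₀`, where `β₀, γ₀` are the angles opposite `b₀, c₀`. -/
theorem sAng_hasDerivAt (a₀ b₀ c₀ : ℝ) (h : ValidTriangle a₀ b₀ c₀) :
    HasDerivAt (fun a => sAng a b₀ c₀)
      (1 / (Real.sin b₀ * Real.sin (sAng c₀ a₀ b₀))) a₀ ∧
    1 / (Real.sin b₀ * Real.sin (sAng c₀ a₀ b₀)) =
      1 / (Real.sin c₀ * Real.sin (sAng b₀ c₀ a₀)) ∧
    HasDerivAt (fun b => sAng a₀ b c₀)
      (-Real.cot (sAng c₀ a₀ b₀) / Real.sin b₀) b₀ := by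
  have hs := (Real.sqrt_pos.2 h.sphericalGram_pos).ne'
  have ha := h.sin_pos.ne'
  have hb := h.rotate.sin_pos.ne'
  have hc := h.rotate.rotate.sin_pos.ne'
  have hγ := h.sin_sAng
  have hβ := h.rotate.rotate.sin_sAng
  rw [← sphericalGram_rotate] at hβ
  refine ⟨h.rotate.hasDerivAt_sAng_opposite.congr_deriv ?_, ?_,
    h.rotate.hasDerivAt_sAng_adjacent.congr_deriv ?_⟩
  · rw [hγ, sphericalGram_rotate]
    field_simp
  · rw [hγ, hβ]
    field_simp
  · rw [Real.cot_eq_cos_div_sin, hγ, h.cos_sAng, sphericalGram_rotate]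
    field_simp
end

section
/- (Minkowski theorem in ℝ³.) Let ν₁,…,νₙ ∈ ℝ³ be pairwise distinct unit vectors spanning ℝ³ and let C₁,…,Cₙ > 0 satisfy Σᵢ Cᵢ·νᵢ = 0. Then there exists h ∈ ℝⁿ such that Q(h) is compact with nonempty interior and Aᵢ(h) = Cᵢ for every i; moreover, if h, h′ ∈ ℝⁿ both have this property, then there exists a ∈ ℝ³ with h′ᵢ = hᵢ + ⟨a, νᵢ⟩ for all i (the polyhedron is unique up to parallel translation). -/
open MeasureTheory
open scoped RealInnerProductSpace

/-- `Q(h) = {x ∈ ℝ³ : ⟨x, νᵢ⟩ ≤ hᵢ for all i}`. -/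
def polyQ {n : ℕ} (ν : Fin n → EuclideanSpace ℝ (Fin 3)) (h : Fin n → ℝ) :
    Set (EuclideanSpace ℝ (Fin 3)) :=
  {x | ∀ i, ⟪x, ν i⟫ ≤ h i}

/-- The area (2-dimensional Hausdorff measure) of the `i`-th face
`Fᵢ(h) = Q(h) ∩ {x : ⟨x, νᵢ⟩ = hᵢ}`. -/
noncomputable def faceArea {n : ℕ} (ν : Fin n → EuclideanSpace ℝ (Fin 3)) (h : Fin n → ℝ)
    (i : Fin n) : ℝ :=
  (μH[2] (polyQ ν h ∩ {x | ⟪x, ν i⟫ = h i})).toReal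

namespace Minkowski
open Set Filter Topology Pointwise

/-- The Euclidean space `ℝᵈ`. -/
abbrev E (d : ℕ) := EuclideanSpace ℝ (Fin d)

/-- The intersection of the half-spaces `⟨y, vⱼ⟩ ≤ cⱼ`. -/
def hpoly {n d : ℕ} (v : Fin n → E d) (c : Fin n → ℝ) : Set (E d) :=
  {y | ∀ j, ⟪y, v j⟫ ≤ c j}

/-- The volume of the polyhedron `hpoly v c`. -/
noncomputable def hvol {n d : ℕ} (v : Fin n → E d) (c : Fin n → ℝ) : ℝ :=
  volume.real (hpoly v c)

/-- The polyhedra `hpoly v c` are bounded, linearly in `c`. -/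
def BddSys {n d : ℕ} (v : Fin n → E d) : Prop :=
  ∃ R : ℝ, ∀ c, ∀ y ∈ hpoly v c, ‖y‖ ≤ R * ‖c‖

/-- The open polyhedron `⟨y, vⱼ⟩ < cⱼ` is nonempty. -/
def Strict {n d : ℕ} (v : Fin n → E d) (c : Fin n → ℝ) : Prop :=
  ∃ y : E d, ∀ j, ⟪y, v j⟫ < c j

variable {n d : ℕ}

lemma isClosed_hpoly (v : Fin n → E d) (c : Fin n → ℝ) : IsClosed (hpoly v c) := by
  simp only [hpoly, ofPred_forall]
  exact isClosed_iInter fun j => isClosed_le (by fun_prop) (by fun_prop)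

lemma isOpen_strict (v : Fin n → E d) (c : Fin n → ℝ) :
    IsOpen {y : E d | ∀ j, ⟪y, v j⟫ < c j} := by
  simp only [ofPred_forall]
  exact isOpen_iInter_of_finite fun j => isOpen_lt (by fun_prop) (by fun_prop)

lemma BddSys.isCompact {v : Fin n → E d} (hv : BddSys v) (c : Fin n → ℝ) :
    IsCompact (hpoly v c) := by
  obtain ⟨R, hR⟩ := hv
  refine Metric.isCompact_of_isClosed_isBounded (isClosed_hpoly v c) ?_
  exact (Metric.isBounded_closedBall (x := (0 : E d)) (r := R * ‖c‖)).subset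
    fun y hy => by simpa using hR c y hy

lemma BddSys.volume_lt_top {v : Fin n → E d} (hv : BddSys v) (c : Fin n → ℝ) :
    volume (hpoly v c) < ⊤ := (hv.isCompact c).measure_lt_top

lemma hvol_nonneg (v : Fin n → E d) (c : Fin n → ℝ) : 0 ≤ hvol v c := measureReal_nonneg

lemma Strict.hvol_pos {v : Fin n → E d} (hv : BddSys v) {c : Fin n → ℝ} (hc : Strict v c) :
    0 < hvol v c := by
  refine ENNReal.toReal_pos ?_ (hv.volume_lt_top c).ne
  have h1 := (isOpen_strict v c).measure_pos (volume : Measure (E d)) hc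
  exact (h1.trans_le (measure_mono fun y hy j => (hy j).le)).ne'

/-- A polyhedron with nonempty interior has an interior point, strict for all constraints. -/
lemma strict_of_interior {v : Fin n → E d} {c : Fin n → ℝ} (hv : ∀ j, v j ≠ 0)
    (h : (interior (hpoly v c)).Nonempty) : Strict v c := by
  obtain ⟨x, hx⟩ := h
  refine ⟨x, fun j => ?_⟩
  have hcont : Tendsto (fun t : ℝ => x + t • v j) (𝓝 0) (𝓝 x) := by
    have : Continuous fun t : ℝ => x + t • v j := by fun_prop
    simpa using this.tendsto 0
  have h1 : ∀ᶠ t in 𝓝[>] (0 : ℝ), x + t • v j ∈ hpoly v c :=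
    (hcont.eventually (mem_interior_iff_mem_nhds.mp hx)).filter_mono nhdsWithin_le_nhds
  obtain ⟨t, ht, ht0⟩ := (h1.and self_mem_nhdsWithin).exists
  have h2 := ht j
  rw [inner_add_left, real_inner_smul_left, real_inner_self_eq_norm_sq] at h2
  have : 0 < t * ‖v j‖ ^ 2 := mul_pos ht0 (by have := norm_pos_iff.mpr (hv j); positivity)
  linarith

lemma Strict.interior_nonempty {v : Fin n → E d} {c : Fin n → ℝ} (hc : Strict v c) :
    (interior (hpoly v c)).Nonempty := by
  obtain ⟨x, hx⟩ := hc
  exact ⟨x, mem_interior.mpr ⟨_, fun y hy j => (hy j).le, isOpen_strict v c, hx⟩⟩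

lemma convex_hpoly (v : Fin n → E d) (c : Fin n → ℝ) : Convex ℝ (hpoly v c) := by
  intro x hx y hy a b ha hb hab j
  have h1 := mul_le_mul_of_nonneg_left (hx j) ha
  have h2 := mul_le_mul_of_nonneg_left (hy j) hb
  rw [inner_add_left, real_inner_smul_left, real_inner_smul_left]
  have : c j = a * c j + b * c j := by rw [← add_mul, hab, one_mul]
  linarith

lemma strict_of_hvol_pos {v : Fin n → E d} {c : Fin n → ℝ} (hv : ∀ j, v j ≠ 0)
    (h : 0 < hvol v c) : Strict v c := by
  apply strict_of_interior hv
  by_contra hne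
  have h1 := (convex_hpoly v c).addHaar_frontier (volume : Measure (E d))
  rw [not_nonempty_iff_eq_empty] at hne
  rw [frontier, (isClosed_hpoly v c).closure_eq, hne, sdiff_empty] at h1
  simp [hvol, Measure.real, h1] at h

lemma volume_hyperplane {v : E d} (hv : v ≠ 0) (c : ℝ) :
    volume {y : E d | ⟪y, v⟫ = c} = 0 := by
  rcases eq_empty_or_nonempty {y : E d | ⟪y, v⟫ = c} with h | ⟨x, hx⟩
  · simp [h]
  · have h1 : {y : E d | ⟪y, v⟫ = c} = (fun y => y + -x) ⁻¹' ((ℝ ∙ v)ᗮ : Submodule ℝ (E d)) := by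
      ext y
      simp only [mem_ofPred_eq, mem_preimage, SetLike.mem_coe,
        Submodule.mem_orthogonal_singleton_iff_inner_left, inner_add_left, inner_neg_left] at hx ⊢
      constructor <;> intro h <;> linarith
    rw [h1, measure_preimage_add_right]
    apply Measure.addHaar_submodule
    intro h
    have : v ∈ ((ℝ ∙ v)ᗮ : Submodule ℝ (E d)) := by rw [h]; trivial
    rw [Submodule.mem_orthogonal_singleton_iff_inner_left] at this
    exact hv (by simpa using this)

/-- The volume of a polyhedron depends continuously on the right-hand sides. -/
lemma hvol_continuousAt {v : Fin n → E d} (hv : BddSys v) {c : Fin n → ℝ}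
    (hc : ∀ j, v j = 0 → c j ≠ 0) : ContinuousAt (hvol v) c := by
  have hrep : ∀ c, hvol v c = ∫ y, (hpoly v c).indicator (fun _ => (1 : ℝ)) y := fun c => by
    rw [integral_indicator (isClosed_hpoly v c).measurableSet]
    simp [hvol]
  rw [show hvol v = _ from funext hrep]
  obtain ⟨R, hR⟩ := id hv
  let B : Set (E d) := Metric.closedBall 0 (|R| * (‖c‖ + 1))
  have hB : volume B < ⊤ := (isCompact_closedBall _ _).measure_lt_top
  refine continuousAt_of_dominated (bound := B.indicator fun _ => (1 : ℝ)) ?_ ?_ ?_ ?_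
  · exact Eventually.of_forall fun c =>
      (measurable_const.indicator (isClosed_hpoly v c).measurableSet).aestronglyMeasurable
  · have h1 : ∀ᶠ c' in 𝓝 c, ‖c'‖ < ‖c‖ + 1 :=
      (continuous_norm.tendsto c).eventually (gt_mem_nhds (by linarith))
    filter_upwards [h1] with c' hc'
    refine Eventually.of_forall fun y => ?_
    by_cases hy : y ∈ hpoly v c'
    · have hyB : y ∈ B := by
        simp only [B, mem_closedBall_zero_iff]
        calc ‖y‖ ≤ R * ‖c'‖ := hR c' y hy
          _ ≤ |R| * ‖c'‖ := by gcongr; exact le_abs_self R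
          _ ≤ _ := by gcongr
      simp [hy, hyB]
    · simp only [hy, not_false_eq_true, indicator_of_notMem, norm_zero]
      exact indicator_nonneg (fun _ _ => zero_le_one) y
  · exact (integrable_indicator_iff Metric.isClosed_closedBall.measurableSet).mpr
      (integrableOn_const hB.ne)
  · have hnull : ∀ᵐ y : E d, ∀ j, ⟪y, v j⟫ ≠ c j := by
      rw [ae_all_iff]
      intro j
      by_cases hj : v j = 0
      · exact Eventually.of_forall fun y => by simpa [hj] using (hc j hj).symm
      · simpa [ae_iff] using volume_hyperplane hj (c j)
    filter_upwards [hnull] with y hy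
    apply ContinuousAt.congr (f := fun _ => (hpoly v c).indicator (fun _ => (1 : ℝ)) y)
      continuousAt_const
    have h2 : ∀ᶠ c' in 𝓝 c, ∀ j, (⟪y, v j⟫ ≤ c j ↔ ⟪y, v j⟫ ≤ c' j) := by
      rw [eventually_all]
      intro j
      have hj : Tendsto (fun c' : Fin n → ℝ => c' j) (𝓝 c) (𝓝 (c j)) :=
        (continuous_apply j).tendsto c
      rcases lt_or_gt_of_ne (hy j) with h | h
      · filter_upwards [hj.eventually (lt_mem_nhds h)] with c' hc'
        exact iff_of_true h.le hc'.le
      · filter_upwards [hj.eventually (gt_mem_nhds h)] with c' hc'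
        exact iff_of_false (not_le.mpr h) (not_le.mpr hc')
    filter_upwards [h2] with c' hc'
    have : y ∈ hpoly v c ↔ y ∈ hpoly v c' := forall_congr' hc'
    by_cases h : y ∈ hpoly v c
    · simp [h, this.mp h]
    · simp [h, mt this.mpr h]

lemma hvol_translate (v : Fin n → E d) (c : Fin n → ℝ) (a : E d) :
    hvol v (fun j => c j + ⟪a, v j⟫) = hvol v c := by
  have : hpoly v c = (fun y => y + a) ⁻¹' hpoly v (fun j => c j + ⟪a, v j⟫) := by
    ext y
    simp [hpoly, inner_add_left]
  rw [hvol, hvol, this, Measure.real, Measure.real, measure_preimage_add_right]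

lemma hpoly_smul (v : Fin n → E d) (c : Fin n → ℝ) {r : ℝ} (hr : 0 < r) :
    hpoly v (r • c) = r • hpoly v c := by
  ext y
  rw [mem_smul_set_iff_inv_smul_mem₀ hr.ne']
  simp only [hpoly, mem_ofPred_eq, Pi.smul_apply, smul_eq_mul, real_inner_smul_left]
  exact forall_congr' fun j => (inv_mul_le_iff₀ hr).symm

lemma hvol_smul (v : Fin n → E d) (c : Fin n → ℝ) {r : ℝ} (hr : 0 < r) :
    hvol v (r • c) = r ^ d * hvol v c := by
  rw [hvol, hpoly_smul v c hr, Measure.real, Measure.addHaar_smul]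
  simp [hvol, Measure.real, abs_of_pos hr, hr.le]

/-- An orthonormal frame adapted to the unit vector `u`. -/
lemma exists_frame {u : E (d + 1)} (hu : ‖u‖ = 1) :
    ∃ w : E d →ₗᵢ[ℝ] E (d + 1), (∀ y, ⟪w y, u⟫ = 0) ∧
      (∀ x, ∃ y, x = ⟪x, u⟫ • u + w y) ∧
      MeasurePreserving (fun p : ℝ × E d => p.1 • u + w p.2) (volume.prod volume) volume := by
  have hu0 : u ≠ 0 := by intro h; simp [h] at hu
  have : Fact (Module.finrank ℝ (E (d + 1)) = d + 1) := ⟨by simp⟩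
  let b := OrthonormalBasis.fromOrthogonalSpanSingleton (𝕜 := ℝ) d hu0
  let w : E d →ₗᵢ[ℝ] E (d + 1) := (Submodule.subtypeₗᵢ _).comp b.repr.symm.toLinearIsometry
  have hw : ∀ y, ⟪w y, u⟫ = 0 := fun y =>
    Submodule.mem_orthogonal_singleton_iff_inner_left.mp (b.repr.symm y).2
  let L : WithLp 2 (ℝ × E d) →ₗᵢ[ℝ] E (d + 1) :=
    { toFun := fun p => p.fst • u + w p.snd
      map_add' := fun p q => by simp only [WithLp.add_fst, WithLp.add_snd, map_add]; module
      map_smul' := fun r p => by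
        simp only [WithLp.smul_fst, WithLp.smul_snd, map_smul, smul_eq_mul, RingHom.id_apply]
        module
      norm_map' := fun p => by
        have h1 : ‖p.fst • u + w p.snd‖ ^ 2 = ‖p‖ ^ 2 := by
          rw [WithLp.prod_norm_sq_eq_of_L2, norm_add_sq_real, real_inner_smul_left,
            real_inner_comm, hw, norm_smul, hu, w.norm_map]
          simp
        exact (sq_eq_sq₀ (norm_nonneg _) (norm_nonneg _)).mp h1 }
  have hfr : Module.finrank ℝ (WithLp 2 (ℝ × E d)) = Module.finrank ℝ (E (d + 1)) := by
    rw [(WithLp.linearEquiv 2 ℝ (ℝ × E d)).finrank_eq]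
    simp [add_comm]
  let Le := L.toLinearIsometryEquiv hfr
  have hLe : ∀ p, Le p = p.fst • u + w p.snd := fun p => rfl
  refine ⟨w, hw, fun x => ⟨(Le.symm x).snd, ?_⟩, ?_⟩
  · have h1 := hLe (Le.symm x)
    rw [Le.apply_symm_apply] at h1
    have h2 : ⟪x, u⟫ = (Le.symm x).fst := by
      rw [h1, inner_add_left, hw, real_inner_smul_left, real_inner_self_eq_norm_sq, hu, ← h1]
      simp
    rw [h2]; exact h1
  · exact (Le.measurePreserving).comp (WithLp.volume_preserving_toLp ℝ (E d))

/-- A function with continuous partial derivatives is differentiable along every direction. -/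
lemma hasDerivAt_of_partial {V : (Fin n → ℝ) → ℝ} {U : Set (Fin n → ℝ)} (hU : IsOpen U)
    {A : Fin n → (Fin n → ℝ) → ℝ} (hA : ∀ i, ContinuousOn (A i) U)
    (hV : ∀ i, ∀ c ∈ U, HasDerivAt (fun s : ℝ => V (c + s • Pi.single i 1)) (A i c) 0)
    (k c : Fin n → ℝ) (hc : c ∈ U) :
    HasDerivAt (fun t : ℝ => V (c + t • k)) (∑ i, k i * A i c) 0 := by
  have key : ∀ S : Finset (Fin n), ∀ c ∈ U, HasDerivAt
      (fun t : ℝ => V (c + t • ∑ i ∈ S, k i • (Pi.single i 1 : Fin n → ℝ)))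
      (∑ i ∈ S, k i * A i c) 0 := by
    intro S
    induction S using Finset.induction_on with
    | empty => intro c _; simpa using hasDerivAt_const (0 : ℝ) (V c)
    | insert i S hi ih =>
      intro c hc
      set e : Fin n → ℝ := ∑ i ∈ S, k i • (Pi.single i 1 : Fin n → ℝ) with he
      let P : ℝ × ℝ → Fin n → ℝ := fun p => c + p.1 • e + p.2 • Pi.single i 1
      have hP : Continuous P := by fun_prop
      have hP0 : P (0, 0) = c := by simp [P]
      have hPU : ∀ᶠ p in 𝓝 ((0 : ℝ), (0 : ℝ)), P p ∈ U :=
        hP.continuousAt.eventually (by rw [hP0]; exact hU.mem_nhds hc)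
      have hcont : ∀ j, ContinuousAt (fun p => A j (P p)) (0, 0) := fun j => by
        refine ContinuousAt.comp (g := A j) ?_ hP.continuousAt
        rw [hP0]; exact (hA j).continuousAt (hU.mem_nhds hc)
      have main := hasStrictFDerivAt_uncurry_coprod (𝕜 := ℝ) (u := ((0 : ℝ), (0 : ℝ)))
        (f := fun t s => V (P (t, s)))
        (f₁ := fun t s => ContinuousLinearMap.toSpanSingleton ℝ (∑ j ∈ S, k j * A j (P (t, s))))
        (f₂ := fun t s => ContinuousLinearMap.toSpanSingleton ℝ (A i (P (t, s)))) ?_ ?_ ?_ ?_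
      · have hline : HasDerivAt (fun t : ℝ => (t, t * k i)) ((1 : ℝ), k i) 0 := by
          simpa using (hasDerivAt_id (0 : ℝ)).prodMk ((hasDerivAt_id (0 : ℝ)).mul_const (k i))
        have h2 := main.hasFDerivAt
        rw [show ((0 : ℝ), (0 : ℝ)) = (fun t : ℝ => (t, t * k i)) 0 by simp] at h2
        have h3 := h2.comp_hasDerivAt 0 hline
        have h4 : ∀ t : ℝ, c + t • (k i • (Pi.single i 1 : Fin n → ℝ) + e)
            = P (t, t * k i) := fun t => by simp only [P]; module
        rw [Finset.sum_insert hi, Finset.sum_insert hi, ← he]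
        simp only [h4]
        refine h3.congr_deriv ?_
        simp only [Function.HasUncurry.uncurry, id, zero_mul, hP0,
          ContinuousLinearMap.coprod_apply, ContinuousLinearMap.toSpanSingleton_apply,
          smul_eq_mul, one_mul]
        ring
      · filter_upwards [hPU] with p hp
        have h1 := ih (P p) hp
        have h2 : HasDerivAt (fun t => V (P (t, p.2))) (∑ j ∈ S, k j * A j (P p)) p.1 := by
          rw [← sub_self p.1] at h1
          refine (h1.comp_sub_const p.1 p.1).congr_of_eventuallyEq
            (Eventually.of_forall fun t => ?_)
          simp only [P]
          congr 1; module
        exact h2.hasFDerivAt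
      · filter_upwards [hPU] with p hp
        have h1 := hV i (P p) hp
        have h2 : HasDerivAt (fun t => V (P (p.1, t))) (A i (P p)) p.2 := by
          rw [← sub_self p.2] at h1
          refine (h1.comp_sub_const p.2 p.2).congr_of_eventuallyEq
            (Eventually.of_forall fun t => ?_)
          simp only [P]
          congr 1; module
        exact h2.hasFDerivAt
      · have h1 : ContinuousAt (fun p => ∑ j ∈ S, k j * A j (P p)) (0, 0) :=
          tendsto_finsetSum _ fun j _ => (hcont j).const_mul (k j)
        exact (ContinuousLinearMap.toSpanSingletonCLE (𝕜 := ℝ)).continuous.continuousAt.comp h1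
      · exact (ContinuousLinearMap.toSpanSingletonCLE (𝕜 := ℝ)).continuous.continuousAt.comp
          (hcont i)
  have h := key Finset.univ c hc
  have hk : ∑ i, k i • (Pi.single i 1 : Fin n → ℝ) = k := by
    ext j; simp [Finset.sum_apply, Pi.single_apply]
  rwa [hk] at h

/-- An isometric embedding `w` onto the orthogonal complement of the unit vector `u`. -/
structure IsFrame (u : E (d + 1)) (w : E d →ₗᵢ[ℝ] E (d + 1)) : Prop where
  norm : ‖u‖ = 1
  orth : ∀ y, ⟪w y, u⟫ = 0
  decomp : ∀ x, ∃ y, x = ⟪x, u⟫ • u + w y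
  mp : MeasurePreserving (fun p : ℝ × E d => p.1 • u + w p.2) (volume.prod volume) volume

/-- The constraint vectors induced on the range of `w`. -/
noncomputable def sliceVec (w : E d →ₗᵢ[ℝ] E (d + 1)) (v : Fin n → E (d + 1)) : Fin n → E d :=
  fun j => ContinuousLinearMap.adjoint w.toContinuousLinearMap (v j)

/-- The constraint values induced on the slice at height `s` in the direction `u`. -/
noncomputable def sliceC (u : E (d + 1)) (v : Fin n → E (d + 1)) (c : Fin n → ℝ) (s : ℝ) :
    Fin n → ℝ := fun j => c j - s * ⟪u, v j⟫

lemma inner_sliceVec (w : E d →ₗᵢ[ℝ] E (d + 1)) (v : Fin n → E (d + 1)) (y : E d) (j : Fin n) :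
    ⟪y, sliceVec w v j⟫ = ⟪w y, v j⟫ := by
  simp [sliceVec, ContinuousLinearMap.adjoint_inner_right]

lemma mem_slice (u : E (d + 1)) (w : E d →ₗᵢ[ℝ] E (d + 1)) (v : Fin n → E (d + 1))
    (c : Fin n → ℝ) (s : ℝ) (y : E d) :
    y ∈ hpoly (sliceVec w v) (sliceC u v c s) ↔ s • u + w y ∈ hpoly v c := by
  simp only [hpoly, mem_ofPred_eq, sliceC, inner_sliceVec, inner_add_left, real_inner_smul_left]
  exact forall_congr' fun j => by constructor <;> intro h <;> linarith

lemma BddSys.slice {v : Fin n → E (d + 1)} (hv : BddSys v) (w : E d →ₗᵢ[ℝ] E (d + 1)) :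
    BddSys (sliceVec w v) := by
  obtain ⟨R, hR⟩ := hv
  refine ⟨R, fun c y hy => ?_⟩
  rw [← w.norm_map]
  exact hR c (w y) fun j => by rw [← inner_sliceVec]; exact hy j

/-- Cavalieri's principle for polyhedra, with a weight depending on the height only. -/
lemma integral_slice {v : Fin n → E (d + 1)} (hv : BddSys v) {u : E (d + 1)}
    {w : E d →ₗᵢ[ℝ] E (d + 1)} (hw : IsFrame u w) (c : Fin n → ℝ) {f : ℝ → ℝ}
    (hf : Continuous f) :
    Integrable (fun s => f s * hvol (sliceVec w v) (sliceC u v c s)) ∧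
    ∫ x in hpoly v c, f ⟪x, u⟫ = ∫ s, f s * hvol (sliceVec w v) (sliceC u v c s) := by
  have hm : MeasurableSet (hpoly v c) := (isClosed_hpoly v c).measurableSet
  let g : E (d + 1) → ℝ := (hpoly v c).indicator fun x => f ⟪x, u⟫
  have hg : Integrable g := by
    rw [integrable_indicator_iff hm]
    exact ContinuousOn.integrableOn_compact (hv.isCompact c) (by fun_prop)
  have hg2 : Integrable (fun p : ℝ × E d => g (p.1 • u + w p.2)) (volume.prod volume) :=
    hw.mp.integrable_comp_of_integrable hg
  have hin : ∀ s, ∫ y, g (s • u + w y) = f s * hvol (sliceVec w v) (sliceC u v c s) := fun s => by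
    have h1 : ∀ y, g (s • u + w y)
        = (hpoly (sliceVec w v) (sliceC u v c s)).indicator (fun _ => f s) y := fun y => by
      have h2 := mem_slice u w v c s y
      have h3 : ⟪s • u + w y, u⟫ = s := by
        rw [inner_add_left, hw.orth, real_inner_smul_left, real_inner_self_eq_norm_sq, hw.norm]
        simp
      by_cases h : y ∈ hpoly (sliceVec w v) (sliceC u v c s)
      · simp only [g, indicator_of_mem h, indicator_of_mem (h2.mp h), h3]
      · simp only [g, indicator_of_notMem h, indicator_of_notMem (mt h2.mpr h)]
    simp only [h1]
    rw [integral_indicator (isClosed_hpoly _ _).measurableSet]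
    simp [hvol, mul_comm]
  constructor
  · have := hg2.integral_prod_left
    simpa only [hin] using this
  · rw [← integral_indicator hm]
    change ∫ x, g x = _
    rw [← hw.mp.map_eq, integral_map hw.mp.aemeasurable
      (by rw [hw.mp.map_eq]; exact hg.aestronglyMeasurable), integral_prod _ hg2]
    simp only [hin]

lemma hvol_eq_integral {v : Fin n → E (d + 1)} (hv : BddSys v) {u : E (d + 1)}
    {w : E d →ₗᵢ[ℝ] E (d + 1)} (hw : IsFrame u w) (c : Fin n → ℝ) :
    Integrable (fun s => hvol (sliceVec w v) (sliceC u v c s)) ∧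
    hvol v c = ∫ s, hvol (sliceVec w v) (sliceC u v c s) := by
  have h := integral_slice hv hw c (f := fun _ => 1) continuous_const
  simp only [one_mul] at h
  exact ⟨h.1, by simpa [hvol] using h.2⟩

/-- The volume of the slice at height `s` orthogonal to `vᵢ`, ignoring the `i`-th constraint. -/
noncomputable def freeSlice (v : Fin n → E (d + 1)) (w : E d →ₗᵢ[ℝ] E (d + 1)) (i : Fin n)
    (c : Fin n → ℝ) (s : ℝ) : ℝ :=
  hvol (sliceVec w v) (Function.update (sliceC (v i) v c s) i 1)

lemma sliceVec_self {v : Fin n → E (d + 1)} {w : E d →ₗᵢ[ℝ] E (d + 1)} {i : Fin n}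
    (hw : IsFrame (v i) w) : sliceVec w v i = 0 := by
  have := inner_sliceVec w v (sliceVec w v i) i
  rwa [hw.orth, inner_self_eq_zero] at this

lemma eq_of_sliceVec_eq_zero {v : Fin n → E (d + 1)} {u : E (d + 1)} {w : E d →ₗᵢ[ℝ] E (d + 1)}
    (hw : IsFrame u w) {j : Fin n} (h : sliceVec w v j = 0) : v j = ⟪v j, u⟫ • u := by
  obtain ⟨y, hy⟩ := hw.decomp (v j)
  have h1 : ⟪w y, v j⟫ = 0 := by rw [← inner_sliceVec, h, inner_zero_right]
  rw [hy, inner_add_right, real_inner_smul_right, hw.orth, real_inner_self_eq_norm_sq,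
    w.norm_map] at h1
  have h2 : y = 0 := by simpa using h1
  rwa [h2, map_zero, add_zero] at hy

lemma hvol_slice_of_le {v : Fin n → E (d + 1)} {w : E d →ₗᵢ[ℝ] E (d + 1)} {i : Fin n}
    (hw : IsFrame (v i) w) (c : Fin n → ℝ) {s : ℝ} (hs : s ≤ c i) :
    hvol (sliceVec w v) (sliceC (v i) v c s) = freeSlice v w i c s := by
  unfold freeSlice hvol
  congr 1
  ext y
  refine forall_congr' fun j => ?_
  by_cases hj : j = i
  · subst hj
    simp [sliceVec_self hw, sliceC, hw.norm, hs]
  · simp [hj]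

lemma hvol_slice_of_gt {v : Fin n → E (d + 1)} {w : E d →ₗᵢ[ℝ] E (d + 1)} {i : Fin n}
    (hw : IsFrame (v i) w) (c : Fin n → ℝ) {s : ℝ} (hs : c i < s) :
    hvol (sliceVec w v) (sliceC (v i) v c s) = 0 := by
  have : hpoly (sliceVec w v) (sliceC (v i) v c s) = ∅ := by
    rw [eq_empty_iff_forall_notMem]
    intro y hy
    have := hy i
    simp [sliceVec_self hw, sliceC, hw.norm] at this
    linarith
  simp [hvol, this]

lemma freeSlice_update (v : Fin n → E (d + 1)) (w : E d →ₗᵢ[ℝ] E (d + 1)) (i : Fin n)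
    (c : Fin n → ℝ) (r s : ℝ) : freeSlice v w i (Function.update c i r) s = freeSlice v w i c s := by
  unfold freeSlice
  congr 1
  ext j
  by_cases hj : j = i
  · subst hj; simp
  · simp [hj, sliceC]

lemma hvol_update {v : Fin n → E (d + 1)} (hv : BddSys v) {w : E d →ₗᵢ[ℝ] E (d + 1)} {i : Fin n}
    (hw : IsFrame (v i) w) (c : Fin n → ℝ) (r : ℝ) :
    IntegrableOn (freeSlice v w i c) (Iic r) ∧
    hvol v (Function.update c i r) = ∫ s in Iic r, freeSlice v w i c s := by
  have h := hvol_eq_integral hv hw (Function.update c i r)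
  have h1 : ∀ s, hvol (sliceVec w v) (sliceC (v i) v (Function.update c i r) s)
      = (Iic r).indicator (freeSlice v w i c) s := fun s => by
    by_cases hs : s ≤ r
    · rw [indicator_of_mem (by exact hs), hvol_slice_of_le hw _ (by simpa using hs),
        freeSlice_update]
    · rw [indicator_of_notMem (by exact hs), hvol_slice_of_gt hw _ (by simpa using hs)]
  simp only [h1] at h
  rwa [integrable_indicator_iff measurableSet_Iic, integral_indicator measurableSet_Iic] at h

lemma freeSlice_continuousAt {v : Fin n → E (d + 1)} (hv : BddSys v) (hunit : ∀ i, ‖v i‖ = 1)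
    (hinj : Function.Injective v) {w : E d →ₗᵢ[ℝ] E (d + 1)} {i : Fin n}
    (hw : IsFrame (v i) w) {c : Fin n → ℝ} (hc : Strict v c) :
    ContinuousAt (fun p : (Fin n → ℝ) × ℝ => freeSlice v w i p.1 p.2) (c, c i) := by
  unfold freeSlice
  refine ContinuousAt.comp (g := hvol (sliceVec w v))
    (f := fun p : (Fin n → ℝ) × ℝ => Function.update (sliceC (v i) v p.1 p.2) i 1)
    (hvol_continuousAt (hv.slice w) fun j hj => ?_) ?_
  · by_cases hji : j = i
    · subst hji; simp
    · have h1 := eq_of_sliceVec_eq_zero hw hj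
      have h2 : |⟪v j, v i⟫| = 1 := by
        have h3 := hunit j
        rw [h1, norm_smul, hunit i, mul_one] at h3
        simpa using h3
      have h4 : ⟪v j, v i⟫ = -1 := by
        rcases (abs_eq zero_le_one).mp h2 with h | h
        · rw [h, one_smul] at h1
          exact absurd (hinj h1) hji
        · exact h
      obtain ⟨y, hy⟩ := hc
      have h5 := hy j
      rw [h1, h4, real_inner_smul_right] at h5
      have h6 := hy i
      simp only [sliceC, Function.update_of_ne hji, real_inner_comm (v j), h4]
      linarith
  · refine Continuous.continuousAt ?_
    unfold sliceC
    fun_prop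

lemma isOpen_setOf_strict (v : Fin n → E d) : IsOpen {c | Strict v c} := by
  have : {c | Strict v c} = ⋃ y : E d, ⋂ j, {c | ⟪y, v j⟫ < c j} := by
    ext c; simp [Strict]
  rw [this]
  exact isOpen_iUnion fun y => isOpen_iInter_of_finite fun j =>
    isOpen_lt continuous_const (continuous_apply j)

/-- The derivative of volume with respect to one support number is the area of that face. -/
lemma hasDerivAt_hvol_single {v : Fin n → E (d + 1)} (hv : BddSys v) (hunit : ∀ i, ‖v i‖ = 1)
    (hinj : Function.Injective v) {w : E d →ₗᵢ[ℝ] E (d + 1)} {i : Fin n}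
    (hw : IsFrame (v i) w) {c : Fin n → ℝ} (hc : Strict v c) :
    HasDerivAt (fun s : ℝ => hvol v (c + s • Pi.single i 1)) (freeSlice v w i c (c i)) 0 := by
  have hupd : ∀ s : ℝ, c + s • Pi.single i 1 = Function.update c i (c i + s) := fun s => by
    ext j
    by_cases hj : j = i
    · subst hj; simp
    · simp [hj]
  simp only [hupd, (hvol_update hv hw c _).2]
  have hInt : ∀ r, IntegrableOn (freeSlice v w i c) (Iic r) := fun r => (hvol_update hv hw c r).1
  have hcont : ContinuousAt (freeSlice v w i c) (c i) :=
    ContinuousAt.comp (f := fun s : ℝ => (c, s)) (x := c i)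
      (freeSlice_continuousAt hv hunit hinj hw hc) (by fun_prop)
  have h1 : HasDerivAt (fun r => ∫ s in (c i)..r, freeSlice v w i c s)
      (freeSlice v w i c (c i)) (c i) :=
    intervalIntegral.integral_hasDerivAt_right (by simp)
      ⟨Iic (c i + 1), Iic_mem_nhds (by linarith), (hInt _).aestronglyMeasurable⟩ hcont
  have h2 : HasDerivAt (fun r => ∫ s in Iic r, freeSlice v w i c s)
      (freeSlice v w i c (c i)) (c i) := by
    refine (h1.add_const (∫ s in Iic (c i), freeSlice v w i c s)).congr_of_eventuallyEq
      (Eventually.of_forall fun r => ?_)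
    have := intervalIntegral.integral_Iic_sub_Iic (hInt (c i)) (hInt r)
    simp only
    linarith
  have h3 : HasDerivAt (fun s : ℝ => c i + s) 1 0 := (hasDerivAt_id _).const_add _
  have h4 := HasDerivAt.comp (0 : ℝ) (h₂ := fun r => ∫ s in Iic r, freeSlice v w i c s)
    (h := fun s => c i + s) (h₂' := freeSlice v w i c (c i)) (by simpa using h2) h3
  simpa [Function.comp_def] using h4

/-- The directional derivative of the volume in terms of the support numbers. -/
lemma hasDerivAt_hvol {v : Fin n → E (d + 1)} (hv : BddSys v) (hunit : ∀ i, ‖v i‖ = 1)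
    (hinj : Function.Injective v) {w : Fin n → E d →ₗᵢ[ℝ] E (d + 1)}
    (hw : ∀ i, IsFrame (v i) (w i)) {c : Fin n → ℝ} (hc : Strict v c) (k : Fin n → ℝ) :
    HasDerivAt (fun t : ℝ => hvol v (c + t • k)) (∑ i, k i * freeSlice v (w i) i c (c i)) 0 := by
  refine hasDerivAt_of_partial (isOpen_setOf_strict v)
    (A := fun i c => freeSlice v (w i) i c (c i)) (fun i c hc => ?_)
    (fun i c hc => hasDerivAt_hvol_single hv hunit hinj (hw i) hc) k c hc
  refine ContinuousAt.continuousWithinAt ?_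
  exact ContinuousAt.comp (f := fun c : Fin n → ℝ => (c, c i)) (x := c)
    (freeSlice_continuousAt hv hunit hinj (hw i) hc) (by fun_prop)

/-- The quantile function of a positive continuous density on an interval. -/
lemma exists_quantile {a b V : ℝ} {F : ℝ → ℝ} (hab : a < b) (hF : ContinuousOn F (Ioo a b))
    (hpos : ∀ s ∈ Ioo a b, 0 < F s) (hInt : IntegrableOn F (Ioo a b))
    (hV : ∫ s in Ioo a b, F s = V) :
    ∃ σ : ℝ → ℝ, (∀ p ∈ Ioo 0 V, σ p ∈ Ioo a b ∧ HasDerivAt σ (F (σ p))⁻¹ p) ∧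
      StrictMonoOn σ (Ioo 0 V) ∧ σ '' Ioo 0 V = Ioo a b := by
  let Φ : ℝ → ℝ := fun s => ∫ x in a..s, F x
  have hii : IntervalIntegrable F volume a b :=
    (intervalIntegrable_iff_integrableOn_Ioo_of_le hab.le).mpr hInt
  have hΦa : Φ a = 0 := by simp [Φ]
  have hΦb : Φ b = V := by
    simp only [Φ]
    rw [intervalIntegral.integral_of_le hab.le, integral_Ioc_eq_integral_Ioo, hV]
  have hΦc : ContinuousOn Φ (Icc a b) := by
    have := intervalIntegral.continuousOn_primitive_interval (μ := volume) (f := F)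
      (a := a) (b := b) (by
        rw [uIcc_of_le hab.le]
        rw [integrableOn_Icc_iff_integrableOn_Ioo]; exact hInt)
    rwa [uIcc_of_le hab.le] at this
  have hΦd : ∀ s ∈ Ioo a b, HasDerivAt Φ (F s) s := fun s hs => by
    refine intervalIntegral.integral_hasDerivAt_right ?_ ?_
      (hF.continuousAt (isOpen_Ioo.mem_nhds hs))
    · exact hii.mono_set (by rw [uIcc_of_le hs.1.le, uIcc_of_le hab.le]; exact Icc_subset_Icc_right hs.2.le)
    · exact ⟨Ioo a b, isOpen_Ioo.mem_nhds hs, hInt.aestronglyMeasurable⟩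
  have hmono : StrictMonoOn Φ (Icc a b) := by
    refine strictMonoOn_of_deriv_pos (convex_Icc a b) hΦc fun s hs => ?_
    rw [interior_Icc] at hs
    rw [(hΦd s hs).deriv]
    exact hpos s hs
  have hmaps : ∀ s ∈ Ioo a b, Φ s ∈ Ioo 0 V := fun s hs => by
    rw [← hΦa, ← hΦb]
    exact ⟨hmono (left_mem_Icc.mpr hab.le) (Ioo_subset_Icc_self hs) hs.1,
      hmono (Ioo_subset_Icc_self hs) (right_mem_Icc.mpr hab.le) hs.2⟩
  have hsurj : Ioo 0 V ⊆ Φ '' Ioo a b := by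
    rw [← hΦa, ← hΦb]
    exact intermediate_value_Ioo hab.le hΦc
  let σ := Function.invFunOn Φ (Ioo a b)
  have hσ : ∀ p ∈ Ioo 0 V, σ p ∈ Ioo a b ∧ Φ (σ p) = p := fun p hp =>
    ⟨Function.invFunOn_mem (hsurj hp), Function.invFunOn_eq (hsurj hp)⟩
  have hinj : InjOn Φ (Ioo a b) := (hmono.mono Ioo_subset_Icc_self).injOn
  have hσm : StrictMonoOn σ (Ioo 0 V) := fun p hp q hq hpq => by
    have h := hmono.lt_iff_lt (Ioo_subset_Icc_self (hσ p hp).1) (Ioo_subset_Icc_self (hσ q hq).1)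
    rw [(hσ p hp).2, (hσ q hq).2] at h
    exact h.mp hpq
  have himg : σ '' Ioo 0 V = Ioo a b := by
    apply Subset.antisymm
    · rintro _ ⟨p, hp, rfl⟩; exact (hσ p hp).1
    · intro s hs
      exact ⟨Φ s, hmaps s hs, hinj (hσ _ (hmaps s hs)).1 hs (hσ _ (hmaps s hs)).2⟩
  refine ⟨σ, fun p hp => ⟨(hσ p hp).1, ?_⟩, hσm, himg⟩
  refine HasDerivAt.of_local_left_inverse (f := Φ) ?_ (hΦd _ (hσ p hp).1)
    (hpos _ (hσ p hp).1).ne' ?_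
  · refine hσm.continuousAt_of_image_mem_nhds (isOpen_Ioo.mem_nhds hp) ?_
    rw [himg]
    exact isOpen_Ioo.mem_nhds (hσ p hp).1
  · filter_upwards [isOpen_Ioo.mem_nhds hp] with q hq using (hσ q hq).2

/-- One-dimensional Prékopa-Leindler inequality for densities of equal mass, with equality case. -/
lemma prekopa_leindler_Ioo {a b a' b' V : ℝ} {F G H : ℝ → ℝ} (hab : a < b) (hab' : a' < b')
    (hF : ContinuousOn F (Ioo a b)) (hFpos : ∀ s ∈ Ioo a b, 0 < F s)
    (hFint : IntegrableOn F (Ioo a b)) (hFV : ∫ s in Ioo a b, F s = V)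
    (hG : ContinuousOn G (Ioo a' b')) (hGpos : ∀ s ∈ Ioo a' b', 0 < G s)
    (hGint : IntegrableOn G (Ioo a' b')) (hGV : ∫ s in Ioo a' b', G s = V)
    (hHint : Integrable H) (hH0 : ∀ s, 0 ≤ H s)
    (hH : ∀ s ∈ Ioo a b, ∀ t ∈ Ioo a' b', F s * G t ≤ H ((s + t) / 2) ^ 2) :
    V ≤ ∫ s, H s ∧ (∫ s, H s ≤ V →
      ∃ τ, a' = a + τ ∧ b' = b + τ ∧ ∀ s ∈ Ioo a b, G (s + τ) = F s) := by
  obtain ⟨σ, hσ, hσm, hσi⟩ := exists_quantile hab hF hFpos hFint hFV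
  obtain ⟨τ, hτ, hτm, hτi⟩ := exists_quantile hab' hG hGpos hGint hGV
  have hV : 0 < V := by
    obtain ⟨x, hx⟩ := nonempty_Ioo.mpr hab
    rw [← hσi] at hx
    obtain ⟨p, hp, -⟩ := hx
    exact hp.1.trans hp.2
  let R : ℝ → ℝ := fun p => (σ p + τ p) / 2
  let R' : ℝ → ℝ := fun p => ((F (σ p))⁻¹ + (G (τ p))⁻¹) / 2
  have hR : ∀ p ∈ Ioo 0 V, HasDerivAt R (R' p) p := fun p hp =>
    ((hσ p hp).2.add (hτ p hp).2).div_const 2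
  have hRm : StrictMonoOn R (Ioo 0 V) := fun p hp q hq hpq => by
    have h1 := hσm hp hq hpq
    have h2 := hτm hp hq hpq
    simp only [R]; linarith
  have hR'pos : ∀ p ∈ Ioo 0 V, 0 < R' p := fun p hp => by
    have h1 := hFpos _ (hσ p hp).1
    have h2 := hGpos _ (hτ p hp).1
    simp only [R']; positivity
  have hRsq : ∀ p ∈ Ioo 0 V, R' p ^ 2 * (F (σ p) * G (τ p)) =
      1 + (F (σ p) - G (τ p)) ^ 2 / (4 * (F (σ p) * G (τ p))) := fun p hp => by
    have h1 := hFpos _ (hσ p hp).1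
    have h2 := hGpos _ (hτ p hp).1
    simp only [R']
    field_simp
    ring
  let q : ℝ → ℝ := fun p => |R' p| • H (R p)
  have hqsq : ∀ p ∈ Ioo 0 V,
      1 + (F (σ p) - G (τ p)) ^ 2 / (4 * (F (σ p) * G (τ p))) ≤ q p ^ 2 := fun p hp => by
    rw [← hRsq p hp]
    simp only [q, smul_eq_mul, mul_pow, sq_abs]
    exact mul_le_mul_of_nonneg_left (hH _ (hσ p hp).1 _ (hτ p hp).1) (sq_nonneg _)
  have hq0 : ∀ p, 0 ≤ q p := fun p => mul_nonneg (abs_nonneg _) (hH0 _)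
  have hq1 : ∀ p ∈ Ioo 0 V, 1 ≤ q p := fun p hp => by
    have h1 := hFpos _ (hσ p hp).1
    have h2 := hGpos _ (hτ p hp).1
    have h3 := hqsq p hp
    have h4 : 0 ≤ (F (σ p) - G (τ p)) ^ 2 / (4 * (F (σ p) * G (τ p))) := by positivity
    nlinarith [hq0 p]
  have hqint : IntegrableOn q (Ioo 0 V) :=
    (integrableOn_image_iff_integrableOn_abs_deriv_smul measurableSet_Ioo
      (fun p hp => (hR p hp).hasDerivWithinAt) hRm.injOn H).mp hHint.integrableOn
  have hqle : ∫ p in Ioo 0 V, q p ≤ ∫ s, H s := by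
    rw [← integral_image_eq_integral_abs_deriv_smul measurableSet_Ioo
      (fun p hp => (hR p hp).hasDerivWithinAt) hRm.injOn H]
    exact setIntegral_le_integral hHint (Eventually.of_forall hH0)
  have hone : ∫ _p in Ioo 0 V, (1 : ℝ) = V := by simp [hV.le]
  have hVq : V ≤ ∫ p in Ioo 0 V, q p := by
    calc V = ∫ _p in Ioo 0 V, (1 : ℝ) := hone.symm
      _ ≤ _ := setIntegral_mono_on (integrableOn_const (by simp)) hqint measurableSet_Ioo hq1
  refine ⟨hVq.trans hqle, fun hle => ?_⟩
  have hzero : ∫ p in Ioo 0 V, (q p - 1) = 0 := by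
    rw [integral_sub hqint (integrableOn_const (by simp)), hone]
    linarith
  have hae : ∀ᵐ p ∂(volume.restrict (Ioo 0 V)), q p - 1 = 0 := by
    refine (integral_eq_zero_iff_of_nonneg_ae ?_
      (hqint.sub (integrableOn_const (by simp)))).mp hzero
    filter_upwards [ae_restrict_mem measurableSet_Ioo] with p hp
    simpa using hq1 p hp
  have hFσ : ContinuousOn (fun p => F (σ p)) (Ioo 0 V) :=
    hF.comp (fun p hp => (hσ p hp).2.continuousAt.continuousWithinAt) fun p hp => (hσ p hp).1
  have hGτ : ContinuousOn (fun p => G (τ p)) (Ioo 0 V) :=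
    hG.comp (fun p hp => (hτ p hp).2.continuousAt.continuousWithinAt) fun p hp => (hτ p hp).1
  have heq : EqOn (fun p => F (σ p)) (fun p => G (τ p)) (Ioo 0 V) := by
    refine Measure.eqOn_Ioo_of_ae_eq volume ?_ hFσ hGτ
    filter_upwards [hae, ae_restrict_mem measurableSet_Ioo] with p hp0 hp
    have h1 := hFpos _ (hσ p hp).1
    have h2 := hGpos _ (hτ p hp).1
    have h3 := hqsq p hp
    rw [show q p = 1 by linarith] at h3
    have h4 : (F (σ p) - G (τ p)) ^ 2 / (4 * (F (σ p) * G (τ p))) ≤ 0 := by linarith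
    have h5 : (F (σ p) - G (τ p)) ^ 2 ≤ 0 := by
      by_contra! h
      have := div_pos h (show 0 < 4 * (F (σ p) * G (τ p)) by positivity)
      linarith
    have h6 := pow_eq_zero_iff (two_ne_zero) |>.mp (le_antisymm h5 (sq_nonneg _))
    linarith
  have hder : ∀ p ∈ Ioo 0 V, HasDerivAt (fun p => τ p - σ p) 0 p := fun p hp => by
    have := (hτ p hp).2.sub (hσ p hp).2
    have h := heq hp
    simp only at h
    rwa [h, sub_self] at this
  obtain ⟨δ, hδ⟩ := isOpen_Ioo.exists_is_const_of_deriv_eq_zero (isPreconnected_Ioo)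
    (fun p hp => (hder p hp).differentiableAt.differentiableWithinAt)
    (fun p hp => (hder p hp).deriv)
  have hshift : ∀ p ∈ Ioo 0 V, τ p = σ p + δ := fun p hp => by
    have := hδ p hp; linarith
  have hIoo : Ioo a' b' = Ioo (a + δ) (b + δ) := by
    rw [← hτi, ← image_add_const_Ioo, ← hσi, image_image]
    exact image_congr hshift
  refine ⟨δ, ?_, ?_, fun s hs => ?_⟩
  · have := congrArg sInf hIoo
    rwa [csInf_Ioo hab', csInf_Ioo (by linarith)] at this
  · have := congrArg sSup hIoo
    rwa [csSup_Ioo hab', csSup_Ioo (by linarith)] at this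
  · rw [← hσi] at hs
    obtain ⟨p, hp, rfl⟩ := hs
    rw [← hshift p hp]
    exact (heq hp).symm

/-- The heights of the interior of `hpoly v c` in the direction `u` form the interval `(a, b)`. -/
structure HeightRange (u : E (d + 1)) (w : E d →ₗᵢ[ℝ] E (d + 1)) (v : Fin n → E (d + 1))
    (c : Fin n → ℝ) (a b : ℝ) : Prop where
  lt : a < b
  eq : {s | Strict (sliceVec w v) (sliceC u v c s)} = Ioo a b
  mem : ∀ x ∈ hpoly v c, ⟪x, u⟫ ∈ Icc a b

lemma strict_slice_iff (u : E (d + 1)) (w : E d →ₗᵢ[ℝ] E (d + 1)) (v : Fin n → E (d + 1))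
    (c : Fin n → ℝ) (s : ℝ) : Strict (sliceVec w v) (sliceC u v c s) ↔
      ∃ y, ∀ j, ⟪s • u + w y, v j⟫ < c j := by
  refine exists_congr fun y => forall_congr' fun j => ?_
  simp only [sliceC, inner_sliceVec, inner_add_left, real_inner_smul_left]
  constructor <;> intro h <;> linarith

lemma IsFrame.inner_eq {u : E (d + 1)} {w : E d →ₗᵢ[ℝ] E (d + 1)} (hw : IsFrame u w) (s : ℝ)
    (y : E d) : ⟪s • u + w y, u⟫ = s := by
  rw [inner_add_left, hw.orth, real_inner_smul_left, real_inner_self_eq_norm_sq, hw.norm]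
  simp

lemma IsFrame.strict_slice_of_strict {u : E (d + 1)} {w : E d →ₗᵢ[ℝ] E (d + 1)}
    (hw : IsFrame u w) {v : Fin n → E (d + 1)} {c : Fin n → ℝ} {z : E (d + 1)}
    (hz : ∀ j, ⟪z, v j⟫ < c j) : Strict (sliceVec w v) (sliceC u v c ⟪z, u⟫) := by
  obtain ⟨y, hy⟩ := hw.decomp z
  rw [strict_slice_iff]
  exact ⟨y, by rwa [← hy]⟩

lemma strict_comb {v : Fin n → E d} {c : Fin n → ℝ} {x z : E d} (hx : x ∈ hpoly v c)
    (hz : ∀ j, ⟪z, v j⟫ < c j) {t : ℝ} (ht0 : 0 < t) (ht1 : t ≤ 1) :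
    ∀ j, ⟪(1 - t) • x + t • z, v j⟫ < c j := fun j => by
  rw [inner_add_left, real_inner_smul_left, real_inner_smul_left]
  have h1 := mul_le_mul_of_nonneg_left (hx j) (sub_nonneg.mpr ht1)
  have h2 := mul_lt_mul_of_pos_left (hz j) ht0
  linarith

lemma exists_heightRange {v : Fin n → E (d + 1)} (hv : BddSys v) {u : E (d + 1)}
    {w : E d →ₗᵢ[ℝ] E (d + 1)} (hw : IsFrame u w) {c : Fin n → ℝ} (hc : Strict v c) :
    ∃ a b, HeightRange u w v c a b := by
  let I : Set ℝ := {s | Strict (sliceVec w v) (sliceC u v c s)}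
  have hopen : IsOpen I := by
    have : Continuous (sliceC u v c) := by unfold sliceC; fun_prop
    exact (isOpen_setOf_strict (sliceVec w v)).preimage this
  obtain ⟨z, hz⟩ := id hc
  have hne : I.Nonempty := ⟨_, hw.strict_slice_of_strict hz⟩
  have hIx : ∀ s ∈ I, ∃ x, (∀ j, ⟪x, v j⟫ < c j) ∧ ⟪x, u⟫ = s := fun s hs => by
    obtain ⟨y, hy⟩ := (strict_slice_iff u w v c s).mp hs
    exact ⟨_, hy, hw.inner_eq s y⟩
  obtain ⟨R, hR⟩ := id hv
  have hbd : ∀ s ∈ I, |s| ≤ R * ‖c‖ := fun s hs => by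
    obtain ⟨x, hx, rfl⟩ := hIx s hs
    calc |⟪x, u⟫| ≤ ‖x‖ * ‖u‖ := abs_real_inner_le_norm x u
      _ = ‖x‖ := by rw [hw.norm, mul_one]
      _ ≤ _ := hR c x fun j => (hx j).le
  have hbelow : BddBelow I := ⟨-(R * ‖c‖), fun s hs => (abs_le.mp (hbd s hs)).1⟩
  have habove : BddAbove I := ⟨R * ‖c‖, fun s hs => (abs_le.mp (hbd s hs)).2⟩
  have hconv : Convex ℝ I := by
    rw [convex_iff_forall_pos]
    intro s hs t ht α β hα hβ hαβ
    obtain ⟨x, hx, rfl⟩ := hIx s hs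
    obtain ⟨y, hy, rfl⟩ := hIx t ht
    have h := hw.strict_slice_of_strict
      (strict_comb (fun j => (hx j).le) hy hβ (by linarith))
    rw [show 1 - β = α by linarith, inner_add_left, real_inner_smul_left,
      real_inner_smul_left] at h
    exact h
  have hIeq : I = Ioo (sInf I) (sSup I) := by
    apply Subset.antisymm
    · intro s hs
      obtain ⟨ε, hε, hball⟩ := Metric.isOpen_iff.mp hopen s hs
      have h1 : s - ε / 2 ∈ I := hball (by simp [abs_of_pos hε, hε])
      have h2 : s + ε / 2 ∈ I := hball (by simp [abs_of_pos hε, hε])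
      have h3 := csInf_le hbelow h1
      have h4 := le_csSup habove h2
      exact ⟨by linarith, by linarith⟩
    · exact IsConnected.Ioo_csInf_csSup_subset ⟨hne, hconv.isPreconnected⟩ hbelow habove
  have hlt : sInf I < sSup I := by
    rw [hIeq] at hne
    exact nonempty_Ioo.mp hne
  refine ⟨sInf I, sSup I, hlt, hIeq, fun x hx => ?_⟩
  rw [← closure_Ioo hlt.ne, ← hIeq]
  have h1 : Tendsto (fun t : ℝ => ⟪(1 - t) • x + t • z, u⟫) (𝓝[>] 0) (𝓝 ⟪x, u⟫) := by
    have : Continuous fun t : ℝ => ⟪(1 - t) • x + t • z, u⟫ := by fun_prop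
    have h := this.tendsto 0
    simp only [sub_zero, one_smul, zero_smul, add_zero] at h
    exact h.mono_left nhdsWithin_le_nhds
  refine mem_closure_of_tendsto h1 ?_
  filter_upwards [Ioc_mem_nhdsGT (zero_lt_one' ℝ)] with t ht
  exact hw.strict_slice_of_strict (strict_comb hx hz ht.1 ht.2)

section
variable {v : Fin n → E (d + 1)} {u : E (d + 1)} {w : E d →ₗᵢ[ℝ] E (d + 1)} {c : Fin n → ℝ}
  {a b : ℝ}

lemma HeightRange.slice_eq_zero (h : HeightRange u w v c a b) (hw : IsFrame u w) {s : ℝ}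
    (hs : s ∉ Icc a b) : hvol (sliceVec w v) (sliceC u v c s) = 0 := by
  have : hpoly (sliceVec w v) (sliceC u v c s) = ∅ := by
    rw [eq_empty_iff_forall_notMem]
    intro y hy
    rw [mem_slice] at hy
    have := h.mem _ hy
    rw [hw.inner_eq] at this
    exact hs this
  simp [hvol, this]

lemma HeightRange.continuousOn (h : HeightRange u w v c a b) (hv : BddSys v) :
    ContinuousOn (fun s => hvol (sliceVec w v) (sliceC u v c s)) (Ioo a b) := by
  intro s hs
  rw [← h.eq] at hs
  obtain ⟨y, hy⟩ := hs
  refine ContinuousAt.continuousWithinAt ?_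
  refine ContinuousAt.comp (g := hvol (sliceVec w v)) (f := sliceC u v c)
    (hvol_continuousAt (hv.slice w) fun j hj => ?_) ?_
  · have := hy j
    rw [hj, inner_zero_right] at this
    exact this.ne'
  · have : Continuous (sliceC u v c) := by unfold sliceC; fun_prop
    exact this.continuousAt

lemma HeightRange.pos (h : HeightRange u w v c a b) (hv : BddSys v) {s : ℝ} (hs : s ∈ Ioo a b) :
    0 < hvol (sliceVec w v) (sliceC u v c s) := by
  rw [← h.eq] at hs
  exact Strict.hvol_pos (hv.slice w) hs

lemma HeightRange.integral_eq (h : HeightRange u w v c a b) (hv : BddSys v) (hw : IsFrame u w) :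
    ∫ s in Ioo a b, hvol (sliceVec w v) (sliceC u v c s) = hvol v c := by
  rw [(hvol_eq_integral hv hw c).2, ← integral_Icc_eq_integral_Ioo]
  exact setIntegral_eq_integral_of_forall_compl_eq_zero fun s hs => h.slice_eq_zero hw hs

/-- The midpoint inequality for volumes of polyhedra, and the consequences of equality for
the slices orthogonal to `u`, deduced from the inequality for slices. -/
lemma midpoint_step {c' : Fin n → ℝ} {a' b' : ℝ} (hv : BddSys v) (hw : IsFrame u w)
    (IH : ∀ e e', Strict (sliceVec w v) e → Strict (sliceVec w v) e' →
      hvol (sliceVec w v) e * hvol (sliceVec w v) e'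
        ≤ hvol (sliceVec w v) ((1 / 2 : ℝ) • (e + e')) ^ 2)
    (hc : Strict v c) (hc' : Strict v c') (h : HeightRange u w v c a b)
    (h' : HeightRange u w v c' a' b') :
    hvol v c * hvol v c' ≤ hvol v ((1 / 2 : ℝ) • (c + c')) ^ 2 ∧
    (hvol v c = hvol v c' → hvol v ((1 / 2 : ℝ) • (c + c')) ≤ hvol v c →
      ∃ δ, a' = a + δ ∧ b' = b + δ ∧ ∀ s ∈ Ioo a b,
        hvol (sliceVec w v) (sliceC u v c' (s + δ)) = hvol (sliceVec w v) (sliceC u v c s)) := by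
  have hV := hc.hvol_pos hv
  have hV' := hc'.hvol_pos hv
  set V := hvol v c with hVdef
  set V' := hvol v c' with hVdef'
  set M := hvol v ((1 / 2 : ℝ) • (c + c')) with hMdef
  have hM0 : 0 ≤ M := hvol_nonneg _ _
  have hsq : 0 < √(V * V') := Real.sqrt_pos.mpr (mul_pos hV hV')
  have hsq2 : √(V * V') ^ 2 = V * V' := Real.sq_sqrt (mul_pos hV hV').le
  have hMint := hvol_eq_integral hv hw ((1 / 2 : ℝ) • (c + c'))
  have hmid : ∀ s t, sliceC u v ((1 / 2 : ℝ) • (c + c')) ((s + t) / 2)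
      = (1 / 2 : ℝ) • (sliceC u v c s + sliceC u v c' t) := fun s t => by
    ext j
    simp only [sliceC, Pi.smul_apply, Pi.add_apply, smul_eq_mul]
    ring
  have key := prekopa_leindler_Ioo (V := 1)
    (F := fun s => hvol (sliceVec w v) (sliceC u v c s) / V)
    (G := fun s => hvol (sliceVec w v) (sliceC u v c' s) / V')
    (H := fun s => hvol (sliceVec w v) (sliceC u v ((1 / 2 : ℝ) • (c + c')) s) / √(V * V'))
    h.lt h'.lt ((h.continuousOn hv).div_const _) (fun s hs => div_pos (h.pos hv hs) hV)
    ((hvol_eq_integral hv hw c).1.integrableOn.div_const _)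
    (by rw [integral_div, h.integral_eq hv hw, div_self hV.ne'])
    ((h'.continuousOn hv).div_const _) (fun s hs => div_pos (h'.pos hv hs) hV')
    ((hvol_eq_integral hv hw c').1.integrableOn.div_const _)
    (by rw [integral_div, h'.integral_eq hv hw, div_self hV'.ne'])
    (hMint.1.div_const _) (fun s => div_nonneg (hvol_nonneg _ _) hsq.le)
    (fun s hs t ht => by
      rw [div_mul_div_comm, div_pow, hsq2, hmid]
      rw [← h.eq] at hs
      rw [← h'.eq] at ht
      exact div_le_div_of_nonneg_right (IH _ _ hs ht) (mul_pos hV hV').le)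
  rw [integral_div, ← hMint.2, ← hMdef, one_le_div hsq, div_le_one hsq] at key
  refine ⟨?_, fun hVV hle => ?_⟩
  · rw [← hsq2]
    exact pow_le_pow_left₀ hsq.le key.1 2
  · have hs : √(V * V') = V := by rw [← hVV, Real.sqrt_mul_self hV.le]
    obtain ⟨δ, h1, h2, h3⟩ := key.2 (hle.trans_eq hs.symm)
    refine ⟨δ, h1, h2, fun s hs => ?_⟩
    have := h3 s hs
    simp only [← hVV] at this
    exact (div_left_inj' hV.ne').mp this

end

/-- Volume is midpoint log-concave as a function of the right-hand sides. -/
theorem hvol_midpoint : ∀ {d : ℕ} {v : Fin n → E d}, BddSys v → ∀ {c c' : Fin n → ℝ},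
    Strict v c → Strict v c' →
    hvol v c * hvol v c' ≤ hvol v ((1 / 2 : ℝ) • (c + c')) ^ 2 := by
  intro d
  induction d with
  | zero =>
    intro v _ c c' hc hc'
    have key : ∀ e : Fin n → ℝ, (∀ j, 0 < e j) → hvol v e = volume.real (univ : Set (E 0)) :=
      fun e he => by
        have : hpoly v e = univ := by
          ext y
          simp [hpoly, Subsingleton.elim y 0, fun j => (he j).le]
        rw [hvol, this]
    have h0 : ∀ {e : Fin n → ℝ}, Strict v e → ∀ j, 0 < e j := by
      rintro e ⟨y, hy⟩ j
      simpa [Subsingleton.elim y 0] using hy j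
    rw [key c (h0 hc), key c' (h0 hc'), key _ fun j => ?_, sq]
    have h1 := h0 hc j
    have h2 := h0 hc' j
    simp only [Pi.smul_apply, Pi.add_apply, smul_eq_mul]
    linarith
  | succ d ih =>
    intro v hv c c' hc hc'
    have hu : ‖(EuclideanSpace.single 0 1 : E (d + 1))‖ = 1 := by simp
    obtain ⟨w, h1, h2, h3⟩ := exists_frame hu
    have hw : IsFrame _ w := ⟨hu, h1, h2, h3⟩
    obtain ⟨a, b, h⟩ := exists_heightRange hv hw hc
    obtain ⟨a', b', h'⟩ := exists_heightRange hv hw hc'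
    exact (midpoint_step hv hw (fun e e' he he' => ih (hv.slice w) he he') hc hc' h h').1

/-- Polyhedra with tight constraints attaining equality in the midpoint inequality are
translates of each other. -/
theorem translate_of_hvol_midpoint {v : Fin n → E (d + 1)} (hv : BddSys v)
    {w : Fin n → E d →ₗᵢ[ℝ] E (d + 1)} (hw : ∀ i, IsFrame (v i) (w i)) {c c' : Fin n → ℝ}
    (hc : Strict v c) (hc' : Strict v c') (ht : ∀ i, ∃ x ∈ hpoly v c, ⟪x, v i⟫ = c i)
    (ht' : ∀ i, ∃ x ∈ hpoly v c', ⟪x, v i⟫ = c' i) (heq : hvol v c = hvol v c')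
    (hmid : hvol v ((1 / 2 : ℝ) • (c + c')) ≤ hvol v c) :
    ∃ a : E (d + 1), ∀ i, c' i = c i + ⟪a, v i⟫ := by
  have hV := hc.hvol_pos hv
  refine ⟨(hvol v c)⁻¹ • ((∫ x in hpoly v c', x) - ∫ x in hpoly v c, x), fun i => ?_⟩
  have hend : ∀ {e : Fin n → ℝ} {a b : ℝ}, HeightRange (v i) (w i) v e a b →
      (∃ x ∈ hpoly v e, ⟪x, v i⟫ = e i) → e i = b := fun {e a b} h hx => by
    apply le_antisymm
    · obtain ⟨x, hx, hxe⟩ := hx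
      exact hxe ▸ (h.mem x hx).2
    · refine le_of_forall_lt_imp_le_of_dense fun s hs => ?_
      by_cases hsa : s ≤ a
      · obtain ⟨x, hx, hxe⟩ := hx
        exact hsa.trans (hxe ▸ (h.mem x hx).1)
      · have hmem : s ∈ Ioo a b := ⟨not_le.mp hsa, hs⟩
        rw [← h.eq] at hmem
        obtain ⟨y, hy⟩ := (strict_slice_iff _ _ _ _ _).mp hmem
        have := hy i
        rw [(hw i).inner_eq] at this
        exact this.le
  obtain ⟨a, b, h⟩ := exists_heightRange hv (hw i) hc
  obtain ⟨a', b', h'⟩ := exists_heightRange hv (hw i) hc'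
  obtain ⟨δ, rfl, rfl, hδ⟩ := (midpoint_step hv (hw i)
    (fun e e' he he' => hvol_midpoint (hv.slice (w i)) he he') hc hc' h h').2 heq hmid
  rw [hend h (ht i), hend h' (ht' i)]
  congr 1
  have hInt : ∀ e, Integrable (fun x : E (d + 1) => x) (volume.restrict (hpoly v e)) := fun e =>
    ContinuousOn.integrableOn_compact (hv.isCompact e) continuousOn_id
  have hmom : ∀ e, ⟪∫ x in hpoly v e, x, v i⟫
      = ∫ s, s * hvol (sliceVec (w i) v) (sliceC (v i) v e s) := fun e => by
    rw [real_inner_comm, ← integral_inner (hInt e),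
      ← (integral_slice hv (hw i) e (f := fun s => s) continuous_id).2]
    exact integral_congr_ae (ae_of_all _ fun x => real_inner_comm _ _)
  have hae : ∀ᵐ s : ℝ, (s + δ) * hvol (sliceVec (w i) v) (sliceC (v i) v c' (s + δ))
      = s * hvol (sliceVec (w i) v) (sliceC (v i) v c s)
        + δ * hvol (sliceVec (w i) v) (sliceC (v i) v c s) := by
    have hne : ∀ x : ℝ, ∀ᵐ s : ℝ, s ≠ x := fun x => by simp [ae_iff]
    filter_upwards [hne a, hne b] with s hsa hsb
    rw [← add_mul]
    by_cases hs : s ∈ Icc a b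
    · rw [hδ s ⟨lt_of_le_of_ne hs.1 hsa.symm, lt_of_le_of_ne hs.2 hsb⟩]
    · rw [h.slice_eq_zero (hw i) hs, h'.slice_eq_zero (hw i) fun hs' => hs
        ⟨by linarith [hs'.1], by linarith [hs'.2]⟩, mul_zero]
  have hshift : ⟪∫ x in hpoly v c', x, v i⟫ = ⟪∫ x in hpoly v c, x, v i⟫ + δ * hvol v c := by
    have hF := hvol_eq_integral hv (hw i) c
    rw [hmom, hmom, ← integral_add_right_eq_self _ δ, integral_congr_ae hae,
      integral_add (integral_slice hv (hw i) c (f := fun s => s) continuous_id).1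
        (hF.1.const_mul δ), integral_const_mul, ← hF.2]
  rw [real_inner_smul_left, inner_sub_left, hshift]
  field_simp
  ring

/-- Spanning normals with a positive linear relation define uniformly bounded polyhedra. -/
lemma bddSys_of_span {v : Fin n → E d} (hspan : Submodule.span ℝ (range v) = ⊤)
    {C : Fin n → ℝ} (hC : ∀ i, 0 < C i) (hsum : ∑ i, C i • v i = 0) : BddSys v := by
  let L : E d →ₗ[ℝ] (Fin n → ℝ) := LinearMap.pi fun j => (innerₗ (E d)).flip (v j)
  have hL : ∀ y j, L y j = ⟪y, v j⟫ := fun y j => by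
    simp [L, real_inner_comm]
  have hinj : Function.Injective L := by
    rw [injective_iff_map_eq_zero]
    intro y hy
    have hmem : y ∈ (Submodule.span ℝ (range v))ᗮ := by
      rw [Submodule.mem_orthogonal]
      intro u hu
      induction hu using Submodule.span_induction with
      | mem x hx =>
        obtain ⟨j, rfl⟩ := hx
        rw [real_inner_comm, ← hL, hy]
        rfl
      | zero => simp
      | add x z _ _ hx hz => rw [inner_add_left, hx, hz, add_zero]
      | smul r x _ hx => rw [real_inner_smul_left, hx, mul_zero]
    simpa [hspan] using hmem
  obtain ⟨K, -, hK⟩ := L.injective_iff_antilipschitz.mp hinj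
  have hrel : ∀ y, ∑ j, C j * ⟪y, v j⟫ = 0 := fun y => by
    have := congrArg (fun x => ⟪y, x⟫) hsum
    simpa [inner_sum, real_inner_smul_right] using this
  set M := ∑ j, (1 + (∑ i, C i) / C j)
  have hterm : ∀ j, 0 ≤ 1 + (∑ i, C i) / C j := fun j =>
    add_nonneg zero_le_one (div_nonneg (Finset.sum_nonneg fun i _ => (hC i).le) (hC j).le)
  refine ⟨K * M, fun c y hy => ?_⟩
  have hle : ∀ j, ⟪y, v j⟫ ≤ ‖c‖ := fun j =>
    (hy j).trans ((le_abs_self _).trans (norm_le_pi_norm c j))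
  have hM : ‖L y‖ ≤ M * ‖c‖ := by
    have hM0 : 0 ≤ M := Finset.sum_nonneg fun j _ => hterm j
    rw [pi_norm_le_iff_of_nonneg (by positivity)]
    intro j
    have hMj : 1 + (∑ i, C i) / C j ≤ M :=
      Finset.single_le_sum (f := fun j => 1 + (∑ i, C i) / C j) (fun j _ => hterm j)
        (Finset.mem_univ j)
    refine le_trans ?_ (mul_le_mul_of_nonneg_right hMj (norm_nonneg c))
    rw [hL, Real.norm_eq_abs, abs_le]
    have hS : 0 ≤ (∑ i, C i) / C j :=
      div_nonneg (Finset.sum_nonneg fun i _ => (hC i).le) (hC j).le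
    constructor
    · have h1 : C j * (‖c‖ - ⟪y, v j⟫) ≤ ∑ i, C i * (‖c‖ - ⟪y, v i⟫) :=
        Finset.single_le_sum (f := fun i => C i * (‖c‖ - ⟪y, v i⟫))
          (fun i _ => mul_nonneg (hC i).le (sub_nonneg.mpr (hle i))) (Finset.mem_univ j)
      simp only [mul_sub, Finset.sum_sub_distrib, hrel, ← Finset.sum_mul] at h1
      have h2 : -(((∑ i, C i) / C j) * ‖c‖) ≤ ⟪y, v j⟫ := by
        rw [div_mul_eq_mul_div, ← neg_div, div_le_iff₀ (hC j)]
        nlinarith [mul_nonneg (hC j).le (norm_nonneg c)]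
      nlinarith [norm_nonneg c]
    · nlinarith [hle j, mul_nonneg hS (norm_nonneg c)]
  calc ‖y‖ ≤ K * ‖L y‖ := by
        have := hK.le_mul_dist y 0
        simpa using this
    _ ≤ K * (M * ‖c‖) := by gcongr
    _ = K * M * ‖c‖ := by ring

/-- Two-dimensional Hausdorff measure on the plane is a positive multiple of the volume. -/
lemma exists_hausdorffMeasure_eq :
    ∃ κ : ℝ, 0 < κ ∧ ∀ s : Set (E 2), (μH[2] s).toReal = κ * volume.real s := by
  have hH : (μH[2] : Measure (E 2)).IsAddHaarMeasure := by
    have := isAddHaarMeasure_hausdorffMeasure (E := E 2)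
    simpa using this
  have h := Measure.isAddLeftInvariant_eq_smul (μH[2] : Measure (E 2)) volume
  refine ⟨Measure.addHaarScalarFactor (μH[2] : Measure (E 2)) volume,
    Measure.addHaarScalarFactor_pos_of_isAddHaarMeasure _ _, fun s => ?_⟩
  conv_lhs => rw [h]
  rw [Measure.smul_apply, ENNReal.smul_def, smul_eq_mul, ENNReal.toReal_mul]
  rfl

/-- The area of a face, up to a constant depending only on normalizations. -/
lemma toReal_hausdorffMeasure_face {κ : ℝ}
    (hκ : ∀ s : Set (E 2), (μH[2] s).toReal = κ * volume.real s)
    {v : Fin n → E 3} {w : E 2 →ₗᵢ[ℝ] E 3} {i : Fin n} (hw : IsFrame (v i) w) (c : Fin n → ℝ) :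
    (μH[2] (hpoly v c ∩ {x | ⟪x, v i⟫ = c i})).toReal = κ * freeSlice v w i c (c i) := by
  have himg : hpoly v c ∩ {x | ⟪x, v i⟫ = c i} = (fun y => c i • v i + w y) ''
      hpoly (sliceVec w v) (sliceC (v i) v c (c i)) := by
    ext x
    simp only [mem_image, mem_slice]
    constructor
    · rintro ⟨hx, hxc⟩
      obtain ⟨y, hy⟩ := hw.decomp x
      rw [show ⟪x, v i⟫ = c i from hxc] at hy
      exact ⟨y, hy ▸ hx, hy.symm⟩
    · rintro ⟨y, hy, rfl⟩
      exact ⟨hy, hw.inner_eq _ _⟩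
  have hiso : Isometry fun y => c i • v i + w y :=
    (IsometryEquiv.addLeft (c i • v i)).isometry.comp w.isometry
  rw [himg, hiso.hausdorffMeasure_image (Or.inl (by norm_num)), hκ, ← hvol_slice_of_le hw c le_rfl]
  rfl

/-- Facial areas are homogeneous of degree one less than the dimension. -/
lemma freeSlice_smul {v : Fin n → E (d + 1)} {w : E d →ₗᵢ[ℝ] E (d + 1)} {i : Fin n}
    (hw : IsFrame (v i) w) (c : Fin n → ℝ) {r : ℝ} (hr : 0 < r) :
    freeSlice v w i (r • c) ((r • c) i) = r ^ d * freeSlice v w i c (c i) := by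
  rw [← hvol_slice_of_le hw c le_rfl, ← hvol_slice_of_le hw (r • c) le_rfl, ← hvol_smul _ _ hr]
  congr 1
  ext j
  simp [sliceC]
  ring

lemma hvol_continuous {v : Fin n → E d} (hv : BddSys v) (hv0 : ∀ j, v j ≠ 0) :
    Continuous (hvol v) :=
  continuous_iff_continuousAt.mpr fun _ => hvol_continuousAt hv fun j h => absurd h (hv0 j)

/-- Some polyhedron has facial areas proportional to the prescribed ones. -/
theorem exists_freeSlice_eq [NeZero n] {v : Fin n → E (d + 1)} (hv : BddSys v)
    (hunit : ∀ i, ‖v i‖ = 1) (hinj : Function.Injective v) {w : Fin n → E d →ₗᵢ[ℝ] E (d + 1)}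
    (hw : ∀ i, IsFrame (v i) (w i)) {C : Fin n → ℝ} (hC : ∀ i, 0 < C i)
    (hsum : ∑ i, C i • v i = 0) :
    ∃ c, Strict v c ∧ ∃ μ > 0, ∀ i, freeSlice v (w i) i c (c i) = μ * C i := by
  have hv0 : ∀ j, v j ≠ 0 := fun j h => by simpa [h] using hunit j
  have hcont := hvol_continuous hv hv0
  set ℓ : (Fin n → ℝ) → ℝ := fun h => ∑ i, C i * h i with hℓ
  have hℓc : Continuous ℓ := by fun_prop
  have hℓs : ∀ (r : ℝ) h, ℓ (r • h) = r * ℓ h := fun r h => by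
    simp only [hℓ, Pi.smul_apply, smul_eq_mul, Finset.mul_sum]
    exact Finset.sum_congr rfl fun i _ => by ring
  have hS : 0 < ∑ i, C i := Finset.sum_pos (fun i _ => hC i) Finset.univ_nonempty
  set K : Set (Fin n → ℝ) := {h | (∀ i, 0 ≤ h i) ∧ ℓ h = 1} with hK
  have hKc : IsCompact K := by
    refine Metric.isCompact_of_isClosed_isBounded ?_ ?_
    · have : K = (⋂ i, {h : Fin n → ℝ | 0 ≤ h i}) ∩ {h | ℓ h = 1} := by ext; simp [hK]
      rw [this]
      exact (isClosed_iInter fun i => isClosed_le continuous_const (continuous_apply i)).inter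
        (isClosed_eq hℓc continuous_const)
    · refine (Metric.isBounded_Icc (0 : Fin n → ℝ) fun i => (C i)⁻¹).subset fun h hh => ?_
      refine ⟨fun i => hh.1 i, fun i => ?_⟩
      have : C i * h i ≤ ℓ h := Finset.single_le_sum (f := fun i => C i * h i)
        (fun i _ => mul_nonneg (hC i).le (hh.1 i)) (Finset.mem_univ i)
      rw [hh.2] at this
      change h i ≤ (C i)⁻¹
      rwa [← one_div, le_div_iff₀ (hC i), mul_comm]
  have hc1 : (fun _ => (∑ i, C i)⁻¹ : Fin n → ℝ) ∈ K :=
    ⟨fun i => (inv_pos.mpr hS).le, by simp only [hℓ, ← Finset.sum_mul]; field_simp⟩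
  obtain ⟨c, hcK, hmax⟩ := hKc.exists_isMaxOn ⟨_, hc1⟩ hcont.continuousOn
  have hVpos : 0 < hvol v c := by
    refine lt_of_lt_of_le (Strict.hvol_pos hv ⟨0, fun j => ?_⟩) (hmax hc1)
    simpa using hS
  have hstrict := strict_of_hvol_pos hv0 hVpos
  have hbound : ∀ h, 0 ≤ ℓ h → hvol v h ≤ hvol v c * ℓ h ^ (d + 1) := fun h h0 => by
    rcases (hvol_nonneg v h).eq_or_lt with hz | hp
    · rw [← hz]; positivity
    · obtain ⟨y, hy⟩ := strict_of_hvol_pos hv0 hp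
      set g : Fin n → ℝ := fun j => h j + ⟪-y, v j⟫ with hg
      have hgpos : ∀ j, 0 < g j := fun j => by
        have := hy j
        simp only [hg, inner_neg_left]
        linarith
      have hrel : ∑ i, C i * ⟪-y, v i⟫ = 0 := by
        have := congrArg (fun x => ⟪-y, x⟫) hsum
        simpa only [inner_sum, real_inner_smul_right, inner_zero_right] using this
      have hgl : ℓ g = ℓ h := by
        simp only [hℓ, hg, mul_add, Finset.sum_add_distrib, hrel, add_zero]
      have hgp : 0 < ℓ g :=
        Finset.sum_pos (fun i _ => mul_pos (hC i) (hgpos i)) Finset.univ_nonempty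
      have hmem : (ℓ g)⁻¹ • g ∈ K :=
        ⟨fun i => (mul_pos (inv_pos.mpr hgp) (hgpos i)).le, by rw [hℓs, inv_mul_cancel₀ hgp.ne']⟩
      have h1 : hvol v ((ℓ g)⁻¹ • g) ≤ hvol v c := hmax hmem
      rw [← hgl, ← hvol_translate v h (-y), mul_comm]
      calc hvol v g = hvol v (ℓ g • ((ℓ g)⁻¹ • g)) := by rw [smul_inv_smul₀ hgp.ne']
        _ = ℓ g ^ (d + 1) * hvol v ((ℓ g)⁻¹ • g) := hvol_smul _ _ hgp
        _ ≤ _ := by gcongr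
  refine ⟨c, hstrict, (d + 1) * hvol v c, by positivity, fun i => ?_⟩
  have hder := hasDerivAt_hvol_single hv hunit hinj (hw i) hstrict
  have hlin : ∀ s : ℝ, ℓ (c + s • Pi.single i 1) = 1 + s * C i := fun s => by
    have h1 := hcK.2
    simp only [hℓ] at h1
    simp only [hℓ, Pi.add_apply, Pi.smul_apply, smul_eq_mul, mul_add, Finset.sum_add_distrib, h1]
    congr 1
    rw [Finset.sum_eq_single i]
    · simp [mul_comm]
    · intro j _ hj
      simp [Pi.single_eq_of_ne hj]
    · simp
  have hpow : HasDerivAt (fun s : ℝ => hvol v c * (1 + s * C i) ^ (d + 1))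
      (hvol v c * ((d + 1) * C i)) 0 := by
    have h1 : HasDerivAt (fun s : ℝ => 1 + s * C i) (C i) 0 := by
      simpa using ((hasDerivAt_id (0 : ℝ)).mul_const (C i)).const_add 1
    simpa using (h1.fun_pow (d + 1)).const_mul (hvol v c)
  have hmin : IsLocalMin (fun s : ℝ => hvol v c * (1 + s * C i) ^ (d + 1)
      - hvol v (c + s • Pi.single i 1)) 0 := by
    have hev : ∀ᶠ s : ℝ in 𝓝 0, 0 ≤ 1 + s * C i := by
      have : Tendsto (fun s : ℝ => 1 + s * C i) (𝓝 0) (𝓝 1) := by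
        have h : Continuous fun s : ℝ => 1 + s * C i := by fun_prop
        simpa using h.tendsto 0
      exact (this.eventually (lt_mem_nhds zero_lt_one)).mono fun _ h => h.le
    filter_upwards [hev] with s hs
    have := hbound (c + s • Pi.single i 1) (by rwa [hlin])
    rw [hlin] at this
    simpa using this
  have := hmin.hasDerivAt_eq_zero (hpow.sub hder)
  linarith

/-- Euler's identity: the volume is the sum of the volumes of the cones over the faces. -/
lemma hvol_eq_sum {v : Fin n → E (d + 1)} (hv : BddSys v) (hunit : ∀ i, ‖v i‖ = 1)
    (hinj : Function.Injective v) {w : Fin n → E d →ₗᵢ[ℝ] E (d + 1)}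
    (hw : ∀ i, IsFrame (v i) (w i)) {c : Fin n → ℝ} (hc : Strict v c) :
    (d + 1) * hvol v c = ∑ i, c i * freeSlice v (w i) i c (c i) := by
  have h1 := hasDerivAt_hvol hv hunit hinj hw hc c
  have h2 : HasDerivAt (fun t : ℝ => (1 + t) ^ (d + 1) * hvol v c) ((d + 1) * hvol v c) 0 := by
    have h1 : HasDerivAt (fun s : ℝ => 1 + s) 1 0 := (hasDerivAt_id (0 : ℝ)).const_add 1
    simpa using (h1.fun_pow (d + 1)).mul_const (hvol v c)
  refine h2.unique (h1.congr_of_eventuallyEq ?_)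
  filter_upwards [lt_mem_nhds (show (-1 : ℝ) < 0 by norm_num)] with t ht
  rw [← hvol_smul v c (by linarith : 0 < 1 + t), add_smul, one_smul]

/-- Along a segment on which the midpoint inequality holds and whose endpoints have equal value,
the initial slope controls the value at the midpoint. -/
lemma slope_ge_of_midpoint {f : ℝ → ℝ} {V D : ℝ} (hV : 0 < V) (h0 : f 0 = V)
    (hf : ∀ t ∈ Icc (0 : ℝ) 1, V * f t ≤ f (t / 2) ^ 2) (hpos : ∀ t ∈ Icc (0 : ℝ) 1, 0 < f t)
    (hD : HasDerivAt f D 0) : 2 * V * Real.log (f (1 / 2) / V) ≤ D := by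
  set L := Real.log (f (1 / 2) / V)
  set x : ℕ → ℝ := fun m => (1 / 2) ^ (m + 1) with hx
  have hxmem : ∀ m, x m ∈ Icc (0 : ℝ) 1 := fun m =>
    ⟨by positivity, pow_le_one₀ (by norm_num) (by norm_num)⟩
  have hlog : ∀ m, 2 * x m * L ≤ Real.log (f (x m) / V) := fun m => by
    induction m with
    | zero => simp [hx, L]
    | succ m ih =>
      have h1 := hf _ (hxmem m)
      have hxs : x m / 2 = x (m + 1) := by simp only [hx]; ring
      rw [hxs] at h1
      have p1 := hpos _ (hxmem m)
      have p2 := hpos _ (hxmem (m + 1))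
      have h2 : Real.log (f (x m) / V) ≤ 2 * Real.log (f (x (m + 1)) / V) := by
        rw [show 2 * Real.log (f (x (m + 1)) / V) = Real.log ((f (x (m + 1)) / V) ^ 2) by
          rw [Real.log_pow]; norm_num]
        apply Real.log_le_log (by positivity)
        rw [div_pow, div_le_div_iff₀ hV (by positivity)]
        nlinarith
      have h3 : 2 * x (m + 1) * L = x m * L := by rw [← hxs]; ring
      linarith
  have hval : ∀ m, V + 2 * x m * L * V ≤ f (x m) := fun m => by
    have p1 := hpos _ (hxmem m)
    have h1 := Real.log_le_sub_one_of_pos (div_pos p1 hV)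
    have h2 := (hlog m).trans h1
    rw [le_sub_iff_add_le, le_div_iff₀ hV] at h2
    linarith
  have hx0 : Tendsto x atTop (𝓝[≠] 0) := by
    refine tendsto_nhdsWithin_iff.mpr ⟨?_, Eventually.of_forall fun m => by simp [hx]⟩
    exact (tendsto_pow_atTop_nhds_zero_of_lt_one (by norm_num) (by norm_num)).comp
      (tendsto_add_atTop_nat 1)
  refine ge_of_tendsto ((hasDerivAt_iff_tendsto_slope.mp hD).comp hx0)
    (Eventually.of_forall fun m => ?_)
  have hxp : 0 < x m := by positivity
  simp only [Function.comp, slope_def_field, h0, sub_zero]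
  rw [le_div_iff₀ hxp]
  linarith [hval m]

/-- Two polyhedra with equal facial areas, the first having the larger volume, are translates of
each other. -/
lemma translate_of_hvol_le {v : Fin n → E (d + 1)} (hd : d ≠ 0) (hv : BddSys v)
    (hunit : ∀ i, ‖v i‖ = 1) (hinj : Function.Injective v)
    {w : Fin n → E d →ₗᵢ[ℝ] E (d + 1)} (hw : ∀ i, IsFrame (v i) (w i)) {c c' : Fin n → ℝ}
    (hc : Strict v c) (hc' : Strict v c') (ht : ∀ i, ∃ x ∈ hpoly v c, ⟪x, v i⟫ = c i)
    (ht' : ∀ i, ∃ x ∈ hpoly v c', ⟪x, v i⟫ = c' i)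
    (harea : ∀ i, freeSlice v (w i) i c (c i) = freeSlice v (w i) i c' (c' i))
    (hle : hvol v c' ≤ hvol v c) : ∃ a : E (d + 1), ∀ i, c' i = c i + ⟪a, v i⟫ := by
  have hV := hc.hvol_pos hv
  have hV' := hc'.hvol_pos hv
  obtain ⟨s, hs1, hs⟩ : ∃ s : ℝ, 1 ≤ s ∧ s ^ (d + 1) * hvol v c' = hvol v c := by
    refine ⟨(hvol v c / hvol v c') ^ (((d + 1 : ℕ) : ℝ)⁻¹), ?_, ?_⟩
    · exact Real.one_le_rpow ((one_le_div hV').mpr hle) (by positivity)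
    · rw [Real.rpow_inv_natCast_pow (by positivity) (Nat.succ_ne_zero d), div_mul_cancel₀ _ hV'.ne']
  have hs0 : 0 < s := by linarith
  have hvs : hvol v (s • c') = hvol v c := by rw [hvol_smul _ _ hs0, hs]
  have hstrict : Strict v (s • c') := by
    obtain ⟨y, hy⟩ := hc'
    refine ⟨s • y, fun j => ?_⟩
    rw [real_inner_smul_left]
    exact mul_lt_mul_of_pos_left (hy j) hs0
  set k := s • c' - c with hk
  have hseg : ∀ t ∈ Icc (0 : ℝ) 1, Strict v (c + t • k) := fun t ht => by
    rcases ht.1.eq_or_lt with rfl | htp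
    · simpa using hc
    · obtain ⟨x, hx⟩ := hc
      obtain ⟨y, hy⟩ := hstrict
      refine ⟨(1 - t) • x + t • y, fun j => ?_⟩
      have h1 := mul_le_mul_of_nonneg_left (hx j).le (sub_nonneg.mpr ht.2)
      have h2 := mul_lt_mul_of_pos_left (hy j) htp
      rw [inner_add_left, real_inner_smul_left, real_inner_smul_left]
      simp only [hk, Pi.add_apply, Pi.smul_apply, Pi.sub_apply, smul_eq_mul] at h2 ⊢
      linarith
  have hmid := fun t ht => hvol_midpoint hv hc (hseg t ht)
  have hhalf : ∀ t : ℝ, (1 / 2 : ℝ) • (c + (c + t • k)) = c + (t / 2) • k := fun t => by module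
  simp only [hhalf] at hmid
  have hslope := slope_ge_of_midpoint (f := fun t => hvol v (c + t • k)) hV (by simp) hmid
    (fun t ht => (hseg t ht).hvol_pos hv) (hasDerivAt_hvol hv hunit hinj hw hc k)
  have hsum : ∑ i, k i * freeSlice v (w i) i c (c i)
      = (d + 1) * (s * hvol v c' - hvol v c) := by
    have h1 := hvol_eq_sum hv hunit hinj hw hc
    have h2 := hvol_eq_sum hv hunit hinj hw hc'
    rw [mul_sub, mul_left_comm, h1, h2, Finset.mul_sum, ← Finset.sum_sub_distrib]
    refine Finset.sum_congr rfl fun i _ => ?_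
    rw [← harea i]
    simp [hk]
    ring
  rw [hsum] at hslope
  have h1 := hmid 1 (by simp)
  rw [one_smul, hk, add_sub_cancel, hvs, ← hk, ← pow_two,
    pow_le_pow_iff_left₀ hV.le (hvol_nonneg _ _) two_ne_zero] at h1
  have hlog : 0 ≤ Real.log (hvol v (c + (1 / 2 : ℝ) • k) / hvol v c) :=
    Real.log_nonneg ((one_le_div hV).mpr h1)
  have hsle : s ≤ s ^ (d + 1) := le_self_pow₀ hs1 (Nat.succ_ne_zero d)
  have hge : 0 ≤ s * hvol v c' - hvol v c := by
    have : 0 ≤ ((d : ℝ) + 1) * (s * hvol v c' - hvol v c) := le_trans (by positivity) hslope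
    exact nonneg_of_mul_nonneg_right this (by positivity)
  have hle' : s * hvol v c' ≤ hvol v c := by rw [← hs]; gcongr
  have hsV : s * hvol v c' = hvol v c := by linarith
  have hsone : s = 1 := by
    have h2 : s = s ^ (d + 1) := mul_right_cancel₀ hV'.ne' (hsV.trans hs.symm)
    have h3 : s ^ d = 1 := by
      rw [pow_succ] at h2
      exact mul_right_cancel₀ hs0.ne' (by linarith)
    exact (pow_eq_one_iff_of_nonneg hs0.le hd).mp h3
  rw [hsV, sub_self, mul_zero] at hslope
  have hlog0 : Real.log (hvol v (c + (1 / 2 : ℝ) • k) / hvol v c) ≤ 0 := by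
    by_contra! hpos
    exact absurd hslope (not_le.mpr (by positivity))
  have h2 : hvol v (c + (1 / 2 : ℝ) • k) ≤ hvol v c := by
    rwa [Real.log_nonpos_iff (div_nonneg (hvol_nonneg _ _) hV.le), div_le_one hV] at hlog0
  rw [hsone, one_smul] at hk hvs
  refine translate_of_hvol_midpoint hv hw hc hc' ht ht' hvs.symm ?_
  rwa [show (1 / 2 : ℝ) • (c + c') = c + (1 / 2 : ℝ) • k by rw [hk]; module]

/-- Polyhedra with equal facial areas are translates of each other. -/
theorem translate_of_freeSlice_eq {v : Fin n → E (d + 1)} (hd : d ≠ 0) (hv : BddSys v)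
    (hunit : ∀ i, ‖v i‖ = 1) (hinj : Function.Injective v)
    {w : Fin n → E d →ₗᵢ[ℝ] E (d + 1)} (hw : ∀ i, IsFrame (v i) (w i)) {c c' : Fin n → ℝ}
    (hc : Strict v c) (hc' : Strict v c') (ht : ∀ i, ∃ x ∈ hpoly v c, ⟪x, v i⟫ = c i)
    (ht' : ∀ i, ∃ x ∈ hpoly v c', ⟪x, v i⟫ = c' i)
    (harea : ∀ i, freeSlice v (w i) i c (c i) = freeSlice v (w i) i c' (c' i)) :
    ∃ a : E (d + 1), ∀ i, c' i = c i + ⟪a, v i⟫ := by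
  rcases le_total (hvol v c') (hvol v c) with h | h
  · exact translate_of_hvol_le hd hv hunit hinj hw hc hc' ht ht' harea h
  · obtain ⟨a, ha⟩ := translate_of_hvol_le hd hv hunit hinj hw hc' hc ht' ht
      (fun i => (harea i).symm) h
    exact ⟨-a, fun i => by rw [ha i, inner_neg_left]; ring⟩

end Minkowski

/-- Minkowski's theorem in ℝ³: existence and uniqueness (up to translation) of a convex
polyhedron with prescribed face normals and face areas. -/
theorem minkowski_theorem {n : ℕ}
    (ν : Fin n → EuclideanSpace ℝ (Fin 3))
    (hunit : ∀ i, ‖ν i‖ = 1) (hdist : Function.Injective ν)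
    (hspan : Submodule.span ℝ (Set.range ν) = ⊤)
    (C : Fin n → ℝ) (hCpos : ∀ i, 0 < C i)
    (hsum : ∑ i, C i • ν i = 0) :
    (∃ h : Fin n → ℝ, IsCompact (polyQ ν h) ∧ (interior (polyQ ν h)).Nonempty ∧
      ∀ i, faceArea ν h i = C i) ∧
    ∀ h h' : Fin n → ℝ,
      (IsCompact (polyQ ν h) ∧ (interior (polyQ ν h)).Nonempty ∧
        ∀ i, faceArea ν h i = C i) →
      (IsCompact (polyQ ν h') ∧ (interior (polyQ ν h')).Nonempty ∧
        ∀ i, faceArea ν h' i = C i) →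
      ∃ a : EuclideanSpace ℝ (Fin 3), ∀ i, h' i = h i + ⟪a, ν i⟫ := by
  have hv : Minkowski.BddSys ν := Minkowski.bddSys_of_span hspan hCpos hsum
  have hv0 : ∀ j, ν j ≠ 0 := fun j h => by simpa [h] using hunit j
  have hn : NeZero n := ⟨by
    rintro rfl
    simp at hspan⟩
  choose w horth hdecomp hmp using fun i => Minkowski.exists_frame (hunit i)
  have hw : ∀ i, Minkowski.IsFrame (ν i) (w i) := fun i =>
    ⟨hunit i, horth i, hdecomp i, hmp i⟩
  obtain ⟨κ, hκ0, hκ⟩ := Minkowski.exists_hausdorffMeasure_eq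
  have harea : ∀ h i, faceArea ν h i = κ * Minkowski.freeSlice ν (w i) i h (h i) := fun h i =>
    Minkowski.toReal_hausdorffMeasure_face hκ (hw i) h
  constructor
  · obtain ⟨c, hc, μ, hμ, hcμ⟩ := Minkowski.exists_freeSlice_eq hv hunit hdist hw hCpos hsum
    set r := (√(κ * μ))⁻¹ with hr
    have hr0 : 0 < r := by positivity
    refine ⟨r • c, hv.isCompact _, Minkowski.Strict.interior_nonempty ?_, fun i => ?_⟩
    · refine Minkowski.strict_of_hvol_pos hv0 ?_
      rw [Minkowski.hvol_smul _ _ hr0]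
      exact mul_pos (pow_pos hr0 _) (hc.hvol_pos hv)
    · rw [harea, Minkowski.freeSlice_smul (hw i) c hr0, hcμ, hr, inv_pow,
        Real.sq_sqrt (by positivity)]
      field_simp
  · rintro h h' ⟨-, hi, ha⟩ ⟨-, hi', ha'⟩
    have htight : ∀ g : Fin n → ℝ, (∀ i, faceArea ν g i = C i) →
        ∀ i, ∃ x ∈ Minkowski.hpoly ν g, ⟪x, ν i⟫ = g i := fun g hg i => by
      by_contra! hne
      have hempty : polyQ ν g ∩ {x | ⟪x, ν i⟫ = g i} = ∅ :=
        Set.eq_empty_of_forall_notMem fun x hx => hne x hx.1 hx.2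
      have := hg i
      rw [faceArea, hempty, measure_empty, ENNReal.toReal_zero] at this
      exact (hCpos i).ne this
    refine Minkowski.translate_of_freeSlice_eq two_ne_zero hv hunit hdist hw
      (Minkowski.strict_of_interior hv0 hi) (Minkowski.strict_of_interior hv0 hi')
      (htight h ha) (htight h' ha') fun i => ?_
    have h1 := (harea h i).symm.trans ((ha i).trans ((ha' i).symm.trans (harea h' i)))
    exact mul_left_cancel₀ hκ0.ne' h1
end
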